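/- arXiv:1611.09728 — 9 statements merged into one kernel-verified Lean document; each statement's English description precedes it below -/
import Mathlib

section
/- Let P be a lattice polytope of dimension d in ℝ^d with h*-polynomial h*. Then there is a polynomial h_P ∈ ℤ[z] with (1−z)^{d+1} · Σ_{n≥1} L°_P(n) z^n = h_P(z) as formal power series over ℤ; moreover the coefficient of z^i in h_P equals the coefficient of z^{d+1−i} in h* for all 0 ≤ i ≤ d+1, and in particular h_P is a monic polynomial of degree d+1. -/
open scoped Pointwise
open Filter Topology

theorem eventually_pos_add_mul_iff (a b : ℝ) :
    ∀ᶠ ε in 𝓝[>] (0 : ℝ), (0 < a + ε * b ↔ 0 < a ∨ (a = 0 ∧ 0 < b)) := by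
  have hcont : Tendsto (fun ε : ℝ => a + ε * b) (𝓝[>] 0) (𝓝 a) := by
    have h : Continuous fun ε : ℝ => a + ε * b := by fun_prop
    have h0 := h.tendsto 0
    simp only [zero_mul, add_zero] at h0
    exact h0.mono_left nhdsWithin_le_nhds
  rcases lt_trichotomy a 0 with ha | rfl | ha
  · filter_upwards [hcont.eventually_lt_const ha] with ε hε
    constructor
    · intro h; linarith
    · rintro (h | h) <;> linarith [h]
  · filter_upwards [self_mem_nhdsWithin] with ε hε
    simp [mul_pos_iff_of_pos_left (Set.mem_Ioi.1 hε)]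
  · filter_upwards [hcont.eventually_const_lt ha] with ε hε
    simp [hε, ha]

section HalfOpen

variable {κ W : Type*} [AddCommGroup W] [Module ℝ W]

/-- The half-open simplicial cone spanned by a basis `b`: the points of the closed cone from which
one enters the interior of the cone when moving slightly in the direction `q`. -/
def halfOpenCone (b : Module.Basis κ ℝ W) (q : W) : Set W :=
  {x | ∀ i, 0 < b.repr x i ∨ (b.repr x i = 0 ∧ 0 < b.repr q i)}

/-- The points of `Λ` at height `n` in the half-open cone whose coordinates with index in `J` are
bounded as in the fundamental parallelepiped. -/
def cappedSlice (b : Module.Basis κ ℝ W) (q : W) (Λ : AddSubgroup W) (ht : W →ₗ[ℝ] ℝ)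
    (J : Set κ) (n : ℕ) : Set W :=
  {x | x ∈ Λ ∧ ht x = n ∧ x ∈ halfOpenCone b q ∧
    ∀ i ∈ J, b.repr x i < 1 ∨ (b.repr x i = 1 ∧ b.repr q i < 0)}

theorem halfOpenCone_nonneg {b : Module.Basis κ ℝ W} {q x : W} (hx : x ∈ halfOpenCone b q) (i : κ) :
    0 ≤ b.repr x i := by
  rcases hx i with h | h
  · exact h.le
  · exact h.1.ge

theorem cappedSlice_subset (b : Module.Basis κ ℝ W) (q : W) (Λ : AddSubgroup W) (ht : W →ₗ[ℝ] ℝ)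
    (J : Set κ) (n : ℕ) : cappedSlice b q Λ ht J n ⊆ cappedSlice b q Λ ht ∅ n := by
  rintro x ⟨h1, h2, h3, -⟩
  exact ⟨h1, h2, h3, by simp⟩

theorem sub_mem_halfOpenCone_iff {b : Module.Basis κ ℝ W} {q x : W}
    {i : κ} (hq : b.repr q i ≠ 0) (hx : x ∈ halfOpenCone b q) :
    x - b i ∈ halfOpenCone b q ↔ ¬ (b.repr x i < 1 ∨ (b.repr x i = 1 ∧ b.repr q i < 0)) := by
  classical
  constructor
  · intro h
    have := h i
    simp only [map_sub, Finsupp.sub_apply, b.repr_self, Finsupp.single_eq_same] at this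
    grind
  · intro h j
    by_cases hj : j = i
    · subst hj
      simp only [map_sub, Finsupp.sub_apply, b.repr_self, Finsupp.single_eq_same]
      grind
    · simpa [Finsupp.single_apply, Ne.symm hj] using hx j

theorem ncard_cappedSlice_succ (b : Module.Basis κ ℝ W) (q : W) (hq : ∀ i, b.repr q i ≠ 0)
    (Λ : AddSubgroup W) (hΛ : ∀ i, b i ∈ Λ) (ht : W →ₗ[ℝ] ℝ) (hb : ∀ i, ht (b i) = 1)
    (hfin : ∀ n, (cappedSlice b q Λ ht ∅ n).Finite) (J : Set κ) (i : κ) (hi : i ∉ J) (n : ℕ) :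
    (cappedSlice b q Λ ht J (n + 1)).ncard =
      (cappedSlice b q Λ ht (insert i J) (n + 1)).ncard + (cappedSlice b q Λ ht J n).ncard := by
  classical
  have hf (J n) : (cappedSlice b q Λ ht J n).Finite :=
    (hfin n).subset (cappedSlice_subset b q Λ ht J n)
  have hinj : Function.Injective fun x => x + b i := add_left_injective _
  rw [← Set.ncard_image_of_injective (cappedSlice b q Λ ht J n) hinj,
    ← Set.ncard_union_eq _ (hf _ _) ((hf _ _).image _)]
  · congr 1
    ext x
    simp only [Set.mem_union, Set.mem_image]
    constructor
    · intro hx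
      by_cases hc : b.repr x i < 1 ∨ (b.repr x i = 1 ∧ b.repr q i < 0)
      · left
        refine ⟨hx.1, hx.2.1, hx.2.2.1, ?_⟩
        rintro j (rfl | hj)
        · exact hc
        · exact hx.2.2.2 j hj
      · right
        refine ⟨x - b i, ⟨Λ.sub_mem hx.1 (hΛ i), ?_,
          (sub_mem_halfOpenCone_iff (hq i) hx.2.2.1).2 hc, ?_⟩, by simp⟩
        · rw [map_sub, hx.2.1, hb]; simp
        · intro j hj
          have hji : i ≠ j := fun h => hi (h ▸ hj)
          simpa [Finsupp.single_apply, hji] using hx.2.2.2 j hj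
    · rintro (hx | ⟨y, hy, rfl⟩)
      · exact ⟨hx.1, hx.2.1, hx.2.2.1, fun j hj => hx.2.2.2 j (Set.mem_insert_of_mem _ hj)⟩
      · refine ⟨Λ.add_mem hy.1 (hΛ i), by simp [hy.2.1, hb], ?_, ?_⟩
        · intro j
          by_cases hji : i = j
          · subst hji
            have := halfOpenCone_nonneg hy.2.2.1 i
            left
            simp only [map_add, Finsupp.add_apply, b.repr_self, Finsupp.single_eq_same]
            linarith
          · simpa [Finsupp.single_apply, hji] using hy.2.2.1 j
        · intro j hj
          have hji : i ≠ j := fun h => hi (h ▸ hj)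
          simpa [Finsupp.single_apply, hji] using hy.2.2.2 j hj
  · rw [Set.disjoint_left]
    rintro x hx ⟨y, hy, rfl⟩
    refine (sub_mem_halfOpenCone_iff (hq i) hx.2.2.1).1 ?_ (hx.2.2.2 i (Set.mem_insert _ _))
    simpa using hy.2.2.1

variable [Fintype κ]

theorem eventually_mem_interior_cone_iff (b : Module.Basis κ ℝ W) (q x : W) :
    ∀ᶠ ε in 𝓝[>] (0 : ℝ), ((∀ i, 0 < b.repr (x + ε • q) i) ↔ x ∈ halfOpenCone b q) := by
  have h := eventually_all.2 fun i => eventually_pos_add_mul_iff (b.repr x i) (b.repr q i)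
  filter_upwards [h] with ε hε
  simp only [map_add, map_smul, Finsupp.add_apply, Finsupp.smul_apply, smul_eq_mul, hε]
  rfl

theorem height_eq_sum_repr (b : Module.Basis κ ℝ W) (ht : W →ₗ[ℝ] ℝ) (hb : ∀ i, ht (b i) = 1)
    (x : W) : ht x = ∑ i, b.repr x i := by
  conv_lhs => rw [← b.sum_repr x, map_sum]
  simp only [map_smul, hb, smul_eq_mul, mul_one]

theorem cappedSlice_insert_zero (b : Module.Basis κ ℝ W) (q : W)
    (Λ : AddSubgroup W) (ht : W →ₗ[ℝ] ℝ) (hb : ∀ i, ht (b i) = 1) (J : Set κ) (i : κ) :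
    cappedSlice b q Λ ht (insert i J) 0 = cappedSlice b q Λ ht J 0 := by
  ext x
  constructor
  · intro hx
    exact ⟨hx.1, hx.2.1, hx.2.2.1, fun j hj => hx.2.2.2 j (Set.mem_insert_of_mem _ hj)⟩
  · intro hx
    refine ⟨hx.1, hx.2.1, hx.2.2.1, fun j _ => Or.inl ?_⟩
    have h0 := height_eq_sum_repr b ht hb x
    have h1 := Finset.single_le_sum (f := fun i => b.repr x i)
      (fun i _ => halfOpenCone_nonneg hx.2.2.1 i) (Finset.mem_univ j)
    simp only [hx.2.1, Nat.cast_zero] at h0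
    linarith

theorem one_sub_X_pow_mul_mk_ncard_cappedSlice (b : Module.Basis κ ℝ W) (q : W)
    (hq : ∀ i, b.repr q i ≠ 0) (Λ : AddSubgroup W) (hΛ : ∀ i, b i ∈ Λ) (ht : W →ₗ[ℝ] ℝ)
    (hb : ∀ i, ht (b i) = 1) (hfin : ∀ n, (cappedSlice b q Λ ht ∅ n).Finite) :
    (1 - PowerSeries.X) ^ Fintype.card κ *
        PowerSeries.mk (fun n => ((cappedSlice b q Λ ht ∅ n).ncard : ℤ)) =
      PowerSeries.mk (fun n => ((cappedSlice b q Λ ht Set.univ n).ncard : ℤ)) := by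
  classical
  suffices h : ∀ J : Finset κ, (1 - PowerSeries.X) ^ J.card *
      PowerSeries.mk (fun n => ((cappedSlice b q Λ ht ∅ n).ncard : ℤ)) =
      PowerSeries.mk (fun n => ((cappedSlice b q Λ ht J n).ncard : ℤ)) by
    simpa using h Finset.univ
  intro J
  induction J using Finset.induction_on with
  | empty => simp
  | insert i J hi ih =>
    rw [Finset.card_insert_of_notMem hi, pow_succ', mul_assoc, ih]
    ext n
    rw [sub_mul, one_mul, map_sub, Finset.coe_insert]
    cases n with
    | zero => simp [cappedSlice_insert_zero b q Λ ht hb]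
    | succ n =>
      rw [PowerSeries.coeff_succ_X_mul]
      simp only [PowerSeries.coeff_mk]
      rw [ncard_cappedSlice_succ b q hq Λ hΛ ht hb hfin J i (by simpa using hi) n]
      push_cast
      ring

theorem sub_mem_cappedSlice_univ {b : Module.Basis κ ℝ W} {q : W}
    {Λ : AddSubgroup W} (hΛ : ∀ i, b i ∈ Λ) {ht : W →ₗ[ℝ] ℝ}
    (hb : ∀ i, ht (b i) = 1) {m n : ℕ} (hmn : m + n = Fintype.card κ) {x : W}
    (hx : x ∈ cappedSlice b q Λ ht Set.univ m) :
    (∑ i, b i) - x ∈ cappedSlice b (-q) Λ ht Set.univ n := by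
  classical
  have hr (i) : b.repr ((∑ i, b i) - x) i = 1 - b.repr x i := by
    simp [Finsupp.single_apply]
  refine ⟨Λ.sub_mem (Λ.sum_mem fun i _ => hΛ i) hx.1, ?_, fun i => ?_, fun i _ => ?_⟩
  · have : (m : ℝ) + n = Fintype.card κ := by exact_mod_cast hmn
    simp [hb, hx.2.1]
    linarith
  · have := hx.2.2.2 i (Set.mem_univ i)
    rw [hr, map_neg, Finsupp.neg_apply]
    grind
  · have := hx.2.2.1 i
    rw [hr, map_neg, Finsupp.neg_apply]
    grind

theorem ncard_cappedSlice_neg (b : Module.Basis κ ℝ W) (q : W)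
    (Λ : AddSubgroup W) (hΛ : ∀ i, b i ∈ Λ) (ht : W →ₗ[ℝ] ℝ)
    (hb : ∀ i, ht (b i) = 1) {m n : ℕ} (hmn : m + n = Fintype.card κ) :
    (cappedSlice b q Λ ht Set.univ m).ncard = (cappedSlice b (-q) Λ ht Set.univ n).ncard := by
  have hinj : Function.Injective fun x => (∑ i, b i) - x := sub_right_injective
  rw [← Set.ncard_image_of_injective _ hinj]
  congr 1
  ext y
  constructor
  · rintro ⟨x, hx, rfl⟩
    exact sub_mem_cappedSlice_univ hΛ hb hmn hx
  · intro hy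
    refine ⟨(∑ i, b i) - y, ?_, by simp⟩
    have := sub_mem_cappedSlice_univ hΛ hb (m := n) (n := m) (by omega) hy
    rwa [neg_neg] at this

theorem cappedSlice_univ_eq_empty (b : Module.Basis κ ℝ W) (q : W)
    (Λ : AddSubgroup W) (ht : W →ₗ[ℝ] ℝ) (hb : ∀ i, ht (b i) = 1) {n : ℕ}
    (hn : Fintype.card κ < n) : cappedSlice b q Λ ht Set.univ n = ∅ := by
  rw [Set.eq_empty_iff_forall_notMem]
  intro x hx
  have h0 := height_eq_sum_repr b ht hb x
  have h1 : ∑ i, b.repr x i ≤ ∑ _i : κ, (1 : ℝ) := by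
    refine Finset.sum_le_sum fun i _ => ?_
    rcases hx.2.2.2 i (Set.mem_univ i) with h | h
    · exact h.le
    · exact h.1.le
  have h2 : (Fintype.card κ : ℝ) < n := by exact_mod_cast hn
  simp [← h0, hx.2.1] at h1
  exact absurd h1 (not_le.2 hn)

end HalfOpen

section Tiling

variable {ι W : Type*} [AddCommGroup W] [Module ℝ W]

/-- `y` lies in no proper subspace spanned by some of the vectors `w i`. -/
def IsGenericFor (w : ι → W) (y : W) : Prop :=
  ∀ s : Set ι, Submodule.span ℝ (w '' s) ≠ ⊤ → y ∉ Submodule.span ℝ (w '' s)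

theorem IsGenericFor.neg {w : ι → W} {q : W} (hq : IsGenericFor w q) : IsGenericFor w (-q) :=
  fun s hs h => hq s hs (by simpa using h)

theorem IsGenericFor.repr_ne_zero {w : ι → W} {q : W} (hq : IsGenericFor w q) {s : Set ι}
    (b : Module.Basis s ℝ W) (hb : ∀ i, b i = w i) (i : s) : b.repr q i ≠ 0 := by
  intro h0
  have himg : w '' (s \ {i.1}) = b '' {i}ᶜ := by
    ext x
    simp only [Set.mem_image, Set.mem_sdiff, Set.mem_singleton_iff, Set.mem_compl_iff, hb]
    constructor
    · rintro ⟨j, ⟨hj, hji⟩, rfl⟩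
      exact ⟨⟨j, hj⟩, fun h => hji (congrArg Subtype.val h), rfl⟩
    · rintro ⟨j, hj, rfl⟩
      exact ⟨j, ⟨j.2, fun h => hj (Subtype.ext h)⟩, rfl⟩
  refine hq (s \ {i.1}) ?_ ?_
  · intro htop
    refine b.linearIndependent.notMem_span_image (s := {i}ᶜ) (x := i) (by simp) ?_
    rw [← himg, htop]
    trivial
  · rw [himg, b.mem_span_image]
    intro j hj
    simp only [Set.mem_compl_iff, Set.mem_singleton_iff]
    rintro rfl
    simp [h0] at hj

variable [Fintype ι]

/-- The cone generated by the vectors `w i`. -/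
def conicSpan (w : ι → W) : Set W :=
  {x | ∃ l : ι → ℝ, (∀ i, 0 ≤ l i) ∧ ∑ i, l i • w i = x}

theorem add_mem_conicSpan {w : ι → W} {x y : W} (hx : x ∈ conicSpan w) (hy : y ∈ conicSpan w) :
    x + y ∈ conicSpan w := by
  obtain ⟨l, hl, rfl⟩ := hx
  obtain ⟨m, hm, rfl⟩ := hy
  exact ⟨l + m, fun i => add_nonneg (hl i) (hm i), by simp [add_smul, Finset.sum_add_distrib]⟩

theorem smul_mem_conicSpan {w : ι → W} {x : W} (hx : x ∈ conicSpan w) {t : ℝ} (ht : 0 ≤ t) :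
    t • x ∈ conicSpan w := by
  obtain ⟨l, hl, rfl⟩ := hx
  exact ⟨t • l, fun i => mul_nonneg ht (hl i), by simp [mul_smul, Finset.smul_sum]⟩

theorem mem_conicSpan_of_basis {s : Set ι} [Fintype s] {w : ι → W} (b : Module.Basis s ℝ W)
    (hb : ∀ i, b i = w i) {x : W} (hx : ∀ i, 0 ≤ b.repr x i) : x ∈ conicSpan w := by
  classical
  refine ⟨Function.extend Subtype.val (b.repr x) 0, fun i => ?_, ?_⟩
  · by_cases hi : i ∈ s
    · have : Function.extend Subtype.val (b.repr x) 0 i = b.repr x ⟨i, hi⟩ :=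
        Subtype.val_injective.extend_apply _ _ (⟨i, hi⟩ : s)
      rw [this]
      exact hx _
    · rw [Function.extend_apply']
      · rfl
      · rintro ⟨a, rfl⟩
        exact hi a.2
  · conv_rhs => rw [← b.sum_repr x]
    symm
    refine Fintype.sum_of_injective Subtype.val Subtype.val_injective _ _ (fun i hi => ?_)
      fun i => ?_
    · rw [Function.extend_apply' _ _ _ (by simpa using hi)]
      simp
    · rw [Subtype.val_injective.extend_apply, hb]

theorem exists_notMem_of_forall_ne_top {E α : Type*} [AddCommGroup E] [Module ℝ E] [Finite α]
    (p : α → Submodule ℝ E) : ∃ x, ∀ a, p a ≠ ⊤ → x ∉ p a := by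
  classical
  have := Fintype.ofFinite α
  have h := Subspace.biUnion_ne_univ_of_top_notMem
    (s := (Finset.univ.image p).filter (· ≠ ⊤)) (by simp)
  obtain ⟨x, hx⟩ := (Set.ne_univ_iff_exists_notMem _).1 h
  refine ⟨x, fun a ha hxa => hx ?_⟩
  simp only [Set.mem_iUnion]
  exact ⟨p a, by simpa using ha, hxa⟩

theorem exists_isGenericFor (w : ι → W) : ∃ q, IsGenericFor w q :=
  exists_notMem_of_forall_ne_top fun s : Set ι => Submodule.span ℝ (w '' s)

theorem eventually_isGenericFor {w : ι → W} {q : W} (hq : IsGenericFor w q) (x : W) :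
    ∀ᶠ ε in 𝓝[>] (0 : ℝ), IsGenericFor w (x + ε • q) := by
  refine eventually_all.2 fun s => ?_
  by_cases hs : Submodule.span ℝ (w '' s) = ⊤
  · simp [hs]
  have hsub : {ε : ℝ | x + ε • q ∈ Submodule.span ℝ (w '' s)}.Subsingleton := by
    intro a ha c hc
    by_contra hne
    refine hq s hs ?_
    have h : (x + a • q) - (x + c • q) ∈ Submodule.span ℝ (w '' s) :=
      Submodule.sub_mem _ ha hc
    rw [add_sub_add_left_eq_sub, ← sub_smul] at h
    exact (Submodule.smul_mem_iff _ (sub_ne_zero.2 hne)).1 h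
  have hclosed := (hsub.anti (Set.sdiff_subset (t := {0}))).finite.isClosed
  filter_upwards [nhdsWithin_le_nhds (hclosed.isOpen_compl.mem_nhds (x := 0) (by simp)),
    self_mem_nhdsWithin] with ε hε hpos _ hmem
  exact hε ⟨hmem, ne_of_gt hpos⟩

/-- There are costs `c` such that a linear form taking the value `c i` at `w i` for all `i` in a
spanning subfamily takes the value `c j` at no other `w j`. -/
theorem exists_generic_cost (w : ι → W) : ∃ c : ι → ℝ, ∀ (s : Set ι) (j : ι) (f : W →ₗ[ℝ] ℝ),
    Submodule.span ℝ (w '' s) = ⊤ → j ∉ s → (∀ i ∈ s, f (w i) = c i) → f (w j) ≠ c j := by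
  classical
  let p : Set ι × ι → Submodule ℝ (ι → ℝ) := fun a =>
    { carrier := {c | ∃ f : W →ₗ[ℝ] ℝ, ∀ i ∈ insert a.2 a.1, f (w i) = c i}
      add_mem' := by
        rintro c e ⟨f, hf⟩ ⟨g, hg⟩
        exact ⟨f + g, fun i hi => by simp [hf i hi, hg i hi]⟩
      zero_mem' := ⟨0, fun i _ => by simp⟩
      smul_mem' := by
        rintro t c ⟨f, hf⟩
        exact ⟨t • f, fun i hi => by simp [hf i hi]⟩ }
  obtain ⟨c, hc⟩ := exists_notMem_of_forall_ne_top p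
  refine ⟨c, fun s j f hs hj hf hfj => hc (s, j) ?_ ⟨f, ?_⟩⟩
  · intro htop
    have hmem : Pi.single j 1 ∈ p (s, j) := by rw [htop]; trivial
    obtain ⟨g, hg⟩ := hmem
    have hg0 : g = 0 := by
      refine LinearMap.ext_on (s := w '' s) hs ?_
      rintro _ ⟨i, hi, rfl⟩
      have hij : i ≠ j := fun h => hj (h ▸ hi)
      simpa [hij] using hg i (Set.mem_insert_of_mem _ hi)
    simpa [hg0] using hg j (Set.mem_insert _ _)
  · rintro i (rfl | hi)
    · exact hfj
    · exact hf i hi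

theorem exists_pos_forall_nonneg_add_mul (l m : ι → ℝ) (hl : ∀ i, 0 ≤ l i)
    (hm : ∀ i, m i < 0 → 0 < l i) : ∃ t > 0, ∀ i, 0 ≤ l i + t * m i := by
  have h := eventually_all.2 fun i => eventually_pos_add_mul_iff (l i) (m i)
  obtain ⟨t, ht, htpos⟩ := (h.and self_mem_nhdsWithin).exists
  refine ⟨t, htpos, fun i => ?_⟩
  rcases lt_or_ge (m i) 0 with hi | hi
  · exact ((ht i).2 (Or.inl (hm i hi))).le
  · exact add_nonneg (hl i) (mul_nonneg (le_of_lt htpos) hi)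

end Tiling

section NormedTiling

variable {ι W : Type*} [Fintype ι] [NormedAddCommGroup W] [NormedSpace ℝ W]

/-- A linear program over a bounded fibre of the cone has an optimal solution with linearly
independent support. -/
theorem exists_basic_optimal {w : ι → W} {ht : W →ₗ[ℝ] ℝ} (hw : ∀ i, ht (w i) = 1) (c : ι → ℝ)
    {y : W} (hy : y ∈ conicSpan w) :
    ∃ l : ι → ℝ, (∀ i, 0 ≤ l i) ∧ ∑ i, l i • w i = y ∧ LinearIndepOn ℝ w {i | l i ≠ 0} ∧
      ∀ l' : ι → ℝ, (∀ i, 0 ≤ l' i) → ∑ i, l' i • w i = y → ∑ i, c i * l i ≤ ∑ i, c i * l' i := by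
  classical
  let F : Set (ι → ℝ) := {l | (∀ i, 0 ≤ l i) ∧ ∑ i, l i • w i = y}
  have hFc : IsCompact F := by
    have hcl : IsClosed F := by
      refine IsClosed.inter ?_ (isClosed_eq (by fun_prop) continuous_const)
      exact isClosed_le (f := fun _ : ι → ℝ => (0 : ι → ℝ)) continuous_const continuous_id
    refine (isCompact_Icc (a := (0 : ι → ℝ)) (b := fun _ => ht y)).of_isClosed_subset hcl ?_
    rintro l ⟨hl, rfl⟩
    refine ⟨hl, fun i => ?_⟩
    simp only [map_sum, map_smul, hw, smul_eq_mul, mul_one]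
    exact Finset.single_le_sum (fun j _ => hl j) (Finset.mem_univ i)
  have hcost : Continuous fun l : ι → ℝ => ∑ i, c i * l i := by fun_prop
  let M : Set (ι → ℝ) := {l | l ∈ F ∧ ∀ l' ∈ F, ∑ i, c i * l i ≤ ∑ i, c i * l' i}
  have hMne : M.Nonempty := by
    obtain ⟨l, hl, hmin⟩ := hFc.exists_isMinOn hy hcost.continuousOn
    exact ⟨l, hl, fun l' hl' => hmin hl'⟩
  have hMc : IsCompact M := by
    have hcl : IsClosed {l : ι → ℝ | ∀ l' ∈ F, ∑ i, c i * l i ≤ ∑ i, c i * l' i} := by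
      simp only [Set.ofPred_forall]
      exact isClosed_biInter fun l' _ => isClosed_le hcost continuous_const
    exact hFc.inter_right hcl
  obtain ⟨l, hl⟩ := hMc.extremePoints_nonempty hMne
  rw [mem_extremePoints] at hl
  obtain ⟨⟨⟨hl0, hly⟩, hmin⟩, hext⟩ := hl
  refine ⟨l, hl0, hly, ?_, fun l' h0 h1 => hmin l' ⟨h0, h1⟩⟩
  rw [linearIndepOn_iff]
  intro μ hμ hμ0
  have hμ0' : ∑ i, μ i • w i = 0 := by
    rw [Finsupp.linearCombination_apply, Finsupp.sum_fintype _ _ (by simp)] at hμ0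
    exact hμ0
  have hsupp (i) (hi : μ i ≠ 0) : 0 < l i :=
    lt_of_le_of_ne (hl0 i) (Ne.symm (hμ (Finsupp.mem_support_iff.2 hi)))
  obtain ⟨t, ht0, htp⟩ := exists_pos_forall_nonneg_add_mul l (fun i => -|μ i|) hl0
    (fun i hi => hsupp i (by rintro h; simp [h] at hi))
  have hmemF (e : ℝ) (he : |e| = 1) : (fun i => l i + (t * e) * μ i) ∈ F := by
    constructor
    · intro i
      have h1 : -|μ i| ≤ e * μ i := by
        have := neg_abs_le (e * μ i)
        rwa [abs_mul, he, one_mul] at this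
      have := htp i
      have := mul_le_mul_of_nonneg_left h1 ht0.le
      simp only [mul_assoc]
      linarith
    · simp only [add_smul, Finset.sum_add_distrib, hly, mul_smul (t * e), ← Finset.smul_sum, hμ0',
        smul_zero, add_zero]
  have hcost' (e : ℝ) : ∑ i, c i * (l i + (t * e) * μ i) =
      ∑ i, c i * l i + e * (t * ∑ i, c i * μ i) := by
    simp only [mul_add, Finset.sum_add_distrib, Finset.mul_sum]
    congr 1
    exact Finset.sum_congr rfl fun i _ => by ring
  have hp := hmin _ (hmemF 1 (by simp))
  have hn := hmin _ (hmemF (-1) (by simp))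
  rw [hcost'] at hp hn
  have hzero : t * ∑ i, c i * μ i = 0 := by linarith
  have hmemM (e : ℝ) (he : |e| = 1) : (fun i => l i + (t * e) * μ i) ∈ M := by
    refine ⟨hmemF e he, fun l' hl' => ?_⟩
    rw [hcost', hzero, mul_zero, add_zero]
    exact hmin l' hl'
  have h := (hext _ (hmemM 1 (by simp)) _ (hmemM (-1) (by simp)) ?_).1
  · ext i
    have := congrFun h i
    simpa [ht0.ne'] using this
  · refine ⟨1 / 2, 1 / 2, by norm_num, by norm_num, by norm_num, ?_⟩
    ext i
    simp
    ring

theorem exists_generic_tiling (w : ι → W) (ht : W →ₗ[ℝ] ℝ) (hw : ∀ i, ht (w i) = 1) :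
    ∃ (T : Set (Set ι)) (b : ∀ s : T, Module.Basis s.1 ℝ W), (∀ s i, b s i = w i) ∧
      ∀ y ∈ conicSpan w, IsGenericFor w y → ∃! s : T, ∀ i, 0 < (b s).repr y i := by
  classical
  obtain ⟨c, hc⟩ := exists_generic_cost w
  let T : Set (Set ι) := {s | LinearIndepOn ℝ w s ∧ Submodule.span ℝ (w '' s) = ⊤ ∧
    ∃ f : W →ₗ[ℝ] ℝ, (∀ i ∈ s, f (w i) = c i) ∧ ∀ j ∉ s, f (w j) < c j}
  let b : ∀ s : T, Module.Basis s.1 ℝ W := fun s =>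
    Module.Basis.mk (v := fun i : s.1 => w i) s.2.1 (by rw [← s.2.2.1, Set.image_eq_range])
  have hb (s : T) (i) : b s i = w i := Module.Basis.mk_apply _ _ i
  refine ⟨T, b, hb, fun y hy hgen => ?_⟩
  have hfy (s : T) (f : W →ₗ[ℝ] ℝ) : f y = ∑ i, (b s).repr y i * f (w i) := by
    conv_lhs => rw [← (b s).sum_repr y, map_sum]
    simp [hb]
  apply existsUnique_of_exists_of_unique
  · obtain ⟨l, hl0, hly, hind, hmin⟩ := exists_basic_optimal hw c hy
    set s : Set ι := {i | l i ≠ 0} with hs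
    have hsum : ∑ i : s, l i • w i = y := by
      rw [← hly]
      refine Fintype.sum_of_injective Subtype.val Subtype.val_injective _ _ (fun i hi => ?_)
        fun i => rfl
      have : l i = 0 := by simpa [hs] using hi
      simp [this]
    have hspan : Submodule.span ℝ (w '' s) = ⊤ := by
      by_contra hne
      refine hgen s hne ?_
      rw [← hsum]
      exact Submodule.sum_mem _ fun i _ =>
        Submodule.smul_mem _ _ (Submodule.subset_span ⟨i, i.2, rfl⟩)
    let B : Module.Basis s ℝ W :=
      Module.Basis.mk (v := fun i : s => w i) hind (by rw [← hspan, Set.image_eq_range])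
    have hB (i) : B i = w i := Module.Basis.mk_apply _ _ i
    let f : W →ₗ[ℝ] ℝ := B.constr ℝ fun i => c i
    have hf (i : s) : f (w i) = c i := by rw [← hB]; exact B.constr_basis ℝ _ i
    have hsT : s ∈ T := by
      refine ⟨hind, hspan, f, fun i hi => hf ⟨i, hi⟩, fun j hj => ?_⟩
      by_contra hlt
      have hgt : c j < f (w j) :=
        lt_of_le_of_ne (not_lt.1 hlt) (hc s j f hspan hj fun i hi => hf ⟨i, hi⟩).symm
      let a : ι → ℝ := Function.extend Subtype.val (B.repr (w j)) 0
      have ha (i : s) : a i = B.repr (w j) i := Subtype.val_injective.extend_apply _ _ i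
      have ha' (i) (hi : i ∉ s) : a i = 0 :=
        Function.extend_apply' _ _ _ (by rintro ⟨k, rfl⟩; exact hi k.2)
      have hsuma : ∑ i, a i • w i = w j := by
        conv_rhs => rw [← B.sum_repr (w j)]
        symm
        refine Fintype.sum_of_injective Subtype.val Subtype.val_injective _ _ (fun i hi => ?_)
          fun i => by rw [ha, hB]
        rw [ha' i (by simpa using hi), zero_smul]
      have hcosta : ∑ i, c i * a i = f (w j) := by
        conv_rhs => rw [← B.sum_repr (w j), map_sum]
        symm
        refine Fintype.sum_of_injective Subtype.val Subtype.val_injective _ _ (fun i hi => ?_)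
          fun i => ?_
        · rw [ha' i (by simpa using hi), mul_zero]
        · rw [ha, map_smul, hB, hf, smul_eq_mul, mul_comm]
      let μ : ι → ℝ := Pi.single j 1 - a
      obtain ⟨t, ht0, htp⟩ := exists_pos_forall_nonneg_add_mul l μ hl0 (by
        intro i hi
        by_cases his : i ∈ s
        · exact lt_of_le_of_ne (hl0 i) (Ne.symm his)
        · exfalso
          have : 0 ≤ μ i := by
            simp only [μ, Pi.sub_apply, ha' i his, sub_zero, Pi.single_apply]
            split_ifs <;> norm_num
          linarith)
      have h1 := hmin (fun i => l i + t * μ i) htp (by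
        simp only [add_smul, Finset.sum_add_distrib, hly, mul_smul, ← Finset.smul_sum, μ,
          Pi.sub_apply, sub_smul, Finset.sum_sub_distrib, hsuma]
        simp [Pi.single_apply])
      have h2 : ∑ i, c i * (l i + t * μ i) = ∑ i, c i * l i + t * (c j - f (w j)) := by
        rw [← hcosta]
        simp only [μ, Pi.sub_apply, mul_add, Finset.sum_add_distrib, mul_sub, mul_left_comm _ t,
          Finset.sum_sub_distrib, ← Finset.mul_sum]
        simp [Pi.single_apply]
      rw [h2] at h1
      have := mul_pos ht0 (sub_pos.2 hgt)
      linarith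
    refine ⟨⟨s, hsT⟩, fun i => ?_⟩
    have hrepr : (b ⟨s, hsT⟩).repr y i = l i := by
      have h : y = ∑ i : s, l i • b ⟨s, hsT⟩ i := by
        rw [← hsum]
        exact Finset.sum_congr rfl fun i _ => by rw [hb]
      rw [h]
      exact congrFun (Module.Basis.repr_sum_self (b ⟨s, hsT⟩) fun i : s => l i) i
    rw [hrepr]
    exact lt_of_le_of_ne (hl0 i) (Ne.symm i.2)
  · have key (s s' : T) (hs : ∀ i, 0 < (b s).repr y i) (hs' : ∀ i, 0 < (b s').repr y i)
        (f f' : W →ₗ[ℝ] ℝ) (hf : ∀ i ∈ s.1, f (w i) = c i) (hf' : ∀ i ∈ s'.1, f' (w i) = c i)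
        (hfj : ∀ j ∉ s.1, f (w j) < c j) : f y ≤ f' y ∧ (f y = f' y → s'.1 ⊆ s.1) := by
      have hle (i : s'.1) : (b s').repr y i * f (w i) ≤ (b s').repr y i * f' (w i) := by
        refine mul_le_mul_of_nonneg_left ?_ (hs' i).le
        rw [hf' i i.2]
        by_cases hi : i.1 ∈ s.1
        · exact (hf i hi).le
        · exact (hfj i hi).le
      rw [hfy s' f, hfy s' f']
      refine ⟨Finset.sum_le_sum fun i _ => hle i, fun heq i hi => ?_⟩
      by_contra his
      have := (Finset.sum_eq_sum_iff_of_le fun i _ => hle i).1 heq ⟨i, hi⟩ (Finset.mem_univ _)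
      have := mul_left_cancel₀ (hs' ⟨i, hi⟩).ne' this
      rw [hf' i hi] at this
      exact (hfj i his).ne this
    intro s s' hs hs'
    obtain ⟨f, hf, hfj⟩ := s.2.2.2
    obtain ⟨f', hf', hfj'⟩ := s'.2.2.2
    have h1 := key s s' hs hs' f f' hf hf' hfj
    have h2 := key s' s hs' hs f' f hf' hf hfj'
    have heq := le_antisymm h1.1 h2.1
    exact Subtype.ext (subset_antisymm (h2.2 heq.symm) (h1.2 heq))

end NormedTiling

section Reciprocity

variable {ι W : Type*} [Fintype ι] [NormedAddCommGroup W] [NormedSpace ℝ W]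

theorem existsUnique_mem_halfOpenCone {w : ι → W} {T : Set (Set ι)}
    {b : ∀ s : T, Module.Basis s.1 ℝ W}
    (htile : ∀ y ∈ conicSpan w, IsGenericFor w y → ∃! s : T, ∀ i, 0 < (b s).repr y i)
    {q : W} (hq : IsGenericFor w q) {x : W} (hx : ∀ᶠ ε in 𝓝[>] (0 : ℝ), x + ε • q ∈ conicSpan w) :
    ∃! s : T, x ∈ halfOpenCone (b s) q := by
  classical
  have hall := eventually_all.2 fun s : T => eventually_mem_interior_cone_iff (b s) q x
  obtain ⟨ε, ⟨h1, h2⟩, h3⟩ := ((hall.and hx).and (eventually_isGenericFor hq x)).exists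
  simpa only [h1] using htile _ h2 h3

theorem add_smul_mem_interior_conicSpan {w : ι → W} {x q : W} (hx : x ∈ conicSpan w)
    (hq : q ∈ interior (conicSpan w)) {t : ℝ} (ht : 0 < t) :
    x + t • q ∈ interior (conicSpan w) := by
  rw [mem_interior_iff_mem_nhds] at hq ⊢
  have hcont : ContinuousAt (fun y => t⁻¹ • (y - x)) (x + t • q) := by fun_prop
  have hval : t⁻¹ • ((x + t • q) - x) = q := by
    rw [add_sub_cancel_left, inv_smul_smul₀ ht.ne']
  filter_upwards [hcont.preimage_mem_nhds (hval.symm ▸ hq)] with y hy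
  have := add_mem_conicSpan hx (smul_mem_conicSpan hy ht.le)
  rwa [smul_inv_smul₀ ht.ne', add_sub_cancel] at this

theorem exists_isGenericFor_mem_interior {w : ι → W} (hnonempty : (interior (conicSpan w)).Nonempty) :
    ∃ q ∈ interior (conicSpan w), IsGenericFor w q := by
  obtain ⟨p, hp⟩ := hnonempty
  obtain ⟨q, hq⟩ := exists_isGenericFor w
  have hcont : Tendsto (fun ε : ℝ => p + ε • q) (𝓝[>] 0) (𝓝 p) := by
    have h : Continuous fun ε : ℝ => p + ε • q := by fun_prop
    have h0 := h.tendsto 0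
    simp only [zero_smul, add_zero] at h0
    exact h0.mono_left nhdsWithin_le_nhds
  obtain ⟨ε, h1, h2⟩ :=
    ((hcont.eventually (isOpen_interior.mem_nhds hp)).and (eventually_isGenericFor hq p)).exists
  exact ⟨_, h1, h2⟩

theorem ncard_eq_sum_ncard_cappedSlice {T : Set (Set ι)}
    [Fintype T] (b : ∀ s : T, Module.Basis s.1 ℝ W) (q : W) (Λ : AddSubgroup W)
    (ht : W →ₗ[ℝ] ℝ) {D : Set W} (hD : ∀ x ∈ D, ∃! s : T, x ∈ halfOpenCone (b s) q)
    (hsub : ∀ s : T, halfOpenCone (b s) q ⊆ D) (n : ℕ)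
    (hfin : {x | x ∈ Λ ∧ ht x = n ∧ x ∈ D}.Finite) :
    {x | x ∈ Λ ∧ ht x = n ∧ x ∈ D}.ncard = ∑ s : T, (cappedSlice (b s) q Λ ht ∅ n).ncard := by
  have hunion : {x | x ∈ Λ ∧ ht x = n ∧ x ∈ D} = ⋃ s : T, cappedSlice (b s) q Λ ht ∅ n := by
    ext x
    simp only [Set.mem_iUnion]
    constructor
    · rintro ⟨h1, h2, h3⟩
      obtain ⟨s, hs, -⟩ := hD x h3
      exact ⟨s, h1, h2, hs, by simp⟩
    · rintro ⟨s, h1, h2, h3, -⟩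
      exact ⟨h1, h2, hsub s h3⟩
  rw [hunion, Set.ncard_iUnion_of_finite, finsum_eq_sum_of_fintype]
  · rw [hunion] at hfin
    exact fun s => hfin.subset (Set.subset_iUnion (fun s => cappedSlice (b s) q Λ ht ∅ n) s)
  · intro s s' hss
    refine Set.disjoint_left.2 fun x hx hx' => hss ?_
    exact (hD x (hsub s hx.2.2.1)).unique hx.2.2.1 hx'.2.2.1

theorem one_sub_X_pow_mul_mk_ncard {w : ι → W} {ht : W →ₗ[ℝ] ℝ} (hw : ∀ i, ht (w i) = 1)
    {T : Set (Set ι)} [∀ s : T, Fintype s.1] [Fintype T] (b : ∀ s : T, Module.Basis s.1 ℝ W)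
    (hb : ∀ s i, b s i = w i) {q : W} (hq : IsGenericFor w q) (Λ : AddSubgroup W)
    (hΛ : ∀ i, w i ∈ Λ) {D : Set W} (hD : ∀ x ∈ D, ∃! s : T, x ∈ halfOpenCone (b s) q)
    (hsub : ∀ s : T, halfOpenCone (b s) q ⊆ D)
    (hfin : ∀ n : ℕ, {x | x ∈ Λ ∧ ht x = n ∧ x ∈ D}.Finite) :
    (1 - PowerSeries.X) ^ Module.finrank ℝ W *
        PowerSeries.mk (fun n : ℕ => ({x | x ∈ Λ ∧ ht x = n ∧ x ∈ D}.ncard : ℤ)) =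
      PowerSeries.mk fun n => ∑ s : T, ((cappedSlice (b s) q Λ ht Set.univ n).ncard : ℤ) := by
  have hsum (A : T → ℕ → ℤ) : PowerSeries.mk (fun n => ∑ s : T, A s n) =
      ∑ s : T, PowerSeries.mk (A s) := by
    ext n
    simp
  have hcount (n : ℕ) := ncard_eq_sum_ncard_cappedSlice b q Λ ht hD hsub n (hfin n)
  simp only [hcount, Nat.cast_sum, hsum, Finset.mul_sum]
  refine Finset.sum_congr rfl fun s _ => ?_
  rw [Module.finrank_eq_card_basis (b s)]
  refine one_sub_X_pow_mul_mk_ncard_cappedSlice (b s) q (hq.repr_ne_zero (b s) (hb s)) Λ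
    (fun i => by rw [hb]; exact hΛ i) ht (fun i => by rw [hb, hw]) fun n => ?_
  exact (hfin n).subset fun x hx => ⟨hx.1, hx.2.1, hsub s hx.2.2.1⟩

/-- Reciprocity for the cone over a lattice polytope. -/
theorem conicSpan_reciprocity {w : ι → W} {ht : W →ₗ[ℝ] ℝ} (hw : ∀ i, ht (w i) = 1)
    (Λ : AddSubgroup W) (hΛ : ∀ i, w i ∈ Λ) (hnonempty : (interior (conicSpan w)).Nonempty)
    (hfin : ∀ n : ℕ, {x | x ∈ Λ ∧ ht x = n ∧ x ∈ conicSpan w}.Finite) :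
    ∃ a a' : ℕ → ℤ,
      (1 - PowerSeries.X) ^ Module.finrank ℝ W * PowerSeries.mk
        (fun n : ℕ => ({x | x ∈ Λ ∧ ht x = n ∧ x ∈ conicSpan w}.ncard : ℤ)) =
          PowerSeries.mk a ∧
      (1 - PowerSeries.X) ^ Module.finrank ℝ W * PowerSeries.mk
        (fun n : ℕ => ({x | x ∈ Λ ∧ ht x = n ∧ x ∈ interior (conicSpan w)}.ncard : ℤ)) =
          PowerSeries.mk a' ∧
      (∀ i j, j + i = Module.finrank ℝ W → a' i = a j) ∧
      ∀ n, Module.finrank ℝ W < n → a' n = 0 := by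
  classical
  obtain ⟨T, b, hb, htile⟩ := exists_generic_tiling w ht hw
  obtain ⟨q, hqint, hq⟩ := exists_isGenericFor_mem_interior hnonempty
  have hbΛ (s : T) (i) : b s i ∈ Λ := by rw [hb]; exact hΛ i
  have hbht (s : T) (i) : ht (b s i) = 1 := by rw [hb, hw]
  refine ⟨_, _, one_sub_X_pow_mul_mk_ncard hw b hb hq Λ hΛ (fun x hx => ?_) (fun s x hx => ?_) hfin,
    one_sub_X_pow_mul_mk_ncard hw b hb hq.neg Λ hΛ (fun x hx => ?_) (fun s x hx => ?_)
      fun n => (hfin n).subset fun x hx => ⟨hx.1, hx.2.1, interior_subset hx.2.2⟩,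
    fun i j hij => ?_, fun n hn => ?_⟩
  · refine existsUnique_mem_halfOpenCone htile hq ?_
    filter_upwards [self_mem_nhdsWithin] with ε hε
    exact add_mem_conicSpan hx (smul_mem_conicSpan (interior_subset hqint) (le_of_lt hε))
  · exact mem_conicSpan_of_basis (b s) (hb s) fun i => halfOpenCone_nonneg hx i
  · refine existsUnique_mem_halfOpenCone htile hq.neg ?_
    have hcont : Tendsto (fun ε : ℝ => x + ε • -q) (𝓝[>] 0) (𝓝 x) := by
      have h : Continuous fun ε : ℝ => x + ε • -q := by fun_prop
      have h0 := h.tendsto 0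
      simp only [zero_smul, add_zero] at h0
      exact h0.mono_left nhdsWithin_le_nhds
    exact hcont.eventually (mem_interior_iff_mem_nhds.1 hx)
  · obtain ⟨ε, h1, hε⟩ :=
      ((eventually_mem_interior_cone_iff (b s) (-q) x).and self_mem_nhdsWithin).exists
    have hmem := mem_conicSpan_of_basis (b s) (hb s) fun i => (h1.2 hx i).le
    have := add_smul_mem_interior_conicSpan hmem hqint hε
    rwa [smul_neg, neg_add_cancel_right] at this
  · refine Finset.sum_congr rfl fun s _ => ?_
    rw [Module.finrank_eq_card_basis (b s)] at hij
    rw [ncard_cappedSlice_neg (b s) q Λ (hbΛ s) ht (hbht s) hij]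
  · refine Finset.sum_eq_zero fun s _ => ?_
    rw [Module.finrank_eq_card_basis (b s)] at hn
    rw [cappedSlice_univ_eq_empty (b s) _ Λ ht (hbht s) hn]
    simp

end Reciprocity

section Homogenization

variable {d : ℕ}

/-- The lattice of points of `ℝ^d × ℝ` with integral coordinates. -/
def integralLattice (d : ℕ) : AddSubgroup ((Fin d → ℝ) × ℝ) where
  carrier := {x | (∀ i, ∃ k : ℤ, x.1 i = k) ∧ ∃ k : ℤ, x.2 = k}
  add_mem' := by
    rintro x y ⟨hx, k, hk⟩ ⟨hy, l, hl⟩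
    refine ⟨fun i => ?_, k + l, by simp [hk, hl]⟩
    obtain ⟨m, hm⟩ := hx i
    obtain ⟨n, hn⟩ := hy i
    exact ⟨m + n, by simp [hm, hn]⟩
  zero_mem' := ⟨fun _ => ⟨0, by simp⟩, 0, by simp⟩
  neg_mem' := by
    rintro x ⟨hx, k, hk⟩
    refine ⟨fun i => ?_, -k, by simp [hk]⟩
    obtain ⟨m, hm⟩ := hx i
    exact ⟨-m, by simp [hm]⟩

theorem setOf_integralLattice_eq_image (n : ℕ) (D : Set ((Fin d → ℝ) × ℝ)) :
    {x | x ∈ integralLattice d ∧ LinearMap.snd ℝ (Fin d → ℝ) ℝ x = n ∧ x ∈ D} =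
      (fun x : Fin d → ℤ => ((fun i => (x i : ℝ)), (n : ℝ))) ''
        {x | ((fun i => (x i : ℝ)), (n : ℝ)) ∈ D} := by
  ext ⟨x, t⟩
  simp only [Set.mem_image]
  constructor
  · rintro ⟨⟨hx, -⟩, ht, hD⟩
    simp only [LinearMap.snd_apply] at ht
    choose k hk using hx
    obtain rfl : x = fun i => (k i : ℝ) := funext hk
    subst ht
    exact ⟨k, hD, rfl⟩
  · rintro ⟨k, hk, h⟩
    rw [← h]
    exact ⟨⟨fun i => ⟨k i, rfl⟩, n, by simp⟩, rfl, hk⟩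

theorem intCast_pair_injective (n : ℕ) :
    Function.Injective fun x : Fin d → ℤ => ((fun i => (x i : ℝ)), (n : ℝ)) := by
  intro x y h
  ext i
  exact Int.cast_injective (α := ℝ) (congrFun (congrArg Prod.fst h) i)

variable (V : Finset (Fin d → ℝ))

/-- The cone over the convex hull of `V` placed at height one. -/
abbrev homogenizedCone : Set ((Fin d → ℝ) × ℝ) :=
  conicSpan fun v : V => ((v : Fin d → ℝ), (1 : ℝ))

theorem mem_homogenizedCone_iff_of_pos {x : Fin d → ℝ} {t : ℝ} (ht : 0 < t) :
    (x, t) ∈ homogenizedCone V ↔ x ∈ t • convexHull ℝ (V : Set (Fin d → ℝ)) := by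
  classical
  rw [Set.mem_smul_set_iff_inv_smul_mem₀ ht.ne', Finset.mem_convexHull']
  constructor
  · rintro ⟨l, hl, h⟩
    rw [Prod.ext_iff, Prod.fst_sum, Prod.snd_sum] at h
    simp only [Prod.smul_mk, smul_eq_mul, mul_one] at h
    have hex (v : V) : Function.extend Subtype.val l 0 v.1 = l v :=
      Subtype.val_injective.extend_apply _ _ v
    refine ⟨fun v => t⁻¹ * Function.extend Subtype.val l 0 v, fun v hv => ?_, ?_, ?_⟩
    · exact mul_nonneg (inv_nonneg.2 ht.le) ((hl ⟨v, hv⟩).trans_eq (hex ⟨v, hv⟩).symm)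
    · rw [← Finset.mul_sum, ← Finset.sum_coe_sort]
      simp only [hex, h.2]
      exact inv_mul_cancel₀ ht.ne'
    · rw [← Finset.sum_coe_sort]
      simp only [hex, mul_smul, ← Finset.smul_sum, h.1]
  · rintro ⟨c, hc, hsum, hx⟩
    refine ⟨fun v => t * c v, fun v => mul_nonneg ht.le (hc v v.2), ?_⟩
    rw [Prod.ext_iff, Prod.fst_sum, Prod.snd_sum]
    simp only [Prod.smul_mk, smul_eq_mul, mul_one, mul_smul, ← Finset.smul_sum, ← Finset.mul_sum]
    rw [Finset.sum_coe_sort V c, Finset.sum_coe_sort V fun v => c v • v, hsum, hx,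
      smul_inv_smul₀ ht.ne', mul_one]
    exact ⟨rfl, rfl⟩

theorem nonneg_of_mem_homogenizedCone {x : (Fin d → ℝ) × ℝ} (hx : x ∈ homogenizedCone V) :
    0 ≤ x.2 := by
  obtain ⟨l, hl, rfl⟩ := hx
  rw [Prod.snd_sum]
  exact Finset.sum_nonneg fun v _ => by simpa using hl v

theorem mem_homogenizedCone_zero_iff {x : Fin d → ℝ} :
    (x, (0 : ℝ)) ∈ homogenizedCone V ↔ x = 0 := by
  constructor
  · rintro ⟨l, hl, h⟩
    rw [Prod.ext_iff, Prod.fst_sum, Prod.snd_sum] at h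
    simp only [Prod.smul_mk, smul_eq_mul, mul_one] at h
    have h0 := (Finset.sum_eq_zero_iff_of_nonneg fun v _ => hl v).1 h.2
    rw [← h.1]
    exact Finset.sum_eq_zero fun v hv => by rw [h0 v hv, zero_smul]
  · rintro rfl
    exact ⟨0, fun _ => le_rfl, by simp; rfl⟩

theorem mem_interior_homogenizedCone_iff_of_pos {x : Fin d → ℝ} {t : ℝ} (ht : 0 < t) :
    (x, t) ∈ interior (homogenizedCone V) ↔
      x ∈ interior (t • convexHull ℝ (V : Set (Fin d → ℝ))) := by
  constructor
  · intro h
    rw [mem_interior_iff_mem_nhds] at h ⊢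
    have hcont : ContinuousAt (fun y : Fin d → ℝ => (y, t)) x := by fun_prop
    filter_upwards [hcont.preimage_mem_nhds h] with y hy
    exact (mem_homogenizedCone_iff_of_pos V ht).1 hy
  · intro h
    rw [interior_smul₀ ht.ne', Set.mem_smul_set_iff_inv_smul_mem₀ ht.ne',
      mem_interior_iff_mem_nhds] at h
    rw [mem_interior_iff_mem_nhds]
    have hcont : ContinuousAt (fun y : (Fin d → ℝ) × ℝ => y.2⁻¹ • y.1) (x, t) :=
      (continuousAt_snd.inv₀ ht.ne').smul continuousAt_fst
    filter_upwards [hcont.preimage_mem_nhds h,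
      continuousAt_snd.preimage_mem_nhds (Ioi_mem_nhds ht)] with y hy hpos
    rw [← Prod.mk.eta (p := y), mem_homogenizedCone_iff_of_pos V hpos,
      Set.mem_smul_set_iff_inv_smul_mem₀ (ne_of_gt hpos)]
    exact hy

theorem notMem_interior_homogenizedCone_zero (x : Fin d → ℝ) :
    (x, (0 : ℝ)) ∉ interior (homogenizedCone V) := by
  intro h
  rw [mem_interior_iff_mem_nhds] at h
  have hcont : ContinuousAt (fun t : ℝ => (x, t)) 0 := by fun_prop
  have hev : ∀ᶠ t in 𝓝[<] (0 : ℝ), (x, t) ∈ homogenizedCone V :=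
    nhdsWithin_le_nhds (hcont.preimage_mem_nhds h)
  obtain ⟨t, h1, h2⟩ := (hev.and self_mem_nhdsWithin).exists
  exact absurd (nonneg_of_mem_homogenizedCone V h1) (not_le.2 h2)

theorem finite_intCast_preimage_of_isBounded {S : Set (Fin d → ℝ)} (hS : Bornology.IsBounded S) :
    {x : Fin d → ℤ | (fun i => (x i : ℝ)) ∈ S}.Finite := by
  obtain ⟨R, hR⟩ := hS.exists_norm_le
  refine (Set.finite_Icc (fun _ : Fin d => -⌈R⌉) fun _ => ⌈R⌉).subset fun x hx => ?_
  have h (i : Fin d) : |(x i : ℝ)| ≤ ⌈R⌉ :=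
    ((norm_le_pi_norm (fun i => (x i : ℝ)) i).trans (hR _ hx)).trans (Int.le_ceil R)
  exact ⟨fun i => by exact_mod_cast (abs_le.1 (h i)).1,
    fun i => by exact_mod_cast (abs_le.1 (h i)).2⟩

end Homogenization

/-- **Corollary (Ehrhart–Macdonald reciprocity for numerators).** For a lattice polytope
`P` of dimension `d` in `ℝ^d` with `h*`-polynomial `h*`, the numerator polynomial `h_P`
of the Ehrhart series of the open polytope `P°` is obtained by reversing the coefficients
of `h*` with respect to degree `d+1`; in particular `h_P` is monic of degree `d+1`. -/
theorem open_numerator_reverses_hstar (d : ℕ) (V : Finset (Fin d → ℝ))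
    (hV : ∀ v ∈ V, ∀ i, ∃ k : ℤ, v i = (k : ℝ))
    (P : Set (Fin d → ℝ)) (hP : P = convexHull ℝ (V : Set (Fin d → ℝ)))
    (hspan : affineSpan ℝ P = ⊤)
    (hstar : Polynomial ℤ)
    (hhstar : (1 - PowerSeries.X) ^ (d + 1) *
        PowerSeries.mk (fun n =>
          if n = 0 then 1 else
            (Set.ncard {x : Fin d → ℤ |
              (fun i => (x i : ℝ)) ∈ (n : ℝ) • P} : ℤ)) =
      (hstar : PowerSeries ℤ)) :
    ∃ hop : Polynomial ℤ,
      (1 - PowerSeries.X) ^ (d + 1) *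
          PowerSeries.mk (fun n =>
            if n = 0 then 0 else
              (Set.ncard {x : Fin d → ℤ |
                (fun i => (x i : ℝ)) ∈ interior ((n : ℝ) • P)} : ℤ)) =
        (hop : PowerSeries ℤ) ∧
      (∀ i ≤ d + 1, hop.coeff i = hstar.coeff (d + 1 - i)) ∧
      hop.Monic ∧ hop.natDegree = d + 1 := by
  have hzero (x : Fin d → ℤ) : (fun i => (x i : ℝ)) = 0 ↔ x = 0 := by
    simp [funext_iff]
  have hfinrank : Module.finrank ℝ ((Fin d → ℝ) × ℝ) = d + 1 := by simp
  have hnonempty : (interior (homogenizedCone V)).Nonempty := by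
    rw [hP, affineSpan_convexHull, ← interior_convexHull_nonempty_iff_affineSpan_eq_top] at hspan
    obtain ⟨p, hp⟩ := hspan
    exact ⟨(p, 1), (mem_interior_homogenizedCone_iff_of_pos V one_pos).2 (by simpa using hp)⟩
  have hfin (n : ℕ) : {x | x ∈ integralLattice d ∧ LinearMap.snd ℝ (Fin d → ℝ) ℝ x = n ∧
      x ∈ homogenizedCone V}.Finite := by
    rw [setOf_integralLattice_eq_image]
    refine Set.Finite.image _ ?_
    rcases n.eq_zero_or_pos with rfl | hn
    · simp [mem_homogenizedCone_zero_iff, hzero]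
    · simp only [mem_homogenizedCone_iff_of_pos V (Nat.cast_pos.2 hn)]
      exact finite_intCast_preimage_of_isBounded
        ((isBounded_convexHull.2 V.finite_toSet.isBounded).smul₀ _)
  obtain ⟨a, a', ha, ha', hrev, hbig⟩ := conicSpan_reciprocity (ht := LinearMap.snd ℝ _ ℝ)
    (fun v : V => rfl) (integralLattice d) (fun v => ⟨hV v v.2, 1, by simp⟩) hnonempty hfin
  have hclosed (n : ℕ) : ({x | x ∈ integralLattice d ∧ LinearMap.snd ℝ (Fin d → ℝ) ℝ x = n ∧
      x ∈ homogenizedCone V}.ncard : ℤ) = if n = 0 then 1 else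
        (Set.ncard {x : Fin d → ℤ | (fun i => (x i : ℝ)) ∈ (n : ℝ) • P} : ℤ) := by
    rw [setOf_integralLattice_eq_image, Set.ncard_image_of_injective _ (intCast_pair_injective n)]
    split_ifs with hn
    · subst hn
      simp [mem_homogenizedCone_zero_iff, hzero]
    · simp only [mem_homogenizedCone_iff_of_pos V (Nat.cast_pos.2 (Nat.pos_of_ne_zero hn)), hP]
  have hopen (n : ℕ) : ({x | x ∈ integralLattice d ∧ LinearMap.snd ℝ (Fin d → ℝ) ℝ x = n ∧
      x ∈ interior (homogenizedCone V)}.ncard : ℤ) = if n = 0 then 0 else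
        (Set.ncard {x : Fin d → ℤ | (fun i => (x i : ℝ)) ∈ interior ((n : ℝ) • P)} : ℤ) := by
    rw [setOf_integralLattice_eq_image, Set.ncard_image_of_injective _ (intCast_pair_injective n)]
    split_ifs with hn
    · subst hn
      simp [notMem_interior_homogenizedCone_zero]
    · simp only [mem_interior_homogenizedCone_iff_of_pos V
        (Nat.cast_pos.2 (Nat.pos_of_ne_zero hn)), hP]
  simp only [hclosed, hopen, hfinrank] at ha ha' hrev hbig
  have hcoeff (j : ℕ) : a j = hstar.coeff j := by
    rw [← Polynomial.coeff_coe, ← hhstar, ha, PowerSeries.coeff_mk]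
  have hzero_coeff : hstar.coeff 0 = 1 := by
    rw [← Polynomial.coeff_coe, ← hhstar]
    simp
  have htrunc (i : ℕ) : (PowerSeries.trunc (d + 2) (PowerSeries.mk a')).coeff i = a' i := by
    rw [PowerSeries.coeff_trunc, PowerSeries.coeff_mk]
    split_ifs with hi
    · rfl
    · exact (hbig i (by omega)).symm
  have hcoeff' (i : ℕ) (hi : i ≤ d + 1) :
      (PowerSeries.trunc (d + 2) (PowerSeries.mk a')).coeff i = hstar.coeff (d + 1 - i) := by
    rw [htrunc, hrev i (d + 1 - i) (by omega), hcoeff]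
  have hlead : (PowerSeries.trunc (d + 2) (PowerSeries.mk a')).coeff (d + 1) = 1 := by
    rw [hcoeff' _ le_rfl, Nat.sub_self, hzero_coeff]
  have hdeg : (PowerSeries.trunc (d + 2) (PowerSeries.mk a')).natDegree ≤ d + 1 :=
    Nat.lt_succ_iff.1 (PowerSeries.natDegree_trunc_lt _ _)
  refine ⟨PowerSeries.trunc (d + 2) (PowerSeries.mk a'), ?_, hcoeff',
    Polynomial.monic_of_natDegree_le_of_coeff_eq_one _ hdeg hlead,
    Polynomial.natDegree_eq_of_le_of_coeff_ne_zero hdeg (by rw [hlead]; exact one_ne_zero)⟩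
  rw [ha']
  ext i
  rw [Polynomial.coeff_coe, htrunc, PowerSeries.coeff_mk]
end

section
/- Let h ∈ ℤ[z] be a nonzero polynomial of degree s ≥ 1, let d ≥ s and l = d+1−s. Suppose (1 + z + ⋯ + z^{l−1})·h(z) = a₁(z) + z^l·b₁(z) where a₁ is symmetric with respect to degree d and b₁ is symmetric with respect to degree s−1, and suppose (1 + z + ⋯ + z^{l})·h(z) = a₂(z) + z^{l+1}·b₂(z) where a₂ is symmetric with respect to degree d+1 and b₂ is symmetric with respect to degree s−1. Then b₁ = b₂ and h(z) = a₂(z) − z·a₁(z). -/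
/-- A polynomial `p ∈ ℤ[z]` is symmetric with respect to degree `m` if it has degree
at most `m` and its coefficients satisfy `p_i = p_{m-i}` for all `0 ≤ i ≤ m`. -/
def SymmetricWrt (p : Polynomial ℤ) (m : ℕ) : Prop :=
  p.degree ≤ (m : ℕ) ∧ ∀ i ≤ m, p.coeff i = p.coeff (m - i)

open Polynomial in
theorem SymmetricWrt.reflect_eq {p : ℤ[X]} {m : ℕ} (hp : SymmetricWrt p m) :
    p.reflect m = p := by
  ext i
  rw [coeff_reflect]
  rcases le_or_gt i m with hi | hi
  · rw [revAt_le hi, ← hp.2 i hi]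
  · rw [revAt_eq_self_of_lt hi]

open Polynomial in
theorem symmetricWrt_geom_sum (n : ℕ) :
    SymmetricWrt (∑ j ∈ Finset.range (n + 1), X ^ j) n := by
  refine ⟨?_, fun i hi => ?_⟩
  · refine (degree_sum_le _ _).trans (Finset.sup_le fun j hj => ?_)
    rw [degree_X_pow]
    exact_mod_cast Finset.mem_range_succ_iff.mp hj
  · simp only [finsetSum_coeff, coeff_X_pow, Finset.sum_ite_eq, Finset.mem_range]
    rw [if_pos (by lia), if_pos (by lia)]

open Polynomial in
/-- The symmetric part `b` of a decomposition `(1 + z + ⋯ + z^n)·h = a + z^{n+1}·b` is determined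
by the difference of `h` and its reflection, independently of `n`. -/
theorem sub_reflect_eq_of_geom_sum_mul_eq {n k : ℕ} {h a b : ℤ[X]}
    (hh : h.natDegree ≤ k + 1) (ha : SymmetricWrt a (n + (k + 1))) (hb : SymmetricWrt b k)
    (hab : (∑ j ∈ Finset.range (n + 1), X ^ j) * h = a + X ^ (n + 1) * b) :
    h - h.reflect (k + 1) = (X - 1) * b := by
  have hG := symmetricWrt_geom_sum n
  have hrev := congrArg (reflect (n + (k + 1))) hab
  have hX : reflect (n + 1) (X ^ (n + 1) : ℤ[X]) = 1 := by
    rw [reflect_monomial, revAt_le le_rfl]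
    simp
  rw [reflect_mul _ _ (natDegree_le_of_degree_le hG.1) hh, hG.reflect_eq, reflect_add,
    ha.reflect_eq, show n + (k + 1) = (n + 1) + k by ring,
    reflect_mul _ _ (natDegree_X_pow_le _) (natDegree_le_of_degree_le hb.1), hX,
    hb.reflect_eq, one_mul] at hrev
  have hne : (∑ j ∈ Finset.range (n + 1), (X : ℤ[X]) ^ j) ≠ 0 :=
    (monic_geom_sum_X n.succ_ne_zero).ne_zero
  refine mul_left_cancel₀ hne ?_
  linear_combination hab - hrev - b * geom_sum_mul (X : ℤ[X]) (n + 1)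

/-- **Lemma.** With `l = d+1-s`, comparing the Stapledon decompositions of
`(1 + z + ⋯ + z^{l-1})·h` (with respect to `d`) and of `(1 + z + ⋯ + z^l)·h`
(with respect to `d+1`) yields `b₁ = b₂` and `h = a₂ - z·a₁`. -/
theorem two_decompositions_compare (d s : ℕ) (h a₁ b₁ a₂ b₂ : Polynomial ℤ)
    (hh0 : h ≠ 0) (hs : h.natDegree = s) (hs1 : 1 ≤ s) (hsd : s ≤ d)
    (ha₁ : SymmetricWrt a₁ d) (hb₁ : SymmetricWrt b₁ (s - 1))
    (h1 : (∑ j ∈ Finset.range (d + 1 - s), Polynomial.X ^ j) * h =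
        a₁ + Polynomial.X ^ (d + 1 - s) * b₁)
    (ha₂ : SymmetricWrt a₂ (d + 1)) (hb₂ : SymmetricWrt b₂ (s - 1))
    (h2 : (∑ j ∈ Finset.range (d + 2 - s), Polynomial.X ^ j) * h =
        a₂ + Polynomial.X ^ (d + 2 - s) * b₂) :
    b₁ = b₂ ∧ h = a₂ - Polynomial.X * a₁ := by
  obtain ⟨k, rfl⟩ : ∃ k, s = k + 1 := ⟨s - 1, by lia⟩
  obtain ⟨n, rfl⟩ : ∃ n, d = n + (k + 1) := ⟨d - (k + 1), by lia⟩
  rw [show n + (k + 1) + 1 - (k + 1) = n + 1 by lia] at h1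
  rw [show n + (k + 1) + 2 - (k + 1) = n + 1 + 1 by lia] at h2
  rw [show n + (k + 1) + 1 = n + 1 + (k + 1) by ring] at ha₂
  have hb : b₁ = b₂ := by
    refine mul_left_cancel₀ (Polynomial.X_sub_C_ne_zero (1 : ℤ)) ?_
    rw [Polynomial.C_1, ← sub_reflect_eq_of_geom_sum_mul_eq hs.le ha₁ hb₁ h1,
      ← sub_reflect_eq_of_geom_sum_mul_eq hs.le ha₂ hb₂ h2]
  refine ⟨hb, ?_⟩
  subst hb
  rw [geom_sum_succ] at h2
  linear_combination h2 - Polynomial.X * h1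
end

section
/- Let d ≥ 2 and let r be a partial order on {1,…,d} with order polytope O_r ⊆ ℝ^d. Let μ : ℝ^d → ℝ^d be the orthogonal projection onto the hyperplane H₀ = {x ∈ ℝ^d : Σ_i x_i = 0}, given by μ(x) = x − ((Σ_i x_i)/d)·(1,…,1), and let L ⊆ ℝ^d be the additive subgroup (ℤ-submodule) generated by μ(e_1), …, μ(e_{d−1}), where e_i are the standard basis vectors. Then (1−z)^{d+1} · Σ_{n≥0} L_{O_r}(n) z^n = (1−z)^{d} · Σ_{n≥0} #(L ∩ n·μ(O_r)) z^n as formal power series over ℤ; that is, the Ehrhart series of O_r (with denominator (1−z)^{d+1}) and of the projected polytope μ(O_r) with respect to the lattice L (with denominator (1−z)^{d}) have the same numerator polynomial. -/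
open scoped Pointwise

namespace OrderPolytope

variable {d : ℕ}

/-- Integer points of the `n`-th dilate of the order polytope of `r`. -/
def latticePoints (r : Fin d → Fin d → Prop) (n : ℕ) : Set (Fin d → ℤ) :=
  {x | (∀ i, 0 ≤ x i ∧ x i ≤ n) ∧ ∀ i j, r i j → x i ≤ x j}

/-- Integer points of the `n`-th dilate of the order polytope having some zero coordinate. -/
def groundedPoints (r : Fin d → Fin d → Prop) (n : ℕ) : Set (Fin d → ℤ) :=
  {x | x ∈ latticePoints r n ∧ ∃ i, x i = 0}

/-- Orthogonal projection onto the hyperplane of vectors with zero coordinate sum. -/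
noncomputable def proj (x : Fin d → ℝ) : Fin d → ℝ := fun j => x j - (∑ i, x i) / d

theorem mem_smul_iff (r : Fin d → Fin d → Prop) (n : ℕ) (x : Fin d → ℝ) :
    x ∈ (n : ℝ) • {x : Fin d → ℝ | (∀ i, 0 ≤ x i ∧ x i ≤ 1) ∧ ∀ i j, r i j → x i ≤ x j} ↔
      (∀ i, 0 ≤ x i ∧ x i ≤ n) ∧ ∀ i j, r i j → x i ≤ x j := by
  rw [Set.mem_smul_set]
  constructor
  · rintro ⟨y, ⟨hy, hy'⟩, rfl⟩
    have hn : (0 : ℝ) ≤ n := n.cast_nonneg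
    refine ⟨fun i => ⟨mul_nonneg hn (hy i).1, ?_⟩,
      fun i j hij => mul_le_mul_of_nonneg_left (hy' i j hij) hn⟩
    simpa using mul_le_mul_of_nonneg_left (hy i).2 hn
  · rintro ⟨hx, hx'⟩
    rcases n.eq_zero_or_pos with rfl | hn
    · refine ⟨0, by simp, funext fun i => ?_⟩
      have := hx i
      simp only [Nat.cast_zero] at this
      simpa using le_antisymm this.1 this.2
    · have hn : (0 : ℝ) < n := by exact_mod_cast hn
      refine ⟨fun i => x i / n, ⟨fun i => ⟨div_nonneg (hx i).1 hn.le, ?_⟩,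
        fun i j hij => div_le_div_of_nonneg_right (hx' i j hij) hn.le⟩, funext fun i => ?_⟩
      · exact (div_le_one hn).2 (hx i).2
      · simp only [Pi.smul_apply, smul_eq_mul]
        field_simp

theorem intCast_mem_smul_iff (r : Fin d → Fin d → Prop) (n : ℕ) (x : Fin d → ℤ) :
    (fun i => (x i : ℝ)) ∈ (n : ℝ) •
        {x : Fin d → ℝ | (∀ i, 0 ≤ x i ∧ x i ≤ 1) ∧ ∀ i j, r i j → x i ≤ x j} ↔
      x ∈ latticePoints r n := by
  rw [mem_smul_iff]
  simp only [latticePoints, Set.mem_ofPred_eq]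
  norm_cast

theorem proj_smul (c : ℝ) (x : Fin d → ℝ) : proj (c • x) = c • proj x := by
  funext j
  simp only [proj, Pi.smul_apply, smul_eq_mul, ← Finset.mul_sum]
  ring

theorem smul_image_proj (c : ℝ) (s : Set (Fin d → ℝ)) : c • (proj '' s) = proj '' (c • s) := by
  simp only [← Set.image_smul, Set.image_image, proj_smul]

theorem proj_sub_const [NeZero d] (x : Fin d → ℝ) (c : ℝ) : proj (fun i => x i - c) = proj x := by
  have hd : (d : ℝ) ≠ 0 := NeZero.ne _
  funext j
  simp only [proj, Finset.sum_sub_distrib, Finset.sum_const, Finset.card_univ, Fintype.card_fin,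
    nsmul_eq_mul]
  field_simp
  ring

/-- Vectors with the same projection differ by a constant vector. -/
theorem sub_eq_sub_of_proj_eq {x y : Fin d → ℝ} (h : proj x = proj y) (i j : Fin d) :
    x i - y i = x j - y j := by
  have hi := congrFun h i
  have hj := congrFun h j
  simp only [proj] at hi hj
  linarith

theorem proj_eq_sum_smul [NeZero d] (w : Fin d → ℤ) (l : Fin d) :
    proj (fun i => (w i : ℝ)) =
      ∑ i, (w i - w l) • proj (fun j => if i = j then 1 else 0) := by
  have hd : (d : ℝ) ≠ 0 := NeZero.ne _
  rw [← proj_sub_const _ (w l : ℝ)]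
  funext j
  have key : ∀ i, ((w i - w l) • proj (fun j => if i = j then 1 else 0) : Fin d → ℝ) j =
      (if i = j then (w i : ℝ) - w l else 0) - (w i - w l) / d := fun i => by
    rw [Pi.smul_apply, zsmul_eq_mul]
    simp only [proj, Finset.sum_ite_eq, Finset.mem_univ, if_true]
    push_cast
    split_ifs <;> ring
  rw [Finset.sum_apply, Finset.sum_congr rfl fun i _ => key i, Finset.sum_sub_distrib,
    Finset.sum_ite_eq' Finset.univ j (fun i => (w i : ℝ) - w l), if_pos (Finset.mem_univ _),
    ← Finset.sum_div]
  rfl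

theorem mem_closure_iff [NeZero d] (y : Fin d → ℝ) :
    y ∈ AddSubgroup.closure {v : Fin d → ℝ | ∃ i : Fin d, (i : ℕ) < d - 1 ∧
        v = proj (fun j => if i = j then 1 else 0)} ↔
      ∃ w : Fin d → ℤ, proj (fun i => (w i : ℝ)) = y := by
  constructor
  · intro hy
    induction hy using AddSubgroup.closure_induction with
    | mem x hx =>
      obtain ⟨i, -, rfl⟩ := hx
      exact ⟨fun j => if i = j then 1 else 0, by simp⟩
    | zero => exact ⟨0, by funext j; simp [proj]⟩
    | add x y _ _ hx hy =>
      obtain ⟨a, rfl⟩ := hx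
      obtain ⟨b, rfl⟩ := hy
      refine ⟨a + b, funext fun j => ?_⟩
      simp only [proj, Pi.add_apply, Int.cast_add, Finset.sum_add_distrib]
      ring
    | neg x _ hx =>
      obtain ⟨a, rfl⟩ := hx
      refine ⟨-a, funext fun j => ?_⟩
      simp only [proj, Pi.neg_apply, Int.cast_neg, Finset.sum_neg_distrib]
      ring
  · rintro ⟨w, rfl⟩
    have hd := NeZero.pos d
    rw [proj_eq_sum_smul w ⟨d - 1, by omega⟩]
    refine AddSubgroup.sum_mem _ fun i _ => ?_
    by_cases hi : (i : ℕ) < d - 1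
    · refine AddSubgroup.zsmul_mem _ (AddSubgroup.subset_closure ?_) _
      exact ⟨i, hi, rfl⟩
    · have : i = ⟨d - 1, by omega⟩ := Fin.ext (by simp only; omega)
      rw [← this, sub_self, zero_smul]
      exact AddSubgroup.zero_mem _

theorem finite_latticePoints (r : Fin d → Fin d → Prop) (n : ℕ) : (latticePoints r n).Finite :=
  (Set.finite_Icc (0 : Fin d → ℤ) (fun _ => (n : ℤ))).subset fun _ hx =>
    ⟨fun i => (hx.1 i).1, fun i => (hx.1 i).2⟩

theorem injOn_proj_groundedPoints (r : Fin d → Fin d → Prop) (n : ℕ) :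
    Set.InjOn (fun x : Fin d → ℤ => proj fun i => (x i : ℝ)) (groundedPoints r n) := by
  rintro x ⟨hx, i, hi⟩ y ⟨hy, j, hj⟩ h
  have key : ∀ a b, x a - y a = x b - y b := fun a b => by
    exact_mod_cast sub_eq_sub_of_proj_eq h a b
  funext a
  have h1 := key a i
  have h2 := key a j
  have h3 := (hx.1 j).1
  have h4 := (hy.1 i).1
  omega

theorem lattice_inter_smul_image_eq [NeZero d] (r : Fin d → Fin d → Prop) (n : ℕ) :
    {y : Fin d → ℝ | (∃ w : Fin d → ℤ, proj (fun i => (w i : ℝ)) = y) ∧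
        y ∈ (n : ℝ) • (proj ''
          {x : Fin d → ℝ | (∀ i, 0 ≤ x i ∧ x i ≤ 1) ∧ ∀ i j, r i j → x i ≤ x j})} =
      (fun x : Fin d → ℤ => proj fun i => (x i : ℝ)) '' groundedPoints r n := by
  ext y
  rw [smul_image_proj]
  constructor
  · rintro ⟨⟨w, rfl⟩, x, hx, hxw⟩
    rw [mem_smul_iff] at hx
    obtain ⟨m, hm⟩ := Finite.exists_min w
    have key := fun i => sub_eq_sub_of_proj_eq hxw i m
    refine ⟨fun i => w i - w m, ⟨⟨fun i => ⟨sub_nonneg.2 (hm i), ?_⟩, fun i j hij => ?_⟩,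
      m, sub_self _⟩, ?_⟩
    · have h1 := key i
      have h2 := (hx.1 i).2
      have h3 := (hx.1 m).1
      have : ((w i - w m : ℤ) : ℝ) ≤ ((n : ℤ) : ℝ) := by
        push_cast
        linarith
      exact_mod_cast this
    · have h1 := key i
      have h2 := key j
      have h3 := hx.2 i j hij
      have : (w i : ℝ) ≤ w j := by linarith
      exact sub_le_sub_right (by exact_mod_cast this) _
    · simpa using proj_sub_const (fun i => (w i : ℝ)) (w m)
  · rintro ⟨x, hx, rfl⟩
    exact ⟨⟨x, rfl⟩, _, (intCast_mem_smul_iff r n x).2 hx.1, rfl⟩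

theorem latticePoints_succ (r : Fin d → Fin d → Prop) (n : ℕ) :
    latticePoints r (n + 1) =
      groundedPoints r (n + 1) ∪ (fun x i => x i + 1) '' latticePoints r n := by
  ext x
  constructor
  · intro hx
    by_cases h : ∃ i, x i = 0
    · exact Or.inl ⟨hx, h⟩
    · push Not at h
      refine Or.inr ⟨fun i => x i - 1, ⟨fun i => ?_, fun i j hij => ?_⟩, by simp⟩
      · have h1 := hx.1 i
        have h2 := h i
        push_cast at h1
        dsimp only
        constructor <;> omega
      · exact sub_le_sub_right (hx.2 i j hij) _
  · rintro (hx | ⟨x, hx, rfl⟩)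
    · exact hx.1
    · refine ⟨fun i => ?_, fun i j hij => add_le_add_left (hx.2 i j hij) _⟩
      have h1 := hx.1 i
      push_cast
      constructor <;> omega

theorem ncard_latticePoints_succ (r : Fin d → Fin d → Prop) (n : ℕ) :
    (latticePoints r (n + 1)).ncard =
      (groundedPoints r (n + 1)).ncard + (latticePoints r n).ncard := by
  rw [latticePoints_succ, Set.ncard_union_eq ?_
    ((finite_latticePoints r _).subset fun _ hx => hx.1) ((finite_latticePoints r n).image _),
    Set.ncard_image_of_injective]
  · intro x y h
    funext i
    have := congrFun h i
    simpa using this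
  · rw [Set.disjoint_left]
    rintro _ ⟨-, i, hi⟩ ⟨x, hx, rfl⟩
    have := (hx.1 i).1
    simp only at hi
    omega

theorem groundedPoints_zero [NeZero d] (r : Fin d → Fin d → Prop) :
    groundedPoints r 0 = latticePoints r 0 := by
  refine Set.Subset.antisymm (fun _ hx => hx.1) fun x hx => ⟨hx, 0, ?_⟩
  have := hx.1 0
  push_cast at this
  omega

end OrderPolytope

/-- **Lemma.** The Ehrhart series of the order polytope `O_r ⊆ ℝ^d` (with denominator
`(1-z)^{d+1}`) and of its orthogonal projection `μ(O_r)` onto the hyperplane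
`H₀ = {x : Σ xᵢ = 0}`, counted with respect to the projected lattice `L` (with
denominator `(1-z)^d`), have the same numerator polynomial. -/
theorem projected_order_polytope_same_numerator (d : ℕ) (hd : 2 ≤ d)
    (r : Fin d → Fin d → Prop) (hr : IsPartialOrder (Fin d) r)
    (O : Set (Fin d → ℝ))
    (hO : O = {x : Fin d → ℝ |
      (∀ i, 0 ≤ x i ∧ x i ≤ 1) ∧ ∀ i j, r i j → x i ≤ x j})
    (μ : (Fin d → ℝ) → (Fin d → ℝ))
    (hμ : ∀ x, μ x = fun j => x j - (∑ i, x i) / d)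
    (L : AddSubgroup (Fin d → ℝ))
    (hL : L = AddSubgroup.closure
      {v : Fin d → ℝ | ∃ i : Fin d, (i : ℕ) < d - 1 ∧
        v = μ (fun j => if i = j then 1 else 0)}) :
    (1 - PowerSeries.X) ^ (d + 1) *
        PowerSeries.mk (fun n =>
          (Set.ncard {x : Fin d → ℤ |
            (fun i => (x i : ℝ)) ∈ (n : ℝ) • O} : ℤ)) =
    (1 - PowerSeries.X) ^ d *
        PowerSeries.mk (fun n =>
          (Set.ncard {y : Fin d → ℝ | y ∈ L ∧ y ∈ (n : ℝ) • (μ '' O)} : ℤ)) := by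
  have : NeZero d := ⟨by omega⟩
  obtain rfl : μ = OrderPolytope.proj := funext hμ
  subst hO hL
  simp only [OrderPolytope.mem_closure_iff, OrderPolytope.lattice_inter_smul_image_eq,
    OrderPolytope.intCast_mem_smul_iff, Set.ofPred_mem_eq,
    (OrderPolytope.injOn_proj_groundedPoints r _).ncard_image]
  rw [pow_succ, mul_assoc]
  congr 1
  ext n
  cases n with
  | zero => simp [sub_mul, OrderPolytope.groundedPoints_zero]
  | succ n => simp [sub_mul, PowerSeries.coeff_succ_X_mul, OrderPolytope.ncard_latticePoints_succ]
end

section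
/- Let P be a lattice polytope of dimension d in ℝ^d with h*-polynomial h* of degree s, and set l = d+1−s. Let a, b ∈ ℤ[z] be the unique polynomials with a symmetric with respect to degree d, b symmetric with respect to degree s−1 (with b = 0 in case s = 0), and (1 + z + ⋯ + z^{l−1})·h*(z) = a(z) + z^l·b(z). Then all coefficients of a and all coefficients of b are nonnegative. -/
open scoped Pointwise

namespace StapledonDecomposition

open Filter Topology

/-- Positivity of `t + ε * e` for all sufficiently small `ε > 0`. -/
def LexPos (e t : ℝ) : Prop := 0 < t ∨ t = 0 ∧ 0 < e

theorem eventually_pos_iff_lexPos (a b : ℝ) (h : a ≠ 0 ∨ b ≠ 0) :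
    ∀ᶠ ε in 𝓝[>] (0 : ℝ), (0 < a + ε * b ↔ LexPos b a) ∧ a + ε * b ≠ 0 := by
  have hc : Tendsto (fun ε : ℝ => a + ε * b) (𝓝[>] 0) (𝓝 a) := by
    have : Continuous (fun ε : ℝ => a + ε * b) := by fun_prop
    simpa using (this.tendsto 0).mono_left nhdsWithin_le_nhds
  rcases lt_trichotomy a 0 with ha | ha | ha
  · filter_upwards [hc.eventually_lt_const ha] with ε hε
    exact ⟨⟨fun h => absurd h hε.not_gt, fun h => by
      rcases h with h | h <;> linarith⟩, hε.ne⟩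
  · subst ha
    have hb : b ≠ 0 := by simpa using h
    filter_upwards [self_mem_nhdsWithin] with ε (hε : 0 < ε)
    simp [LexPos, hε, hb, hε.ne']
  · filter_upwards [hc.eventually_const_lt ha] with ε hε
    exact ⟨⟨fun _ => Or.inl ha, fun _ => hε⟩, hε.ne'⟩

theorem exists_pos_forall_apply_ne_zero {ι : Type*} [Finite ι]
    (F : Finset ((ι → ℝ) →ₗ[ℝ] ℝ)) (hF : ∀ f ∈ F, f ≠ 0) :
    ∃ r : ι → ℝ, (∀ i, 0 < r i) ∧ ∀ f ∈ F, f r ≠ 0 := by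
  classical
  induction F using Finset.induction_on with
  | empty => exact ⟨fun _ => 1, by simp, by simp⟩
  | insert f F _ ih =>
    obtain ⟨r, hr, hrF⟩ := ih fun g hg => hF g (Finset.mem_insert_of_mem hg)
    obtain ⟨v, hv⟩ : ∃ v, f v ≠ 0 := by
      by_contra! h
      exact hF f (Finset.mem_insert_self f F) (LinearMap.ext h)
    have h1 : ∀ᶠ ε in 𝓝[>] (0 : ℝ), ∀ i, 0 < r i + ε * v i := by
      rw [eventually_all]
      intro i
      filter_upwards [eventually_pos_iff_lexPos (r i) (v i) (Or.inl (hr i).ne')] with ε hε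
      exact hε.1.2 (Or.inl (hr i))
    have h2 : ∀ᶠ ε in 𝓝[>] (0 : ℝ), ∀ g ∈ insert f F, g r + ε * g v ≠ 0 := by
      rw [Filter.eventually_all_finset]
      intro g hg
      have : g r ≠ 0 ∨ g v ≠ 0 := by
        rcases Finset.mem_insert.1 hg with rfl | hg
        · exact Or.inr hv
        · exact Or.inl (hrF g hg)
      filter_upwards [eventually_pos_iff_lexPos (g r) (g v) this] with ε hε
      exact hε.2
    obtain ⟨ε, h1, h2⟩ := (h1.and h2).exists
    exact ⟨r + ε • v, by simpa using h1, by simpa using h2⟩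

section Basis

variable {ι E : Type*} [AddCommGroup E] [Module ℝ E]

/-- The subfamily of `w` indexed by `σ` is a basis. -/
def IsBasis (w : ι → E) (σ : Finset ι) : Prop :=
  LinearIndependent ℝ (fun i : σ => w i) ∧ ⊤ ≤ Submodule.span ℝ (Set.range fun i : σ => w i)

open scoped Classical in
/-- The coordinate functional with index `i` of the basis indexed by `σ`. -/
noncomputable def coord (w : ι → E) (σ : Finset ι) (i : ι) : E →ₗ[ℝ] ℝ :=
  if h : IsBasis w σ ∧ i ∈ σ then (Module.Basis.mk h.1.1 h.1.2).coord ⟨i, h.2⟩ else 0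

variable {w : ι → E} {σ : Finset ι}

theorem coord_of_notMem {i : ι} (hi : i ∉ σ) : coord w σ i = 0 :=
  dif_neg fun h => hi h.2

theorem IsBasis.coord_self (h : IsBasis w σ) {i : ι} (hi : i ∈ σ) : coord w σ i (w i) = 1 := by
  have := Module.Basis.mk_coord_apply_eq (hli := h.1) (hsp := h.2) ⟨i, hi⟩
  rw [coord, dif_pos ⟨h, hi⟩]
  exact this

theorem IsBasis.coord_ne (h : IsBasis w σ) {i j : ι} (hj : j ∈ σ) (hij : j ≠ i) :
    coord w σ i (w j) = 0 := by
  by_cases hi : i ∈ σ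
  · have := Module.Basis.mk_coord_apply_ne (hli := h.1) (hsp := h.2) (i := ⟨i, hi⟩) (j := ⟨j, hj⟩)
      (by simpa using hij)
    rw [coord, dif_pos ⟨h, hi⟩]
    exact this
  · rw [coord_of_notMem hi]
    rfl

theorem IsBasis.sum_coord (h : IsBasis w σ) (y : E) : ∑ i ∈ σ, coord w σ i y • w i = y := by
  rw [← Finset.sum_coe_sort]
  conv_rhs => rw [← (Module.Basis.mk h.1 h.2).sum_repr y]
  refine Finset.sum_congr rfl fun i _ => ?_
  rw [coord, dif_pos ⟨h, i.2⟩]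
  simp

theorem IsBasis.card_eq (h : IsBasis w σ) : σ.card = Module.finrank ℝ E := by
  rw [Module.finrank_eq_card_basis (Module.Basis.mk h.1 h.2), Fintype.card_coe]

/-- A subset `S` of a spanning family contains a subset `t` with the same span that extends
to a basis. -/
theorem exists_isBasis [Finite ι] (hw : ⊤ ≤ Submodule.span ℝ (Set.range w)) (S : Set ι) :
    ∃ (t : Set ι) (σ : Finset ι), t ⊆ S ∧ t ⊆ σ ∧ w '' S ⊆ Submodule.span ℝ (w '' t) ∧
      IsBasis w σ := by
  classical
  obtain ⟨t, htS, -, hSt, hli⟩ := exists_linearIndepOn_extension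
    (linearIndepOn_empty ℝ w) (Set.empty_subset S)
  obtain ⟨u, -, htu, hu, hliu⟩ := exists_linearIndepOn_extension hli (Set.subset_univ t)
  refine ⟨t, u.toFinite.toFinset, htS, by simpa using htu, hSt, ?_, ?_⟩
  · have : LinearIndepOn ℝ w (u.toFinite.toFinset : Set ι) := by simpa using hliu
    exact this
  · refine hw.trans (Submodule.span_le.2 ?_)
    rw [← Set.image_univ]
    refine hu.trans ?_
    have : Set.range (fun i : u.toFinite.toFinset => w i) = w '' u := by
      ext; simp
    rw [this]

end Basis

section Triangulation

variable {ι E : Type*} [Fintype ι] [AddCommGroup E] [Module ℝ E] {w : ι → E}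

/-- The cone of nonnegative combinations of the family `w`. -/
def cone (w : ι → E) : Set E := {y | ∃ r : ι → ℝ, (∀ i, 0 ≤ r i) ∧ ∑ i, r i • w i = y}

theorem IsBasis.sum_coord_univ {σ : Finset ι} (h : IsBasis w σ) (y : E) :
    ∑ i, coord w σ i y • w i = y := by
  conv_rhs => rw [← h.sum_coord y]
  refine (Finset.sum_subset (Finset.subset_univ σ) fun i _ hi => ?_).symm
  simp [coord_of_notMem hi]

/-- The reduced cost of the generator `w j` with respect to the basis `σ` and the costs `c`. -/
noncomputable def reducedCost (w : ι → E) (c : ι → ℝ) (σ : Finset ι) (j : ι) : ℝ :=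
  c j - ∑ i, c i * coord w σ i (w j)

theorem IsBasis.reducedCost_eq_zero {σ : Finset ι} (h : IsBasis w σ) (c : ι → ℝ) {j : ι}
    (hj : j ∈ σ) : reducedCost w c σ j = 0 := by
  rw [reducedCost, Finset.sum_eq_single j, h.coord_self hj]
  · simp
  · intro i _ hij
    rw [h.coord_ne hj hij.symm, mul_zero]
  · simp

theorem sum_mul_reducedCost (c r : ι → ℝ) (σ : Finset ι) :
    ∑ j, r j * reducedCost w c σ j =
      ∑ j, c j * r j - ∑ i, c i * coord w σ i (∑ j, r j • w j) := by
  simp only [reducedCost, mul_sub, Finset.sum_sub_distrib, map_sum, map_smul, smul_eq_mul,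
    Finset.mul_sum]
  rw [Finset.sum_comm (γ := ι)]
  congr 1
  · exact Finset.sum_congr rfl fun j _ => mul_comm _ _
  · exact Finset.sum_congr rfl fun j _ => Finset.sum_congr rfl fun i _ => by ring

/-- The cell `σ` is dual feasible for the costs `c`. -/
def IsCell (w : ι → E) (c : ι → ℝ) (σ : Finset ι) : Prop :=
  IsBasis w σ ∧ ∀ j ∉ σ, 0 < reducedCost w c σ j

theorem IsCell.reducedCost_nonneg {c : ι → ℝ} {σ : Finset ι} (h : IsCell w c σ) (j : ι) :
    0 ≤ reducedCost w c σ j := by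
  by_cases hj : j ∈ σ
  · exact (h.1.reducedCost_eq_zero c hj).ge
  · exact (h.2 j hj).le

theorem IsCell.subset {c : ι → ℝ} {σ τ : Finset ι} (hσ : IsCell w c σ) (hτ : IsCell w c τ) {y : E}
    (hσy : ∀ i ∈ σ, 0 < coord w σ i y) (hτy : ∀ i ∈ τ, 0 < coord w τ i y) : τ ⊆ σ := by
  have nonneg : ∀ ρ : Finset ι, (∀ i ∈ ρ, 0 < coord w ρ i y) → ∀ i, 0 ≤ coord w ρ i y := by
    intro ρ hρ i
    by_cases hi : i ∈ ρ
    · exact (hρ i hi).le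
    · simp [coord_of_notMem hi]
  have h1 := sum_mul_reducedCost (w := w) c (fun j => coord w τ j y) σ
  have h2 := sum_mul_reducedCost (w := w) c (fun j => coord w σ j y) τ
  rw [hτ.1.sum_coord_univ] at h1
  rw [hσ.1.sum_coord_univ] at h2
  have t1 : ∀ j ∈ Finset.univ, 0 ≤ coord w τ j y * reducedCost w c σ j := fun j _ =>
    mul_nonneg (nonneg τ hτy j) (hσ.reducedCost_nonneg j)
  have t2 : ∀ j ∈ Finset.univ, 0 ≤ coord w σ j y * reducedCost w c τ j := fun j _ =>
    mul_nonneg (nonneg σ hσy j) (hτ.reducedCost_nonneg j)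
  have h0 : ∑ j, coord w τ j y * reducedCost w c σ j = 0 := by
    have := Finset.sum_nonneg t1
    have := Finset.sum_nonneg t2
    linarith
  intro j hj
  by_contra hjσ
  have := (Finset.sum_eq_zero_iff_of_nonneg t1).1 h0 j (Finset.mem_univ j)
  exact (mul_pos (hτy j hj) (hσ.2 j hjσ)).ne' this

theorem exists_isMinOn_cost {ht : E →ₗ[ℝ] ℝ} (hht : ∀ i, 0 < ht (w i))
    (hw : ⊤ ≤ Submodule.span ℝ (Set.range w))
    (c : ι → ℝ) {y : E} (hy : y ∈ cone w) :
    ∃ r : ι → ℝ, ((∀ i, 0 ≤ r i) ∧ ∑ i, r i • w i = y) ∧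
      ∀ r' : ι → ℝ, (∀ i, 0 ≤ r' i) → ∑ i, r' i • w i = y → ∑ i, c i * r i ≤ ∑ i, c i * r' i := by
  obtain ⟨-, σ, -, -, -, hσ⟩ := exists_isBasis hw ∅
  have hinj : ∀ r : ι → ℝ, ∑ i, r i • w i = y ↔
      ∀ k, ∑ i, r i * coord w σ k (w i) = coord w σ k y := by
    intro r
    constructor
    · rintro rfl k
      simp [map_sum]
    · intro h
      rw [← hσ.sum_coord_univ y, ← hσ.sum_coord_univ (∑ i, r i • w i)]
      refine Finset.sum_congr rfl fun k _ => ?_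
      rw [← h k, map_sum]
      simp
  have hcpt : IsCompact {r : ι → ℝ | (∀ i, 0 ≤ r i) ∧ ∑ i, r i • w i = y} := by
    refine (isCompact_univ_pi (fun i : ι => isCompact_Icc (a := (0 : ℝ))
      (b := ht y / ht (w i)))).of_isClosed_subset ?_ ?_
    · simp only [hinj, Set.ofPred_and, Set.ofPred_forall]
      refine (isClosed_iInter fun i => isClosed_le (by fun_prop) (by fun_prop)).inter
        (isClosed_iInter fun k => isClosed_eq (by fun_prop) (by fun_prop))
    · rintro r ⟨hr, rfl⟩ i -
      refine ⟨hr i, ?_⟩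
      rw [le_div_iff₀ (hht i), map_sum]
      simp only [map_smul, smul_eq_mul]
      exact Finset.single_le_sum (f := fun i => r i * ht (w i))
        (fun j _ => mul_nonneg (hr j) (hht j).le) (Finset.mem_univ i)
  obtain ⟨r, hr, hmin⟩ := hcpt.exists_isMinOn (f := fun r => ∑ i, c i * r i) hy
    (by fun_prop : Continuous fun r : ι → ℝ => ∑ i, c i * r i).continuousOn
  exact ⟨r, hr, fun r' h1 h2 => hmin (show r' ∈ {r : ι → ℝ | _} from ⟨h1, h2⟩)⟩

/-- If moving from `r` towards the generator `w j` along the basis `σ` keeps nonnegativity, then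
the reduced cost has the expected sign. -/
theorem reducedCost_mul_nonneg_of_min {c r : ι → ℝ} {σ : Finset ι} (hσ : IsBasis w σ)
    (hr : ∀ i, 0 ≤ r i) (hpos : ∀ i ∈ σ, 0 < r i)
    (hmin : ∀ r' : ι → ℝ, (∀ i, 0 ≤ r' i) → ∑ i, r' i • w i = ∑ i, r i • w i →
      ∑ i, c i * r i ≤ ∑ i, c i * r' i)
    {j : ι} (δ : ℝ) (hδ : 0 < δ ∨ 0 < r j) :
    0 ≤ δ * reducedCost w c σ j := by
  classical
  let v : ι → ℝ := fun i => δ * ((if i = j then 1 else 0) - coord w σ i (w j))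
  have hv : ∑ i, v i • w i = 0 := by
    simp only [v, mul_smul, sub_smul, ← Finset.smul_sum, Finset.sum_sub_distrib,
      hσ.sum_coord_univ]
    simp
  have hcv : ∑ i, c i * v i = δ * reducedCost w c σ j := by
    simp only [v, reducedCost, mul_sub, Finset.sum_sub_distrib, Finset.mul_sum]
    congr 1
    · simp [mul_comm]
    · exact Finset.sum_congr rfl fun i _ => by ring
  have hev : ∀ᶠ ε in 𝓝[>] (0 : ℝ), ∀ i, 0 ≤ r i + ε * v i := by
    rw [eventually_all]
    intro i
    by_cases hi : 0 < r i
    · filter_upwards [eventually_pos_iff_lexPos (r i) (v i) (Or.inl hi.ne')] with ε hε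
      exact (hε.1.2 (Or.inl hi)).le
    · filter_upwards [self_mem_nhdsWithin] with ε (hε : 0 < ε)
      have hiσ : i ∉ σ := fun h => hi (hpos i h)
      refine add_nonneg (hr i) (mul_nonneg hε.le ?_)
      simp only [v, coord_of_notMem hiσ]
      by_cases hij : i = j
      · subst hij
        simpa using (hδ.resolve_right hi).le
      · simp [hij]
  obtain ⟨ε, hε, hε0⟩ := (hev.and self_mem_nhdsWithin).exists
  have := hmin (fun i => r i + ε * v i) hε (by
    simp only [add_smul, mul_smul, Finset.sum_add_distrib, ← Finset.smul_sum, hv]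
    simp)
  simp only [mul_add, Finset.sum_add_distrib] at this
  have h2 : ∑ i, c i * (ε * v i) = ε * (δ * reducedCost w c σ j) := by
    rw [← hcv, Finset.mul_sum]
    exact Finset.sum_congr rfl fun i _ => by ring
  rw [h2] at this
  exact nonneg_of_mul_nonneg_right (by linarith) hε0

theorem existsUnique_isCell {ht : E →ₗ[ℝ] ℝ} (hht : ∀ i, 0 < ht (w i))
    (hw : ⊤ ≤ Submodule.span ℝ (Set.range w)) {c : ι → ℝ}
    (hc : ∀ σ, IsBasis w σ → ∀ j ∉ σ, reducedCost w c σ j ≠ 0) {y : E} (hy : y ∈ cone w)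
    (hgen : ∀ σ, IsBasis w σ → ∀ i ∈ σ, coord w σ i y ≠ 0) :
    ∃! σ, IsCell w c σ ∧ ∀ i ∈ σ, 0 < coord w σ i y := by
  obtain ⟨r, ⟨hr, rfl⟩, hmin⟩ := exists_isMinOn_cost hht hw c hy
  obtain ⟨t, σ, htS, htσ, hspan, hσ⟩ := exists_isBasis hw {i | 0 < r i}
  have hy : ∑ i, r i • w i ∈ Submodule.span ℝ (w '' t) := by
    refine Submodule.sum_mem _ fun i _ => ?_
    rcases (hr i).lt_or_eq with h | h
    · exact Submodule.smul_mem _ _ (hspan ⟨i, h, rfl⟩)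
    · simp [← h]
  have hσt : ∀ i ∈ σ, 0 < r i := by
    intro i hi
    refine htS ?_
    by_contra hit
    refine hgen σ hσ i hi ?_
    have : Submodule.span ℝ (w '' t) ≤ LinearMap.ker (coord w σ i) := by
      rw [Submodule.span_le]
      rintro _ ⟨j, hj, rfl⟩
      exact hσ.coord_ne (htσ hj) (fun h => hit (h ▸ hj))
    exact this hy
  have hzero : ∀ j ∉ σ, r j = 0 := by
    intro j hj
    by_contra h
    have hpos : 0 < r j := lt_of_le_of_ne (hr j) (Ne.symm h)
    have h1 := reducedCost_mul_nonneg_of_min hσ hr hσt hmin 1 (Or.inr hpos)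
    have h2 := reducedCost_mul_nonneg_of_min hσ hr hσt hmin (-1) (Or.inr hpos)
    exact hc σ hσ j hj (by linarith)
  have hcell : IsCell w c σ := by
    refine ⟨hσ, fun j hj => lt_of_le_of_ne ?_ (hc σ hσ j hj).symm⟩
    simpa using reducedCost_mul_nonneg_of_min hσ hr hσt hmin (j := j) 1 (Or.inl one_pos)
  have hcoord : ∀ i ∈ σ, coord w σ i (∑ i, r i • w i) = r i := by
    intro i hi
    rw [map_sum, Finset.sum_eq_single i]
    · simp [hσ.coord_self hi]
    · intro j _ hji
      by_cases hj : j ∈ σ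
      · simp [hσ.coord_ne hj hji]
      · simp [hzero j hj]
    · simp
  have hpos : ∀ i ∈ σ, 0 < coord w σ i (∑ i, r i • w i) := fun i hi => by
    rw [hcoord i hi]; exact hσt i hi
  refine ⟨σ, ⟨hcell, hpos⟩, fun τ hτ => ?_⟩
  exact (hcell.subset hτ.1 hpos hτ.2).antisymm (hτ.1.subset hcell hτ.2 hpos)

/-- A triangulation of a cone in which every maximal cell contains the generator `w k`, with the
opposite facet of the cell lying on the boundary of the cone. -/
theorem exists_star_triangulation {ht : E →ₗ[ℝ] ℝ} (hht : ∀ i, 0 < ht (w i))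
    (hw : ⊤ ≤ Submodule.span ℝ (Set.range w)) (k : ι) :
    ∃ T : Finset (Finset ι),
      (∀ σ ∈ T, IsBasis w σ ∧ k ∈ σ ∧ ∀ j, 0 ≤ coord w σ k (w j)) ∧
      ∀ y ∈ cone w, (∀ σ, IsBasis w σ → ∀ i ∈ σ, coord w σ i y ≠ 0) →
        ∃! σ, σ ∈ T ∧ ∀ i ∈ σ, 0 < coord w σ i y := by
  classical
  let rc : Finset ι → ι → (ι → ℝ) →ₗ[ℝ] ℝ := fun σ j =>
    LinearMap.proj j - ∑ i, coord w σ i (w j) • LinearMap.proj i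
  have hrc : ∀ c σ j, rc σ j c = reducedCost w c σ j := by
    intro c σ j
    simp [rc, reducedCost, LinearMap.sum_apply, mul_comm]
  obtain ⟨c, -, hc⟩ := exists_pos_forall_apply_ne_zero
    ((Finset.univ.image fun p : Finset ι × ι => rc p.1 p.2).filter (· ≠ 0)) (by simp)
  have hc' : ∀ σ, ∀ j ∉ σ, reducedCost w c σ j ≠ 0 := by
    intro σ j hj
    rw [← hrc]
    refine hc _ (Finset.mem_filter.2 ⟨Finset.mem_image.2 ⟨(σ, j), Finset.mem_univ _, rfl⟩, ?_⟩)
    intro h0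
    have := LinearMap.congr_fun h0 (Pi.single j 1)
    rw [hrc, reducedCost, Finset.sum_eq_zero] at this
    · simp at this
    · intro i _
      by_cases hi : i = j
      · subst hi
        simp [coord_of_notMem hj]
      · simp [hi]
  have hev : ∀ᶠ ε in 𝓝[>] (0 : ℝ), ∀ σ : Finset ι, ∀ j ∉ σ,
      (0 < -reducedCost w (Pi.single k 1) σ j + ε * reducedCost w c σ j ↔
        LexPos (reducedCost w c σ j) (-reducedCost w (Pi.single k 1) σ j)) ∧
      -reducedCost w (Pi.single k 1) σ j + ε * reducedCost w c σ j ≠ 0 := by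
    rw [eventually_all]
    intro σ
    rw [eventually_all]
    intro j
    by_cases hj : j ∈ σ
    · simp [hj]
    · simpa [hj] using eventually_pos_iff_lexPos (-reducedCost w (Pi.single k 1) σ j) _
        (Or.inr (hc' σ j hj))
  obtain ⟨ε, hε⟩ := hev.exists
  let c' : ι → ℝ := -Pi.single k 1 + ε • c
  have hrc' : ∀ σ j, reducedCost w c' σ j =
      -reducedCost w (Pi.single k 1) σ j + ε * reducedCost w c σ j := by
    intro σ j
    simp only [← hrc, c']
    simp
  have hk : ∀ σ j, -reducedCost w (Pi.single k 1) σ j =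
      coord w σ k (w j) - if j = k then 1 else 0 := by
    intro σ j
    simp [reducedCost, Pi.single_apply]
  refine ⟨Finset.univ.filter (IsCell w c'), ?_, fun y hy hgen => ?_⟩
  · intro σ hσ
    obtain ⟨hb, hσ⟩ := (Finset.mem_filter.1 hσ).2
    have hnn : ∀ j ∉ σ, 0 ≤ coord w σ k (w j) - if j = k then 1 else 0 := by
      intro j hj
      have := hσ j hj
      rw [hrc', (hε σ j hj).1, hk] at this
      rcases this with h | h
      · exact h.le
      · exact h.1.ge
    have hkσ : k ∈ σ := by
      by_contra h
      have := hnn k h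
      norm_num [coord_of_notMem h] at this
    refine ⟨hb, hkσ, fun j => ?_⟩
    by_cases hj : j ∈ σ
    · by_cases hjk : j = k
      · subst hjk
        simp [hb.coord_self hj]
      · simp [hb.coord_ne hj hjk]
    · simpa [show j ≠ k from fun h => hj (h ▸ hkσ)] using hnn j hj
  · simpa using existsUnique_isCell hht hw (c := c')
      (fun σ _ j hj => by rw [hrc']; exact (hε σ j hj).2) hy hgen

end Triangulation

section GeneratingFunction

variable {E : Type*} [AddCommGroup E] [Module ℝ E] {ht : E →ₗ[ℝ] ℝ}

/-- The generating function counting the elements of `S` by their height. -/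
noncomputable def genFun (ht : E →ₗ[ℝ] ℝ) (S : Set E) : PowerSeries ℤ :=
  PowerSeries.mk fun n => ({y ∈ S | ht y = n}.ncard : ℤ)

/-- The set `S` has finitely many elements of each natural height. -/
def SliceFinite (ht : E →ₗ[ℝ] ℝ) (S : Set E) : Prop := ∀ n : ℕ, {y ∈ S | ht y = n}.Finite

theorem SliceFinite.mono {S T : Set E} (hT : SliceFinite ht T) (hST : S ⊆ T) : SliceFinite ht S :=
  fun n => (hT n).subset fun _ hy => ⟨hST hy.1, hy.2⟩

theorem genFun_coeff_nonneg (S : Set E) (n : ℕ) : 0 ≤ PowerSeries.coeff n (genFun ht S) := by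
  simp [genFun]

theorem genFun_diff {S T : Set E} (hT : SliceFinite ht T) (hST : S ⊆ T) :
    genFun ht (T \ S) = genFun ht T - genFun ht S := by
  ext n
  simp only [genFun, PowerSeries.coeff_mk, map_sub]
  have h : {y ∈ T \ S | ht y = n} = {y ∈ T | ht y = n} \ {y ∈ S | ht y = n} := by
    ext y
    simp only [Set.mem_sdiff, Set.mem_ofPred_eq]
    tauto
  have hsub : {y ∈ S | ht y = n} ⊆ {y ∈ T | ht y = n} := fun _ hy => ⟨hST hy.1, hy.2⟩
  rw [h, eq_sub_iff_add_eq]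
  exact_mod_cast Set.ncard_sdiff_add_ncard_of_subset hsub (hT n)

theorem genFun_eq_sum {κ : Type*} {S : Set E} (hS : SliceFinite ht S) (T : Finset κ) (K : κ → Set E)
    (hK : ∀ i ∈ T, K i ⊆ S) (hex : ∀ y ∈ S, ∃! i, i ∈ T ∧ y ∈ K i) :
    genFun ht S = ∑ i ∈ T, genFun ht (K i) := by
  classical
  induction T using Finset.induction_on generalizing S with
  | empty =>
    have : S = ∅ := Set.eq_empty_of_forall_notMem fun y hy => by
      obtain ⟨i, hi, -⟩ := hex y hy
      simp at hi
    subst this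
    ext n
    simp [genFun]
  | insert a T ha ih =>
    have hKa := hK a (Finset.mem_insert_self a T)
    rw [Finset.sum_insert ha, ← ih (S := S \ K a) (hS.mono Set.sdiff_subset), genFun_diff hS hKa]
    · ring
    · intro i hi y hy
      refine ⟨hK i (Finset.mem_insert_of_mem hi) hy, fun hya => ha ?_⟩
      have := (hex y (hKa hya)).unique ⟨Finset.mem_insert_self a T, hya⟩
        ⟨Finset.mem_insert_of_mem hi, hy⟩
      exact this ▸ hi
    · rintro y ⟨hy, hya⟩
      obtain ⟨i, ⟨hi, hyi⟩, huniq⟩ := hex y hy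
      have hia : i ≠ a := fun h => hya (h ▸ hyi)
      exact ⟨i, ⟨Finset.mem_of_mem_insert_of_ne hi hia, hyi⟩,
        fun j hj => huniq j ⟨Finset.mem_insert_of_mem hj.1, hj.2⟩⟩

theorem X_pow_mul_genFun {K : Set E} (hK : ∀ y ∈ K, 0 ≤ ht y) {g : E} {k : ℕ} (hg : ht g = k) :
    PowerSeries.X ^ k * genFun ht K = genFun ht ((g + ·) '' K) := by
  ext n
  rw [PowerSeries.coeff_X_pow_mul']
  simp only [genFun, PowerSeries.coeff_mk]
  have himg : {y ∈ (g + ·) '' K | ht y = n} = (g + ·) '' {y ∈ K | ht y = (n : ℝ) - k} := by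
    ext y
    constructor
    · rintro ⟨⟨z, hz, rfl⟩, h⟩
      refine ⟨z, ⟨hz, ?_⟩, rfl⟩
      simp only [map_add, hg] at h
      linarith
    · rintro ⟨z, ⟨hz, h⟩, rfl⟩
      refine ⟨⟨z, hz, rfl⟩, ?_⟩
      simp only [map_add, hg, h]
      ring
  rw [himg, Set.ncard_image_of_injective _ (add_right_injective g)]
  split_ifs with h
  · rw [Nat.cast_sub h]
  · have : {y ∈ K | ht y = (n : ℝ) - k} = ∅ := by
      refine Set.eq_empty_of_forall_notMem fun y hy => ?_
      have h1 := hK y hy.1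
      have h2 : (n : ℝ) < k := by exact_mod_cast not_le.1 h
      have h3 := hy.2
      linarith
    simp [this]

theorem one_sub_X_pow_mul_genFun {K : Set E} (hfin : SliceFinite ht K) (hK : ∀ y ∈ K, 0 ≤ ht y)
    {g : E} {k : ℕ} (hg : ht g = k) (hgK : ∀ y ∈ K, g + y ∈ K) :
    (1 - PowerSeries.X ^ k) * genFun ht K = genFun ht {y ∈ K | y - g ∉ K} := by
  have h : {y ∈ K | y - g ∉ K} = K \ ((g + ·) '' K) := by
    ext y
    have : y ∈ (g + ·) '' K ↔ y - g ∈ K := by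
      constructor
      · rintro ⟨z, hz, rfl⟩
        simpa using hz
      · exact fun h => ⟨_, h, by simp⟩
    rw [Set.mem_sdiff, this]
    rfl
  rw [h, genFun_diff hfin (by rintro _ ⟨y, hy, rfl⟩; exact hgK y hy), sub_mul, one_mul,
    X_pow_mul_genFun hK hg]

end GeneratingFunction

section Cell

variable {ι E : Type*} [AddCommGroup E] [Module ℝ E] {ht : E →ₗ[ℝ] ℝ} {w : ι → E} {σ : Finset ι}

/-- The elements of `L` whose coordinates with respect to `σ` satisfy the predicates `Q`. -/
def cell (L : AddSubgroup E) (w : ι → E) (σ : Finset ι) (Q : ι → ℝ → Prop) : Set E :=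
  {y | y ∈ L ∧ ∀ i ∈ σ, Q i (coord w σ i y)}

theorem IsBasis.ht_eq (h : IsBasis w σ) (y : E) : ht y = ∑ i ∈ σ, coord w σ i y * ht (w i) := by
  conv_lhs => rw [← h.sum_coord y]
  simp

theorem prod_mul_genFun_cell (hσ : IsBasis w σ) {L : AddSubgroup E} {k : ι → ℕ}
    (hwL : ∀ i, w i ∈ L) (hk : ∀ i, ht (w i) = k i) {Q : ι → ℝ → Prop}
    (hQ : ∀ i ∈ σ, ∀ t, Q i t → 0 ≤ t) (hfin : SliceFinite ht (cell L w σ Q)) (T : Finset ι)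
    (hT : T ⊆ σ) (hQT : ∀ i ∈ T, ∀ t, Q i t → Q i (t + 1)) :
    (∏ i ∈ T, (1 - PowerSeries.X ^ k i)) * genFun ht (cell L w σ Q) =
      genFun ht (cell L w σ fun i t => Q i t ∧ (i ∈ T → ¬ Q i (t - 1))) := by
  classical
  induction T using Finset.induction_on with
  | empty => simp
  | insert j T hj ih =>
    rw [Finset.insert_subset_iff] at hT
    have hsub : cell L w σ (fun i t => Q i t ∧ (i ∈ T → ¬ Q i (t - 1))) ⊆ cell L w σ Q :=
      fun y hy => ⟨hy.1, fun i hi => (hy.2 i hi).1⟩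
    rw [Finset.prod_insert hj, mul_assoc,
      ih hT.2 fun i hi => hQT i (Finset.mem_insert_of_mem hi),
      one_sub_X_pow_mul_genFun (hfin.mono hsub) ?_ (hk j) ?_]
    · congr 1
      ext y
      constructor
      · rintro ⟨hy, hyj⟩
        refine ⟨hy.1, fun i hi => ⟨(hy.2 i hi).1, fun hiT => ?_⟩⟩
        rcases Finset.mem_insert.1 hiT with rfl | hiT
        · intro hQi
          refine hyj ⟨L.sub_mem hy.1 (hwL i), fun l hl => ?_⟩
          rw [map_sub]
          by_cases hli : i = l
          · subst hli
            rw [hσ.coord_self hT.1]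
            exact ⟨hQi, fun h => absurd h hj⟩
          · rw [hσ.coord_ne hT.1 hli, sub_zero]
            exact hy.2 l hl
        · exact (hy.2 i hi).2 hiT
      · rintro hy
        refine ⟨⟨hy.1, fun i hi => ⟨(hy.2 i hi).1,
          fun hiT => (hy.2 i hi).2 (Finset.mem_insert_of_mem hiT)⟩⟩, fun hyj => ?_⟩
        have h1 := (hyj.2 j hT.1).1
        rw [map_sub, hσ.coord_self hT.1] at h1
        exact (hy.2 j hT.1).2 (Finset.mem_insert_self j T) h1
    · intro y hy
      rw [hσ.ht_eq y]
      refine Finset.sum_nonneg fun i hi => mul_nonneg (hQ i hi _ (hy.2 i hi).1) ?_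
      rw [hk]
      positivity
    · intro y hy
      refine ⟨L.add_mem (hwL j) hy.1, fun i hi => ?_⟩
      rw [map_add]
      by_cases hij : j = i
      · subst hij
        rw [hσ.coord_self hi, add_comm]
        exact ⟨hQT j (Finset.mem_insert_self j T) _ (hy.2 j hi).1, fun h => absurd h hj⟩
      · rw [hσ.coord_ne hT.1 hij, zero_add]
        exact hy.2 i hi

end Cell

theorem LexPos.nonneg {e t : ℝ} (h : LexPos e t) : 0 ≤ t := by
  rcases h with h | h <;> linarith

theorem LexPos.add_one {e t : ℝ} (h : LexPos e t) : LexPos e (t + 1) :=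
  Or.inl (by linarith [h.nonneg])

theorem le_one_of_not_lexPos {e t : ℝ} (h : ¬ LexPos e (t - 1)) : t ≤ 1 := by
  by_contra! h'
  exact h (Or.inl (by linarith))

theorem lexPos_neg_one_sub {e : ℝ} (he : e ≠ 0) (t : ℝ) :
    (LexPos (-e) (1 - t) ∧ ¬ LexPos (-e) (1 - t - 1)) ↔ (LexPos e t ∧ ¬ LexPos e (t - 1)) := by
  have h1 : 0 < 1 - t ↔ ¬ (0 < t - 1 ∨ t - 1 = 0) := by grind
  have h2 : 1 - t - 1 = -t := by ring
  rw [h2]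
  unfold LexPos
  grind

section Cone

variable {ι E : Type*} [Fintype ι] [AddCommGroup E] [Module ℝ E] {v : ι → E}

/-- The set of positive combinations of the family `v`. -/
def openCone (v : ι → E) : Set E := {y | ∃ r : ι → ℝ, (∀ i, 0 < r i) ∧ ∑ i, r i • v i = y}

theorem openCone_subset : openCone v ⊆ cone v := fun _ ⟨r, hr, h⟩ => ⟨r, fun i => (hr i).le, h⟩

theorem add_mem_cone {y z : E} (hy : y ∈ cone v) (hz : z ∈ cone v) : y + z ∈ cone v := by
  obtain ⟨r, hr, rfl⟩ := hy
  obtain ⟨s, hs, rfl⟩ := hz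
  exact ⟨r + s, fun i => add_nonneg (hr i) (hs i), by simp [add_smul, Finset.sum_add_distrib]⟩

theorem add_mem_openCone {y z : E} (hy : y ∈ cone v) (hz : z ∈ openCone v) :
    y + z ∈ openCone v := by
  obtain ⟨r, hr, rfl⟩ := hy
  obtain ⟨s, hs, rfl⟩ := hz
  exact ⟨r + s, fun i => add_pos_of_nonneg_of_pos (hr i) (hs i),
    by simp [add_smul, Finset.sum_add_distrib]⟩

theorem smul_mem_cone {y : E} (hy : y ∈ cone v) {c : ℝ} (hc : 0 ≤ c) : c • y ∈ cone v := by
  obtain ⟨r, hr, rfl⟩ := hy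
  exact ⟨c • r, fun i => mul_nonneg hc (hr i), by simp [mul_smul, Finset.smul_sum]⟩

theorem smul_mem_openCone {y : E} (hy : y ∈ openCone v) {c : ℝ} (hc : 0 < c) :
    c • y ∈ openCone v := by
  obtain ⟨r, hr, rfl⟩ := hy
  exact ⟨c • r, fun i => mul_pos hc (hr i), by simp [mul_smul, Finset.smul_sum]⟩

theorem mem_cone_self (i : ι) : v i ∈ cone v := by
  classical
  exact ⟨Pi.single i 1,
    (Pi.single_nonneg.2 zero_le_one : (0 : ι → ℝ) ≤ Pi.single i 1), by simp [Pi.single_apply]⟩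

theorem sum_mem_cone {κ : Type*} (s : Finset κ) {f : κ → E} (hf : ∀ i ∈ s, f i ∈ cone v) :
    ∑ i ∈ s, f i ∈ cone v := by
  classical
  induction s using Finset.induction_on with
  | empty => exact ⟨0, by simp, by simp⟩
  | insert a s ha ih =>
    rw [Finset.sum_insert ha]
    exact add_mem_cone (hf a (Finset.mem_insert_self a s))
      (ih fun i hi => hf i (Finset.mem_insert_of_mem hi))

theorem cone_option {x : E} (hx : x ∈ cone v) : cone (fun o : Option ι => o.elim x v) = cone v := by
  ext y
  constructor
  · rintro ⟨r, hr, rfl⟩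
    refine sum_mem_cone _ fun o _ => smul_mem_cone ?_ (hr o)
    cases o with
    | none => exact hx
    | some i => exact mem_cone_self i
  · rintro ⟨r, hr, rfl⟩
    exact ⟨fun o => o.elim 0 r, fun o => by cases o <;> simp [hr], by simp [Fintype.sum_option]⟩

theorem mem_openCone_iff {q y : E} (hq : q ∈ openCone v) :
    y ∈ openCone v ↔ ∀ᶠ ε in 𝓝[>] (0 : ℝ), y + ε • (-q) ∈ cone v := by
  constructor
  · rintro ⟨r, hr, rfl⟩
    obtain ⟨s, hs, rfl⟩ := hq
    have : ∀ᶠ ε in 𝓝[>] (0 : ℝ), ∀ i, 0 < r i + ε * (-s i) := by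
      rw [eventually_all]
      intro i
      filter_upwards [eventually_pos_iff_lexPos (r i) (-s i) (Or.inl (hr i).ne')] with ε hε
      exact hε.1.2 (Or.inl (hr i))
    filter_upwards [this] with ε hε
    refine ⟨fun i => r i + ε * (-s i), fun i => (hε i).le, ?_⟩
    simp [add_smul, mul_smul, Finset.sum_add_distrib, Finset.smul_sum]
  · intro h
    obtain ⟨ε, hε, hε0⟩ := (h.and self_mem_nhdsWithin).exists
    have := add_mem_openCone hε (smul_mem_openCone hq hε0)
    simpa using this

theorem exists_generic_mem_openCone (hv : ⊤ ≤ Submodule.span ℝ (Set.range v)) {κ : Type*}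
    [Finite κ] (w : κ → E) :
    ∃ q ∈ openCone v, ∀ σ, IsBasis w σ → ∀ i ∈ σ, coord w σ i q ≠ 0 := by
  classical
  cases nonempty_fintype κ
  obtain ⟨r, hr, hF⟩ := exists_pos_forall_apply_ne_zero
    ((Finset.univ.image fun p : Finset κ × κ =>
      coord w p.1 p.2 ∘ₗ Fintype.linearCombination ℝ v).filter (· ≠ 0)) (by simp)
  refine ⟨∑ i, r i • v i, ⟨r, hr, rfl⟩, fun σ hσ i hi => ?_⟩
  refine hF _ (Finset.mem_filter.2 ⟨Finset.mem_image.2 ⟨(σ, i), Finset.mem_univ _, rfl⟩, ?_⟩)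
  intro h0
  have hker : Submodule.span ℝ (Set.range v) ≤ LinearMap.ker (coord w σ i) := by
    rw [Submodule.span_le]
    rintro _ ⟨j, rfl⟩
    simpa using LinearMap.congr_fun h0 (Pi.single j 1)
  have : coord w σ i (w i) = 0 := hker (hv Submodule.mem_top)
  simp [hσ.coord_self hi] at this

theorem existsUnique_lexPos {T : Finset (Finset ι)} {w : ι → E} (hTb : ∀ σ ∈ T, IsBasis w σ)
    (hT : ∀ y ∈ cone w, (∀ σ, IsBasis w σ → ∀ i ∈ σ, coord w σ i y ≠ 0) →
        ∃! σ, σ ∈ T ∧ ∀ i ∈ σ, 0 < coord w σ i y)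
    {p y : E} (hp : ∀ σ, IsBasis w σ → ∀ i ∈ σ, coord w σ i p ≠ 0)
    (hy : ∀ᶠ ε in 𝓝[>] (0 : ℝ), y + ε • p ∈ cone w) :
    ∃! σ, σ ∈ T ∧ ∀ i ∈ σ, LexPos (coord w σ i p) (coord w σ i y) := by
  have hev : ∀ᶠ ε in 𝓝[>] (0 : ℝ), ∀ σ, IsBasis w σ → ∀ i ∈ σ,
      (0 < coord w σ i (y + ε • p) ↔ LexPos (coord w σ i p) (coord w σ i y)) ∧
        coord w σ i (y + ε • p) ≠ 0 := by
    simp only [map_add, map_smul, smul_eq_mul]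
    rw [eventually_all]
    intro σ
    rw [eventually_imp_distrib_left]
    intro hσ
    rw [Filter.eventually_all_finset]
    intro i hi
    exact eventually_pos_iff_lexPos _ _ (Or.inr (hp σ hσ i hi))
  obtain ⟨ε, hε, hεy⟩ := (hev.and hy).exists
  have := hT _ hεy fun σ hσ i hi => (hε σ hσ i hi).2
  refine (existsUnique_congr fun σ => ?_).1 this
  refine and_congr_right fun hσ => forall₂_congr fun i hi => ?_
  exact (hε σ (hTb σ hσ) i hi).1

theorem eventually_mem_cone_of_lexPos {w : ι → E} {σ : Finset ι} (hσ : IsBasis w σ) {p y : E}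
    (h : ∀ i ∈ σ, LexPos (coord w σ i p) (coord w σ i y)) :
    ∀ᶠ ε in 𝓝[>] (0 : ℝ), y + ε • p ∈ cone w := by
  have hev : ∀ᶠ ε in 𝓝[>] (0 : ℝ), ∀ i ∈ σ, 0 < coord w σ i (y + ε • p) := by
    simp only [map_add, map_smul, smul_eq_mul]
    rw [Filter.eventually_all_finset]
    intro i hi
    filter_upwards [eventually_pos_iff_lexPos (coord w σ i y) (coord w σ i p)
      ((h i hi).imp (fun h => h.ne') fun h => h.2.ne')] with ε hε
    exact hε.1.2 (h i hi)
  filter_upwards [hev] with ε hε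
  rw [← hσ.sum_coord (y + ε • p)]
  exact sum_mem_cone _ fun i hi => smul_mem_cone (mem_cone_self i) (hε i hi).le

end Cone

section Box

variable {ι E : Type*} [AddCommGroup E] [Module ℝ E] {ht : E →ₗ[ℝ] ℝ} {w : ι → E} {σ : Finset ι}

theorem cell_congr {L : AddSubgroup E} {Q Q' : ι → ℝ → Prop}
    (h : ∀ i ∈ σ, ∀ t, Q i t ↔ Q' i t) : cell L w σ Q = cell L w σ Q' := by
  ext y
  exact and_congr_right fun _ => forall₂_congr fun i hi => h i hi _

/-- The half-open cone over the cell `σ`, with facets removed according to the direction `p`. -/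
def halfOpenCone (L : AddSubgroup E) (w : ι → E) (σ : Finset ι) (p : E) : Set E :=
  cell L w σ fun i t => LexPos (coord w σ i p) t

/-- The half-open fundamental parallelepiped of `halfOpenCone L w σ p`. -/
def box (L : AddSubgroup E) (w : ι → E) (σ : Finset ι) (p : E) : Set E :=
  cell L w σ fun i t => LexPos (coord w σ i p) t ∧ ¬ LexPos (coord w σ i p) (t - 1)

theorem box_subset {L : AddSubgroup E} {p : E} : box L w σ p ⊆ halfOpenCone L w σ p :=
  fun _ hy => ⟨hy.1, fun i hi => (hy.2 i hi).1⟩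

theorem prod_mul_genFun_halfOpenCone (hσ : IsBasis w σ) {L : AddSubgroup E} {k : ι → ℕ}
    (hwL : ∀ i, w i ∈ L) (hk : ∀ i, ht (w i) = k i) (p : E)
    (hfin : SliceFinite ht (halfOpenCone L w σ p)) :
    (∏ i ∈ σ, (1 - PowerSeries.X ^ k i)) * genFun ht (halfOpenCone L w σ p) =
      genFun ht (box L w σ p) := by
  rw [halfOpenCone, prod_mul_genFun_cell hσ hwL hk (fun i _ t h => h.nonneg) hfin σ subset_rfl
    fun i _ t h => h.add_one]
  congr 1
  exact cell_congr fun i hi t => by simp [hi]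

theorem coeff_genFun_box_neg (hσ : IsBasis w σ) {L : AddSubgroup E} {k : ι → ℕ}
    (hwL : ∀ i, w i ∈ L) (hk : ∀ i, ht (w i) = k i) {p : E} (hp : ∀ i ∈ σ, coord w σ i p ≠ 0)
    (n : ℕ) : PowerSeries.coeff n (genFun ht (box L w σ (-p))) =
      if n ≤ ∑ i ∈ σ, k i then
        PowerSeries.coeff (∑ i ∈ σ, k i - n) (genFun ht (box L w σ p)) else 0 := by
  classical
  have hg : ∀ j ∈ σ, coord w σ j (∑ i ∈ σ, w i) = 1 := by
    intro j hj
    rw [map_sum, Finset.sum_eq_single j]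
    · exact hσ.coord_self hj
    · exact fun i hi hij => hσ.coord_ne hi hij
    · exact fun h => absurd hj h
  have hgL : ∑ i ∈ σ, w i ∈ L := L.sum_mem fun i _ => hwL i
  have hght : ht (∑ i ∈ σ, w i) = ∑ i ∈ σ, k i := by simp [hk]
  have hmem : ∀ y, ∑ i ∈ σ, w i - y ∈ box L w σ (-p) ↔ y ∈ box L w σ p := by
    intro y
    refine and_congr ?_ (forall₂_congr fun i hi => ?_)
    · exact ⟨fun h => by simpa using L.sub_mem hgL h, fun h => L.sub_mem hgL h⟩
    · simp only [map_sub, hg i hi, map_neg]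
      exact lexPos_neg_one_sub (hp i hi) _
  have himg : {y ∈ box L w σ (-p) | ht y = n} =
      (∑ i ∈ σ, w i - ·) '' {y ∈ box L w σ p | ht y = (∑ i ∈ σ, k i : ℕ) - (n : ℝ)} := by
    ext y
    constructor
    · rintro ⟨hy, hn⟩
      refine ⟨∑ i ∈ σ, w i - y, ⟨(hmem _).1 (by simpa using hy), ?_⟩, by simp⟩
      rw [map_sub, hght, hn]
    · rintro ⟨z, ⟨hz, hn⟩, rfl⟩
      refine ⟨(hmem z).2 hz, ?_⟩
      simp only [map_sub, hght, hn]
      simp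
  simp only [genFun, PowerSeries.coeff_mk, himg]
  rw [Set.ncard_image_of_injective _ sub_right_injective]
  split_ifs with h
  · rw [Nat.cast_sub h]
  · have : {y ∈ box L w σ p | ht y = (∑ i ∈ σ, k i : ℕ) - (n : ℝ)} = ∅ := by
      refine Set.eq_empty_of_forall_notMem fun y hy => ?_
      have h1 : 0 ≤ ht y := by
        rw [hσ.ht_eq y]
        refine Finset.sum_nonneg fun i hi => mul_nonneg (hy.1.2 i hi).1.nonneg ?_
        rw [hk]
        positivity
      have h2 : ((∑ i ∈ σ, k i : ℕ) : ℝ) < n := by exact_mod_cast not_le.1 h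
      have h3 := hy.2
      linarith
    rw [this]
    simp

theorem coeff_genFun_box_eq_zero (hσ : IsBasis w σ) {L : AddSubgroup E} {k : ι → ℕ}
    (hk : ∀ i, ht (w i) = k i) {p : E} {j : ι} (hj : j ∈ σ) (hjp : 0 < coord w σ j p)
    (hkj : 0 < k j) {n : ℕ} (hn : ∑ i ∈ σ, k i ≤ n) :
    PowerSeries.coeff n (genFun ht (box L w σ p)) = 0 := by
  have : {y ∈ box L w σ p | ht y = n} = ∅ := by
    refine Set.eq_empty_of_forall_notMem fun y hy => ?_
    have h1 : ht y < ∑ i ∈ σ, (k i : ℝ) := by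
      rw [hσ.ht_eq y]
      simp only [hk]
      refine Finset.sum_lt_sum (fun i hi => ?_) ⟨j, hj, ?_⟩
      · exact mul_le_of_le_one_left (by positivity) (le_one_of_not_lexPos (hy.1.2 i hi).2)
      · refine mul_lt_of_lt_one_left (by exact_mod_cast hkj) ?_
        by_contra! h
        refine (hy.1.2 j hj).2 ?_
        rcases h.lt_or_eq with h | h
        · exact Or.inl (by linarith)
        · exact Or.inr ⟨by linarith, hjp⟩
    rw [hy.2] at h1
    have : n < ∑ i ∈ σ, k i := by exact_mod_cast h1
    omega
  simp [genFun, this]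

/-- The part of a half-open cone on the facet opposite to `w j`. -/
theorem prod_mul_genFun_facet [DecidableEq ι] (hσ : IsBasis w σ) {L : AddSubgroup E} {k : ι → ℕ}
    (hwL : ∀ i, w i ∈ L) (hk : ∀ i, ht (w i) = k i) (p : E)
    (hfin : SliceFinite ht (halfOpenCone L w σ p)) {j : ι} (hj : j ∈ σ) :
    (∏ i ∈ σ.erase j, (1 - PowerSeries.X ^ k i)) *
        genFun ht {y ∈ halfOpenCone L w σ p | coord w σ j y = 0} =
      genFun ht {y ∈ box L w σ p | coord w σ j y = 0} := by
  have h : {y ∈ halfOpenCone L w σ p | coord w σ j y = 0} =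
      cell L w σ fun i t => LexPos (coord w σ i p) t ∧ (i = j → t = 0) := by
    ext y
    constructor
    · rintro ⟨hy, h0⟩
      exact ⟨hy.1, fun i hi => ⟨hy.2 i hi, by rintro rfl; exact h0⟩⟩
    · rintro hy
      exact ⟨⟨hy.1, fun i hi => (hy.2 i hi).1⟩, (hy.2 j hj).2 rfl⟩
  rw [h, prod_mul_genFun_cell hσ hwL hk (fun i _ t h => h.1.nonneg)
    (h ▸ hfin.mono fun y hy => hy.1) _ (Finset.erase_subset j σ)
    fun i hi t h => ⟨h.1.add_one, fun hij => absurd hij (Finset.ne_of_mem_erase hi)⟩]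
  congr 1
  ext y
  constructor
  · rintro hy
    refine ⟨⟨hy.1, fun i hi => ⟨(hy.2 i hi).1.1, fun hlex => ?_⟩⟩, (hy.2 j hj).1.2 rfl⟩
    by_cases hij : i = j
    · have := hlex.nonneg
      rw [(hy.2 i hi).1.2 hij] at this
      norm_num at this
    · exact (hy.2 i hi).2 (Finset.mem_erase.2 ⟨hij, hi⟩) ⟨hlex, fun h => absurd h hij⟩
  · rintro ⟨hy, h0⟩
    exact ⟨hy.1, fun i hi => ⟨⟨(hy.2 i hi).1, by rintro rfl; exact h0⟩,
      fun _ h => (hy.2 i hi).2 h.1⟩⟩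

end Box

section Decomposition

variable {ι E : Type*} [Fintype ι] [AddCommGroup E] [Module ℝ E]

/-- Starring the cone over `v` at an interior lattice point `x` of height `k` splits its numerator
into a contribution `N₀` of the boundary and a remainder `N₁`, and replacing the cone by its
interior reverses the numerator. -/
theorem exists_boundary_decomposition {v : ι → E} {ht : E →ₗ[ℝ] ℝ} {L : AddSubgroup E} {d : ℕ}
    (hd : Module.finrank ℝ E = d + 1) (hv : ⊤ ≤ Submodule.span ℝ (Set.range v))
    (hvL : ∀ i, v i ∈ L) (hv1 : ∀ i, ht (v i) = 1) (hfin : SliceFinite ht (L ∩ cone v))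
    {x : E} (hxL : x ∈ L) (hx : x ∈ openCone v) {k : ℕ} (hxk : ht x = k) :
    0 < k ∧ ∃ N₀ N₁ : PowerSeries ℤ,
      (∀ n, 0 ≤ PowerSeries.coeff n N₀) ∧ (∀ n, 0 ≤ PowerSeries.coeff n N₁) ∧
      (∀ n, d + k ≤ n → PowerSeries.coeff n (N₀ + N₁) = 0) ∧
      (1 - PowerSeries.X) ^ d * (1 - PowerSeries.X ^ k) * genFun ht (L ∩ cone v) = N₀ + N₁ ∧
      (1 - PowerSeries.X) ^ d * (genFun ht (L ∩ cone v) - genFun ht (L ∩ openCone v)) = N₀ ∧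
      ∀ n, PowerSeries.coeff n
        ((1 - PowerSeries.X) ^ d * (1 - PowerSeries.X ^ k) * genFun ht (L ∩ openCone v)) =
          if n ≤ d + k then PowerSeries.coeff (d + k - n) (N₀ + N₁) else 0 := by
  classical
  have : Nontrivial E := Module.nontrivial_of_finrank_pos (R := ℝ) (by omega)
  have : Nonempty ι := by
    by_contra h
    rw [not_nonempty_iff] at h
    rw [Set.range_eq_empty v, Submodule.span_empty, top_le_iff] at hv
    exact bot_ne_top hv
  have hk0 : 0 < k := by
    obtain ⟨r, hr, rfl⟩ := hx
    have : (0 : ℝ) < k := by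
      rw [← hxk, map_sum]
      refine Finset.sum_pos (fun i _ => ?_) Finset.univ_nonempty
      simpa [hv1] using hr i
    exact_mod_cast this
  refine ⟨hk0, ?_⟩
  set w : Option ι → E := fun o => o.elim x v
  let h : Option ι → ℕ := fun o => o.elim k fun _ => 1
  have hcone : cone w = cone v := cone_option (openCone_subset hx)
  have hwL : ∀ o, w o ∈ L := fun o => by cases o <;> simp [w, hxL, hvL]
  have hh : ∀ o, ht (w o) = h o := fun o => by cases o <;> simp [w, h, hxk, hv1]
  have hht : ∀ o, 0 < ht (w o) := fun o => by
    rw [hh]; cases o <;> simp [h, hk0]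
  have hw : ⊤ ≤ Submodule.span ℝ (Set.range w) := by
    refine hv.trans (Submodule.span_mono ?_)
    rintro _ ⟨i, rfl⟩
    exact ⟨some i, rfl⟩
  obtain ⟨T, hT, hTu⟩ := exists_star_triangulation hht hw none
  obtain ⟨q, hq, hqgen⟩ := exists_generic_mem_openCone hv w
  have hqneg : ∀ σ, IsBasis w σ → ∀ i ∈ σ, coord w σ i (-q) ≠ 0 := fun σ hσ i hi => by
    simpa using hqgen σ hσ i hi
  have hqnone : ∀ σ ∈ T, 0 < coord w σ none q := by
    intro σ hσ
    obtain ⟨hσb, hn, hnn⟩ := hT σ hσ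
    refine lt_of_le_of_ne ?_ (hqgen σ hσb none hn).symm
    obtain ⟨r, hr, rfl⟩ := hq
    rw [map_sum]
    refine Finset.sum_nonneg fun i _ => ?_
    rw [map_smul]
    exact mul_nonneg (hr i).le (hnn (some i))
  have hsum : ∀ σ ∈ T, ∑ i ∈ σ, h i = d + k ∧ ∏ i ∈ σ.erase none,
      (1 - PowerSeries.X ^ h i : PowerSeries ℤ) = (1 - PowerSeries.X) ^ d := by
    intro σ hσ
    obtain ⟨hσb, hn, -⟩ := hT σ hσ
    have hcard : (σ.erase none).card = d := by
      rw [Finset.card_erase_of_mem hn, hσb.card_eq, hd]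
      simp
    have h1 : ∀ i ∈ σ.erase none, h i = 1 := by
      intro i hi
      cases i with
      | none => simp at hi
      | some i => rfl
    constructor
    · rw [← Finset.sum_erase_add _ _ hn, Finset.sum_congr rfl h1]
      simp [hcard, h]
    · rw [Finset.prod_congr rfl fun i hi => by rw [h1 i hi]]
      simp [hcard]
  have hprod : ∀ σ ∈ T, ∏ i ∈ σ, (1 - PowerSeries.X ^ h i : PowerSeries ℤ) =
      (1 - PowerSeries.X) ^ d * (1 - PowerSeries.X ^ k) := by
    intro σ hσ
    rw [← Finset.prod_erase_mul _ _ (hT σ hσ).2.1, (hsum σ hσ).2]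
    rfl
  have hIsub : (L ∩ openCone v : Set E) ⊆ L ∩ cone v :=
    Set.inter_subset_inter_right _ openCone_subset
  have hKsub : ∀ σ ∈ T, halfOpenCone L w σ q ⊆ L ∩ cone v := by
    intro σ hσ y hy
    refine ⟨hy.1, ?_⟩
    rw [← hcone, ← (hT σ hσ).1.sum_coord y]
    exact sum_mem_cone _ fun i hi => smul_mem_cone (mem_cone_self i) (hy.2 i hi).nonneg
  have hKnsub : ∀ σ ∈ T, halfOpenCone L w σ (-q) ⊆ L ∩ openCone v := by
    intro σ hσ y hy
    refine ⟨hy.1, ?_⟩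
    rw [mem_openCone_iff hq, ← hcone]
    exact eventually_mem_cone_of_lexPos (hT σ hσ).1 hy.2
  have hexC : ∀ y ∈ (L ∩ cone v : Set E), ∃! σ, σ ∈ T ∧ y ∈ halfOpenCone L w σ q := by
    rintro y ⟨hyL, hy⟩
    have := existsUnique_lexPos (fun σ hσ => (hT σ hσ).1) hTu hqgen (y := y) (by
      filter_upwards [self_mem_nhdsWithin] with ε hε
      rw [hcone]
      exact add_mem_cone hy (smul_mem_cone (openCone_subset hq) (le_of_lt hε)))
    refine (existsUnique_congr fun σ => ?_).1 this
    exact and_congr_right fun _ => ⟨fun h => ⟨hyL, h⟩, fun h => h.2⟩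
  have hexI : ∀ y ∈ (L ∩ openCone v : Set E), ∃! σ, σ ∈ T ∧ y ∈ halfOpenCone L w σ (-q) := by
    rintro y ⟨hyL, hy⟩
    have := existsUnique_lexPos (fun σ hσ => (hT σ hσ).1) hTu hqneg (y := y) (by
      rw [hcone]
      exact (mem_openCone_iff hq).1 hy)
    refine (existsUnique_congr fun σ => ?_).1 this
    exact and_congr_right fun _ => ⟨fun h => ⟨hyL, h⟩, fun h => h.2⟩
  have hbdry : ∀ σ ∈ T, ∀ y ∈ halfOpenCone L w σ q, y ∉ openCone v ↔ coord w σ none y = 0 := by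
    intro σ hσ y hy
    obtain ⟨hσb, hn, hnn⟩ := hT σ hσ
    constructor
    · intro hyI
      by_contra h0
      have hpos : 0 < coord w σ none y := lt_of_le_of_ne (hy.2 none hn).nonneg (Ne.symm h0)
      apply hyI
      rw [← hσb.sum_coord y, ← Finset.sum_erase_add _ _ hn]
      refine add_mem_openCone ?_ (smul_mem_openCone hx hpos)
      rw [← hcone]
      exact sum_mem_cone _ fun i hi => smul_mem_cone (mem_cone_self i)
        (hy.2 i (Finset.mem_of_mem_erase hi)).nonneg
    · intro h0 hyI
      rw [mem_openCone_iff hq] at hyI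
      obtain ⟨ε, ⟨r, hr, hrε⟩, hε⟩ := (hyI.and self_mem_nhdsWithin).exists
      have h1 : 0 ≤ coord w σ none (y + ε • -q) := by
        rw [← hrε, map_sum]
        refine Finset.sum_nonneg fun i _ => ?_
        rw [map_smul]
        exact mul_nonneg (hr i) (hnn (some i))
      have h2 := mul_pos hε (hqnone σ hσ)
      simp only [map_add, map_smul, map_neg, h0, smul_eq_mul] at h1
      linarith
  let F : Finset (Option ι) → Set E := fun σ => {y ∈ box L w σ q | coord w σ none y = 0}
  have hboxfin : ∀ σ ∈ T, SliceFinite ht (box L w σ q) := fun σ hσ =>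
    hfin.mono (box_subset.trans (hKsub σ hσ))
  have hN : ∑ σ ∈ T, genFun ht (F σ) + ∑ σ ∈ T, genFun ht (box L w σ q \ F σ) =
      ∑ σ ∈ T, genFun ht (box L w σ q) := by
    rw [← Finset.sum_add_distrib]
    refine Finset.sum_congr rfl fun σ hσ => ?_
    rw [genFun_diff (hboxfin σ hσ) fun y hy => hy.1]
    ring
  refine ⟨∑ σ ∈ T, genFun ht (F σ), ∑ σ ∈ T, genFun ht (box L w σ q \ F σ), ?_, ?_, ?_, ?_, ?_, ?_⟩
  · intro n
    rw [map_sum]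
    exact Finset.sum_nonneg fun σ _ => genFun_coeff_nonneg _ _
  · intro n
    rw [map_sum]
    exact Finset.sum_nonneg fun σ _ => genFun_coeff_nonneg _ _
  · intro n hn
    rw [hN, map_sum]
    refine Finset.sum_eq_zero fun σ hσ => ?_
    exact coeff_genFun_box_eq_zero (hT σ hσ).1 hh (hT σ hσ).2.1 (hqnone σ hσ) hk0
      ((hsum σ hσ).1.trans_le hn)
  · rw [hN, genFun_eq_sum hfin T _ hKsub hexC, Finset.mul_sum]
    refine Finset.sum_congr rfl fun σ hσ => ?_
    rw [← hprod σ hσ]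
    exact prod_mul_genFun_halfOpenCone (hT σ hσ).1 hwL hh q (hfin.mono (hKsub σ hσ))
  · rw [← genFun_diff hfin hIsub, genFun_eq_sum (hfin.mono Set.sdiff_subset) T
      fun σ => {y ∈ halfOpenCone L w σ q | coord w σ none y = 0}, Finset.mul_sum]
    · refine Finset.sum_congr rfl fun σ hσ => ?_
      rw [← (hsum σ hσ).2]
      exact prod_mul_genFun_facet (hT σ hσ).1 hwL hh q (hfin.mono (hKsub σ hσ)) (hT σ hσ).2.1
    · rintro σ hσ y ⟨hy, h0⟩
      exact ⟨hKsub σ hσ hy, fun h => (hbdry σ hσ y hy).2 h0 h.2⟩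
    · rintro y ⟨hyC, hyI⟩
      refine (existsUnique_congr fun σ => ?_).1 (hexC y hyC)
      refine and_congr_right fun hσ => ⟨fun hy => ⟨hy, ?_⟩, fun hy => hy.1⟩
      exact (hbdry σ hσ y hy).1 fun h => hyI ⟨hyC.1, h⟩
  · intro n
    rw [hN, genFun_eq_sum (hfin.mono hIsub) T _ hKnsub hexI, Finset.mul_sum, map_sum, map_sum]
    trans ∑ σ ∈ T, if n ≤ d + k then
      PowerSeries.coeff (d + k - n) (genFun ht (box L w σ q)) else 0
    swap
    · split_ifs <;> simp
    refine Finset.sum_congr rfl fun σ hσ => ?_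
    rw [← hprod σ hσ, prod_mul_genFun_halfOpenCone (hT σ hσ).1 hwL hh (-q)
      ((hfin.mono hIsub).mono (hKnsub σ hσ)),
      coeff_genFun_box_neg (hT σ hσ).1 hwL hh (hqgen σ (hT σ hσ).1), (hsum σ hσ).1]

end Decomposition

section Algebra

open Polynomial

theorem coeff_geom_sum_X (k n : ℕ) :
    (∑ j ∈ Finset.range k, X ^ j : ℤ[X]).coeff n = if n < k then 1 else 0 := by
  simp [coeff_X_pow]

theorem natDegree_geom_sum_X {k : ℕ} (hk : 0 < k) :
    (∑ j ∈ Finset.range k, X ^ j : ℤ[X]).natDegree = k - 1 := by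
  refine natDegree_eq_of_le_of_coeff_ne_zero ?_ (by rw [coeff_geom_sum_X, if_pos (by omega)]; simp)
  rw [natDegree_le_iff_coeff_eq_zero]
  intro n hn
  rw [coeff_geom_sum_X, if_neg (by omega)]

theorem geom_sum_X_ne_zero {k : ℕ} (hk : 0 < k) : (∑ j ∈ Finset.range k, X ^ j : ℤ[X]) ≠ 0 := by
  intro h
  have := coeff_geom_sum_X k 0
  simp [h, hk] at this

theorem reflect_geom_sum_X {k : ℕ} (hk : 0 < k) :
    reflect (k - 1) (∑ j ∈ Finset.range k, X ^ j : ℤ[X]) = ∑ j ∈ Finset.range k, X ^ j := by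
  ext n
  rw [coeff_reflect, coeff_geom_sum_X, coeff_geom_sum_X]
  congr 1
  rw [eq_iff_iff]
  by_cases hn : n ≤ k - 1
  · rw [revAt_le hn]
    omega
  · rw [revAt_eq_self_of_lt (by omega)]

theorem _root_.SymmetricWrt.natDegree_le {p : ℤ[X]} {m : ℕ} (hp : SymmetricWrt p m) :
    p.natDegree ≤ m := natDegree_le_of_degree_le hp.1

theorem _root_.SymmetricWrt.reflect_eq_s10 {p : ℤ[X]} {m : ℕ} (hp : SymmetricWrt p m) :
    reflect m p = p := by
  ext n
  rw [coeff_reflect]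
  by_cases hn : n ≤ m
  · rw [revAt_le hn, hp.2 n hn]
  · rw [revAt_eq_self_of_lt (by omega)]

theorem reflect_add_right {p : ℤ[X]} {m : ℕ} (hp : p.natDegree ≤ m) (l : ℕ) :
    reflect (m + l) p = reflect m p * X ^ l := by
  have := reflect_mul p 1 hp (show (1 : ℤ[X]).natDegree ≤ l by simp)
  simpa using this

theorem reflect_X_pow_mul {p : ℤ[X]} {m : ℕ} (hp : p.natDegree ≤ m) (l : ℕ) :
    reflect (l + m) (X ^ l * p) = reflect m p := by
  have := reflect_mul (X ^ l) p (show (X ^ l : ℤ[X]).natDegree ≤ l by simp) hp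
  rw [this]
  have h : reflect l (X ^ l : ℤ[X]) = 1 := by
    rw [← one_mul (X ^ l : ℤ[X]), ← C_1, reflect_C_mul_X_pow]
    simp
  rw [h, one_mul]

/-- The symmetric part `a` is determined by the reversal of `p`. -/
theorem one_sub_X_mul_eq {p a b : ℤ[X]} {d s : ℕ} (hs : p.natDegree = s) (hsd : s ≤ d)
    (ha : SymmetricWrt a d) (hb : SymmetricWrt b (s - 1)) (hb0 : s = 0 → b = 0)
    (hab : (∑ j ∈ Finset.range (d + 1 - s), X ^ j) * p = a + X ^ (d + 1 - s) * b) :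
    (1 - X) * a = p - reflect (d + 1) p := by
  obtain ⟨l, hl⟩ : ∃ l, l = d + 1 - s := ⟨_, rfl⟩
  rw [← hl] at hab
  have hl0 : 0 < l := by omega
  have hbr : reflect d b = X ^ l * b := by
    rcases Nat.eq_zero_or_pos s with h | h
    · simp [hb0 h]
    · have := reflect_add_right hb.natDegree_le l
      rw [hb.reflect_eq_s10, show s - 1 + l = d by omega] at this
      rw [this, mul_comm]
  have hbd : b.natDegree ≤ d := hb.natDegree_le.trans (by omega)
  have hrefl := congrArg (reflect (d + l)) hab
  rw [reflect_add, reflect_add_right ha.natDegree_le, ha.reflect_eq_s10, add_comm d l,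
    reflect_X_pow_mul hbd, hbr, show l + d = (l - 1) + (d + 1) by omega,
    reflect_mul _ _ (natDegree_geom_sum_X hl0).le (by omega : p.natDegree ≤ d + 1),
    reflect_geom_sum_X hl0] at hrefl
  have hgeom := mul_neg_geom_sum (X : ℤ[X]) l
  refine mul_left_cancel₀ (geom_sum_X_ne_zero hl0) ?_
  linear_combination hrefl - hab + a * hgeom

theorem reciprocity_of_decomposition {p : ℤ[X]} {A I N : PowerSeries ℤ} {d k : ℕ} (hk : 0 < k)
    (hp0 : p ≠ 0) (hA : (1 - PowerSeries.X) ^ (d + 1) * A = (p : PowerSeries ℤ))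
    (hN : ∀ n, d + k ≤ n → PowerSeries.coeff n N = 0)
    (hAN : (1 - PowerSeries.X) ^ d * (1 - PowerSeries.X ^ k) * A = N)
    (hIN : ∀ n, PowerSeries.coeff n ((1 - PowerSeries.X) ^ d * (1 - PowerSeries.X ^ k) * I) =
      if n ≤ d + k then PowerSeries.coeff (d + k - n) N else 0) :
    p.natDegree ≤ d ∧
      (1 - PowerSeries.X) ^ (d + 1) * I = (reflect (d + 1) p : PowerSeries ℤ) := by
  obtain ⟨G, hG⟩ : ∃ G : ℤ[X], G = ∑ j ∈ Finset.range k, Polynomial.X ^ j := ⟨_, rfl⟩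
  have hG0 : G ≠ 0 := hG ▸ geom_sum_X_ne_zero hk
  have hgeom : (1 - PowerSeries.X) * (G : PowerSeries ℤ) = 1 - PowerSeries.X ^ k := by
    have := congrArg (fun f : ℤ[X] => (f : PowerSeries ℤ))
      (mul_neg_geom_sum (Polynomial.X : ℤ[X]) k)
    rw [← hG] at this
    simpa using this
  have hNp : N = ((G * p : ℤ[X]) : PowerSeries ℤ) := by
    rw [← hAN, Polynomial.coe_mul, ← hA, ← hgeom]
    ring
  have hdeg : (G * p).natDegree ≤ d + k - 1 := by
    rw [natDegree_le_iff_coeff_eq_zero]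
    intro n hn
    rw [← Polynomial.coeff_coe, ← hNp]
    exact hN n (by omega)
  have hGd : G.natDegree = k - 1 := hG ▸ natDegree_geom_sum_X hk
  have hpd : p.natDegree ≤ d := by
    rw [natDegree_mul hG0 hp0, hGd] at hdeg
    omega
  refine ⟨hpd, ?_⟩
  have hrefl : (1 - PowerSeries.X) ^ d * (1 - PowerSeries.X ^ k) * I =
      ((reflect (d + k) (G * p) : ℤ[X]) : PowerSeries ℤ) := by
    ext n
    rw [hIN, Polynomial.coeff_coe, coeff_reflect]
    split_ifs with hn
    · rw [revAt_le hn, hNp, Polynomial.coeff_coe]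
    · rw [revAt_eq_self_of_lt (by omega), ← Polynomial.coeff_coe, ← hNp, hN n (by omega)]
  rw [show d + k = (k - 1) + (d + 1) by omega, reflect_mul _ _ hGd.le (by omega), hG,
    reflect_geom_sum_X hk, ← hG, Polynomial.coe_mul, ← hgeom] at hrefl
  refine mul_left_cancel₀ (a := (G : PowerSeries ℤ)) ?_ ?_
  · simpa using hG0
  · rw [← hrefl]
    ring

theorem coeff_ne_zero_of_reciprocity {p : ℤ[X]} {I : PowerSeries ℤ} {d : ℕ} (hp0 : p ≠ 0)
    (hpd : p.natDegree ≤ d)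
    (hI : (1 - PowerSeries.X) ^ (d + 1) * I = (reflect (d + 1) p : PowerSeries ℤ)) :
    PowerSeries.coeff (d + 1 - p.natDegree) I ≠ 0 := by
  have hdvd : PowerSeries.X ^ (d + 1 - p.natDegree) ∣
      (1 - PowerSeries.X : PowerSeries ℤ) ^ (d + 1) * I := by
    rw [PowerSeries.X_pow_dvd_iff, hI]
    intro m hm
    rw [Polynomial.coeff_coe, coeff_reflect, revAt_le (by omega)]
    exact coeff_eq_zero_of_natDegree_lt (by omega)
  have hunit : IsUnit ((1 - PowerSeries.X : PowerSeries ℤ) ^ (d + 1)) :=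
    IsUnit.pow _ (PowerSeries.isUnit_iff_constantCoeff.2 (by simp))
  rw [hunit.dvd_mul_left] at hdvd
  obtain ⟨J, rfl⟩ := hdvd
  have := congrArg (PowerSeries.coeff (d + 1 - p.natDegree)) hI
  rw [mul_left_comm, Polynomial.coeff_coe, coeff_reflect, revAt_le (by omega),
    show d + 1 - (d + 1 - p.natDegree) = p.natDegree by omega] at this
  rw [PowerSeries.coeff_X_pow_mul'] at this ⊢
  simp only [le_refl, if_true, Nat.sub_self, PowerSeries.coeff_zero_eq_constantCoeff, map_mul,
    map_pow, map_sub, map_one, PowerSeries.constantCoeff_X, sub_zero, one_pow, one_mul] at this ⊢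
  rw [this]
  exact leadingCoeff_ne_zero.2 hp0

end Algebra

section Polytope

variable {d : ℕ} {V : Finset (Fin d → ℝ)}

/-- The height one copies of the points of `V`. -/
def lift (V : Finset (Fin d → ℝ)) (p : V) : (Fin d → ℝ) × ℝ := (p, 1)

/-- The integer points of `ℝ^d × ℝ`. -/
def integerPoints (d : ℕ) : AddSubgroup ((Fin d → ℝ) × ℝ) :=
  (((Int.castAddHom ℝ).compLeft (Fin d)).prodMap (Int.castAddHom ℝ)).range

theorem mem_integerPoints {y : (Fin d → ℝ) × ℝ} :
    y ∈ integerPoints d ↔ ∃ (x : Fin d → ℤ) (m : ℤ), ((fun i => (x i : ℝ)), (m : ℝ)) = y := by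
  simp only [integerPoints, AddMonoidHom.mem_range, Prod.exists]
  rfl

theorem top_le_span_lift (h : affineSpan ℝ (V : Set (Fin d → ℝ)) = ⊤) :
    ⊤ ≤ Submodule.span ℝ (Set.range (lift V)) := by
  have h1 : ∀ x : Fin d → ℝ,
      ((x, 1) : (Fin d → ℝ) × ℝ) ∈ Submodule.span ℝ (Set.range (lift V)) := by
    intro x
    have hx : x ∈ affineSpan ℝ (V : Set (Fin d → ℝ)) := h ▸ AffineSubspace.mem_top ℝ _ x
    refine affineSpan_induction hx (fun y hy => Submodule.subset_span ⟨⟨y, hy⟩, rfl⟩) ?_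
    intro c u v w hu hv hw
    have := Submodule.add_mem _ (Submodule.smul_mem _ c (Submodule.sub_mem _ hu hv)) hw
    simpa using this
  rintro ⟨x, t⟩ -
  have h0 := Submodule.add_mem _ (h1 x) (Submodule.smul_mem _ (t - 1) (h1 0))
  simpa using h0

theorem mem_cone_lift {x : Fin d → ℝ} {t : ℝ} (ht : 0 < t) :
    (x, t) ∈ cone (lift V) ↔ x ∈ t • convexHull ℝ (V : Set (Fin d → ℝ)) := by
  rw [Set.mem_smul_set_iff_inv_smul_mem₀ ht.ne', Finset.mem_convexHull']
  constructor
  · rintro ⟨r, hr, h⟩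
    have h1 : ∑ p, r p • (p : Fin d → ℝ) = x := by
      simpa [lift, Prod.fst_sum] using congrArg Prod.fst h
    have h2 : ∑ p, r p = t := by
      simpa [lift, Prod.snd_sum] using congrArg Prod.snd h
    classical
    refine ⟨fun y => if hy : y ∈ V then t⁻¹ * r ⟨y, hy⟩ else 0, fun y hy => ?_, ?_, ?_⟩
    · simp only [dif_pos hy]
      exact mul_nonneg (inv_nonneg.2 ht.le) (hr _)
    · rw [← Finset.sum_coe_sort]
      simp only [Finset.coe_mem, dif_pos, Subtype.coe_eta, ← Finset.mul_sum, h2]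
      exact inv_mul_cancel₀ ht.ne'
    · rw [← Finset.sum_coe_sort]
      simp only [Finset.coe_mem, dif_pos, Subtype.coe_eta, mul_smul, ← Finset.smul_sum, h1]
  · rintro ⟨r, hr, h1, h2⟩
    refine ⟨fun p => t * r p, fun p => mul_nonneg ht.le (hr p p.2), ?_⟩
    have h3 : ∑ p : V, (t * r p) • (p : Fin d → ℝ) = x := by
      simp only [mul_smul, ← Finset.smul_sum]
      rw [Finset.sum_coe_sort V fun p => r p • p, h2, smul_inv_smul₀ ht.ne']
    have h4 : ∑ p : V, t * r p = t := by
      rw [← Finset.mul_sum, Finset.sum_coe_sort V r, h1, mul_one]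
    ext1
    · simpa [lift, Prod.fst_sum] using h3
    · simpa [lift, Prod.snd_sum] using h4

theorem cone_lift_slice_zero : {y ∈ (integerPoints d ∩ cone (lift V) : Set ((Fin d → ℝ) × ℝ)) |
    LinearMap.snd ℝ _ ℝ y = ((0 : ℕ) : ℝ)} = {0} := by
  ext y
  constructor
  · rintro ⟨⟨-, r, hr, rfl⟩, h0⟩
    have h : ∑ p, r p = 0 := by simpa [lift, Prod.snd_sum] using h0
    rw [Finset.sum_eq_zero_iff_of_nonneg fun p _ => hr p] at h
    simp [fun p => h p (Finset.mem_univ p)]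
  · rintro rfl
    exact ⟨⟨(integerPoints d).zero_mem, 0, by simp, by simp⟩, by simp⟩

theorem cone_lift_slice {n : ℕ} (hn : n ≠ 0) :
    {y ∈ (integerPoints d ∩ cone (lift V) : Set ((Fin d → ℝ) × ℝ)) |
      LinearMap.snd ℝ _ ℝ y = (n : ℝ)} =
    (fun x : Fin d → ℤ => (((fun i => (x i : ℝ)), (n : ℝ)) : (Fin d → ℝ) × ℝ)) ''
      {x | (fun i => (x i : ℝ)) ∈ (n : ℝ) • convexHull ℝ (V : Set (Fin d → ℝ))} := by
  have hn0 : (0 : ℝ) < n := by positivity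
  ext y
  constructor
  · rintro ⟨⟨hyL, hyC⟩, hyn⟩
    obtain ⟨x, m, rfl⟩ := mem_integerPoints.1 hyL
    have hmn : (m : ℝ) = n := hyn
    rw [hmn] at hyC ⊢
    exact ⟨x, (mem_cone_lift hn0).1 hyC, rfl⟩
  · rintro ⟨x, hx, rfl⟩
    exact ⟨⟨mem_integerPoints.2 ⟨x, n, by simp⟩, (mem_cone_lift hn0).2 hx⟩, rfl⟩

theorem finite_integer_points_smul_convexHull (t : ℝ) :
    {x : Fin d → ℤ | (fun i => (x i : ℝ)) ∈ t • convexHull ℝ (V : Set (Fin d → ℝ))}.Finite := by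
  have hb : Bornology.IsBounded (t • convexHull ℝ (V : Set (Fin d → ℝ))) :=
    ((isBounded_convexHull.2 V.finite_toSet.isBounded).smul₀ t)
  obtain ⟨R, hR⟩ := hb.exists_norm_le
  refine (Set.finite_Icc (fun _ : Fin d => -⌈R⌉) (fun _ => ⌈R⌉)).subset fun x hx => ?_
  have h : ∀ i, |(x i : ℝ)| ≤ R := fun i => (norm_le_pi_norm _ i).trans (hR _ hx)
  constructor <;> intro i
  · have h1 := (abs_le.1 (h i)).1
    have h2 := Int.le_ceil R
    have : -(⌈R⌉ : ℝ) ≤ x i := by linarith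
    exact_mod_cast this
  · have h1 := (abs_le.1 (h i)).2
    have h2 := Int.le_ceil R
    have : (x i : ℝ) ≤ ⌈R⌉ := by linarith
    exact_mod_cast this

theorem sliceFinite_cone_lift : SliceFinite (LinearMap.snd ℝ _ ℝ)
    (integerPoints d ∩ cone (lift V) : Set ((Fin d → ℝ) × ℝ)) := by
  intro n
  rcases eq_or_ne n 0 with rfl | hn
  · rw [cone_lift_slice_zero]
    exact Set.finite_singleton 0
  · rw [cone_lift_slice hn]
    exact (finite_integer_points_smul_convexHull _).image _

theorem genFun_cone_lift :
    genFun (LinearMap.snd ℝ _ ℝ) (integerPoints d ∩ cone (lift V) : Set ((Fin d → ℝ) × ℝ)) =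
      PowerSeries.mk (fun n => if n = 0 then 1 else
        (Set.ncard {x : Fin d → ℤ |
          (fun i => (x i : ℝ)) ∈ (n : ℝ) • convexHull ℝ (V : Set (Fin d → ℝ))} : ℤ)) := by
  ext n
  simp only [genFun, PowerSeries.coeff_mk]
  split_ifs with hn
  · rw [hn, cone_lift_slice_zero]
    simp
  · rw [cone_lift_slice hn, Set.ncard_image_of_injective]
    intro x y hxy
    funext i
    simpa using congrFun (congrArg Prod.fst hxy) i

end Polytope

end StapledonDecomposition

open StapledonDecomposition

/-- **Theorem (Stapledon).** Let `P` be a lattice polytope of dimension `d` with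
`h*`-polynomial `h*` of degree `s` and `l = d+1-s`. In the unique decomposition
`(1 + z + ⋯ + z^{l-1})·h*(z) = a(z) + z^l·b(z)` with `a` symmetric with respect to
degree `d` and `b` symmetric with respect to degree `s-1`, both `a` and `b` have
nonnegative coefficients. -/
theorem stapledon_nonneg (d : ℕ) (V : Finset (Fin d → ℝ))
    (hV : ∀ v ∈ V, ∀ i, ∃ k : ℤ, v i = (k : ℝ))
    (P : Set (Fin d → ℝ)) (hP : P = convexHull ℝ (V : Set (Fin d → ℝ)))
    (hspan : affineSpan ℝ P = ⊤)
    (hstar : Polynomial ℤ)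
    (hhstar : (1 - PowerSeries.X) ^ (d + 1) *
        PowerSeries.mk (fun n =>
          if n = 0 then 1 else
            (Set.ncard {x : Fin d → ℤ |
              (fun i => (x i : ℝ)) ∈ (n : ℝ) • P} : ℤ)) =
      (hstar : PowerSeries ℤ))
    (s : ℕ) (hs : s = hstar.natDegree)
    (a b : Polynomial ℤ)
    (ha : SymmetricWrt a d) (hb : SymmetricWrt b (s - 1)) (hb0 : s = 0 → b = 0)
    (hab : (∑ j ∈ Finset.range (d + 1 - s), Polynomial.X ^ j) * hstar =
        a + Polynomial.X ^ (d + 1 - s) * b) :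
    (∀ i, 0 ≤ a.coeff i) ∧ (∀ i, 0 ≤ b.coeff i) := by
  subst hP
  rw [affineSpan_convexHull] at hspan
  rw [← genFun_cone_lift] at hhstar
  have hd : Module.finrank ℝ ((Fin d → ℝ) × ℝ) = d + 1 := by simp
  have hspan' := top_le_span_lift hspan
  have hL : ∀ p, lift V p ∈ integerPoints d := by
    intro p
    choose x hx using hV p p.2
    exact mem_integerPoints.2 ⟨x, 1, by ext1 <;> simp [lift, ← hx]⟩
  have hstar0 : hstar ≠ 0 := by
    rintro rfl
    have := congrArg PowerSeries.constantCoeff hhstar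
    rw [genFun_cone_lift, map_mul,
      ← PowerSeries.coeff_zero_eq_constantCoeff_apply (PowerSeries.mk _), PowerSeries.coeff_mk] at this
    simp at this
  have key := fun (x : (Fin d → ℝ) × ℝ) hxL hx (k : ℕ) hxk =>
    exists_boundary_decomposition (ht := LinearMap.snd ℝ (Fin d → ℝ) ℝ) hd hspan' hL (fun _ => rfl)
      sliceFinite_cone_lift (x := x) hxL hx (k := k) hxk
  obtain ⟨hk, N₀, N₁, -, -, hdeg, hC, -, hI⟩ := key (∑ p, lift V p)
    ((integerPoints d).sum_mem fun p _ => hL p) ⟨fun _ => 1, by simp, by simp⟩ V.card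
    (by simp [lift])
  obtain ⟨hsd, hrec⟩ := reciprocity_of_decomposition hk hstar0 hhstar hdeg hC hI
  have hne := coeff_ne_zero_of_reciprocity hstar0 hsd hrec
  rw [← hs] at hne hsd
  obtain ⟨x, ⟨hxL, hx⟩, hxh⟩ : {y ∈ (integerPoints d ∩ openCone (lift V) : Set _) |
      LinearMap.snd ℝ (Fin d → ℝ) ℝ y = ((d + 1 - s : ℕ) : ℝ)}.Nonempty := by
    by_contra h
    rw [Set.not_nonempty_iff_eq_empty] at h
    rw [genFun, PowerSeries.coeff_mk, h] at hne
    simp at hne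
  obtain ⟨hl, M₀, M₁, hM₀, hM₁, -, hC, hB, -⟩ := key x hxL hx _ hxh
  have haeq : (a : PowerSeries ℤ) = M₀ := by
    have h1 := congrArg (fun f : Polynomial ℤ => (f : PowerSeries ℤ))
      (one_sub_X_mul_eq hs.symm hsd ha hb hb0 hab)
    simp only [Polynomial.coe_mul, Polynomial.coe_sub, Polynomial.coe_one, Polynomial.coe_X,
      ← hrec, ← hhstar] at h1
    have hX : (1 - PowerSeries.X : PowerSeries ℤ) ≠ 0 := by
      intro h
      simpa using congrArg PowerSeries.constantCoeff h
    refine mul_left_cancel₀ hX ?_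
    rw [h1, ← hB]
    ring
  have hsum : (a : PowerSeries ℤ) + PowerSeries.X ^ (d + 1 - s) * (b : PowerSeries ℤ) =
      M₀ + M₁ := by
    have h1 := congrArg (fun f : Polynomial ℤ => (f : PowerSeries ℤ)) hab
    have h2 := congrArg (fun f : Polynomial ℤ => (f : PowerSeries ℤ))
      (mul_neg_geom_sum (Polynomial.X : Polynomial ℤ) (d + 1 - s))
    simp only [Polynomial.coe_mul, Polynomial.coe_sub, Polynomial.coe_one, Polynomial.coe_X,
      Polynomial.coe_add, Polynomial.coe_pow, ← hhstar] at h1 h2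
    rw [← hC, ← h1, ← h2]
    ring
  have hbeq : PowerSeries.X ^ (d + 1 - s) * (b : PowerSeries ℤ) = M₁ := by
    rw [haeq] at hsum
    exact add_left_cancel hsum
  constructor
  · intro i
    rw [← Polynomial.coeff_coe, haeq]
    exact hM₀ i
  · intro i
    have := hM₁ (i + (d + 1 - s))
    rwa [← hbeq, PowerSeries.coeff_X_pow_mul, Polynomial.coeff_coe] at this
end

section
/- Let d ≥ 1 and let r be a partial order on {1,…,d} with order polytope O_r ⊆ ℝ^d. For every n ≥ 1: (i) the number of lattice points in n·O_r equals Ω_r(n+1), the number of weak order-preserving maps from ({1,…,d}, r) to {1,…,n+1}; and (ii) the number of lattice points in the topological interior of n·O_r equals Ω°_r(n−1), the number of strict order-preserving maps from ({1,…,d}, r) to {1,…,n−1}. -/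
open scoped Pointwise

/-- The dilate by `c > 0` of the order polytope of a relation, in terms of inequalities. -/
lemma mem_smul_orderPolytope {ι : Type*} (r : ι → ι → Prop) {c : ℝ} (hc : 0 < c) (x : ι → ℝ) :
    x ∈ c • {x : ι → ℝ | (∀ i, 0 ≤ x i ∧ x i ≤ 1) ∧ ∀ i j, r i j → x i ≤ x j} ↔
      (∀ i, 0 ≤ x i ∧ x i ≤ c) ∧ ∀ i j, r i j → x i ≤ x j := by
  simp only [Set.mem_smul_set_iff_inv_smul_mem₀ hc.ne', Set.mem_ofPred_eq, Pi.smul_apply,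
    smul_eq_mul, inv_mul_le_iff₀ hc, mul_inv_cancel_left₀ hc.ne', mul_one,
    mul_nonneg_iff_of_pos_left (inv_pos.mpr hc)]

/-- From an interior point one can move a positive distance in any direction. -/
lemma exists_pos_add_smul_mem_of_mem_interior {E : Type*} [AddCommGroup E] [Module ℝ E]
    [TopologicalSpace E] [ContinuousAdd E] [ContinuousSMul ℝ E] {S : Set E} {x : E}
    (hx : x ∈ interior S) (v : E) : ∃ ε : ℝ, 0 < ε ∧ x + ε • v ∈ S := by
  have hcont : Continuous fun t : ℝ => x + t • v := by fun_prop
  have hmem : {t : ℝ | x + t • v ∈ S} ∈ nhds 0 :=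
    hcont.continuousAt.preimage_mem_nhds (by simpa using mem_interior_iff_mem_nhds.mp hx)
  obtain ⟨δ, hδ, hball⟩ := Metric.mem_nhds_iff.mp hmem
  refine ⟨δ / 2, half_pos hδ, hball ?_⟩
  rw [Metric.mem_ball, Real.dist_0_eq_abs, abs_of_pos (half_pos hδ)]
  exact half_lt_self hδ

/-- The interior of a dilated order polytope is cut out by the strict inequalities. -/
lemma mem_interior_smul_orderPolytope {ι : Type*} [Finite ι] (r : ι → ι → Prop) {c : ℝ}
    (hc : 0 < c) (x : ι → ℝ) :
    x ∈ interior (c • {x : ι → ℝ | (∀ i, 0 ≤ x i ∧ x i ≤ 1) ∧ ∀ i j, r i j → x i ≤ x j}) ↔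
      (∀ i, 0 < x i ∧ x i < c) ∧ ∀ i j, r i j → i ≠ j → x i < x j := by
  classical
  constructor
  · intro hx
    have move (v : ι → ℝ) := exists_pos_add_smul_mem_of_mem_interior hx v
    simp only [mem_smul_orderPolytope r hc] at move
    refine ⟨fun i => ⟨?_, ?_⟩, fun i j hij hne => ?_⟩
    · obtain ⟨ε, hε, h, -⟩ := move (-Pi.single i 1)
      have := (h i).1
      simp at this
      linarith
    · obtain ⟨ε, hε, h, -⟩ := move (Pi.single i 1)
      have := (h i).2
      simp at this
      linarith
    · obtain ⟨ε, hε, -, h⟩ := move (Pi.single i 1)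
      have := h i j hij
      simp [hne.symm] at this
      linarith
  · intro hx
    have hopen : IsOpen {x : ι → ℝ |
        (∀ i, 0 < x i ∧ x i < c) ∧ ∀ i j, r i j → i ≠ j → x i < x j} := by
      simp only [Set.ofPred_and, Set.ofPred_forall]
      refine .inter (isOpen_iInter_of_finite fun i => .inter ?_ ?_)
        (isOpen_iInter_of_finite fun i => isOpen_iInter_of_finite fun j =>
          isOpen_iInter_of_finite fun _ => isOpen_iInter_of_finite fun _ => ?_)
      all_goals exact isOpen_lt (by fun_prop) (by fun_prop)
    refine interior_maximal (fun y hy => ?_) hopen hx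
    refine (mem_smul_orderPolytope r hc y).mpr
      ⟨fun i => ⟨(hy.1 i).1.le, (hy.1 i).2.le⟩, fun i j hij => ?_⟩
    obtain rfl | hne := eq_or_ne i j
    · exact le_rfl
    · exact (hy.2 i j hij hne).le

/-- Integer points of a cube of side `m` based at `a` correspond to maps into `Fin m`. -/
lemma ncard_int_cube_eq_card_fin {ι : Type*} (a : ℤ) (m : ℕ) (Q : (ι → ℤ) → Prop) :
    {x : ι → ℤ | (∀ i, a ≤ x i ∧ x i < a + m) ∧ Q x}.ncard =
      Nat.card {φ : ι → Fin m // Q fun i => a + (φ i : ℕ)} := by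
  have hinj : Function.Injective fun (φ : ι → Fin m) (i : ι) => a + ((φ i : ℕ) : ℤ) := by
    intro φ ψ h
    funext i
    have := congrFun h i
    simp only at this
    omega
  rw [← Set.coe_ofPred, Nat.card_coe_set_eq, ← Set.ncard_image_of_injective _ hinj]
  congr 1
  ext x
  constructor
  · rintro ⟨hx, hQ⟩
    have hxφ : (fun i => a + (((x i - a).toNat : ℕ) : ℤ)) = x := by
      funext i
      have := hx i
      omega
    refine ⟨fun i => ⟨(x i - a).toNat, by have := hx i; omega⟩, ?_, hxφ⟩
    simpa only [Set.mem_ofPred_eq, hxφ] using hQ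
  · rintro ⟨φ, hφ, rfl⟩
    exact ⟨fun i => by have := (φ i).isLt; simp only; omega, hφ⟩

/-- **Theorem (Stanley).** For the order polytope `O_r ⊆ ℝ^d` of a partial order `r` on
`{1,…,d}` and every `n ≥ 1`: (i) the number of lattice points of `n·O_r` equals
`Ω_r(n+1)`, the number of weak order-preserving maps from `({1,…,d}, r)` to `{1,…,n+1}`;
and (ii) the number of lattice points in the interior of `n·O_r` equals `Ω°_r(n-1)`,
the number of strict order-preserving maps from `({1,…,d}, r)` to `{1,…,n-1}`. -/
theorem order_polytope_lattice_points (d : ℕ) (hd : 1 ≤ d)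
    (r : Fin d → Fin d → Prop) (hr : IsPartialOrder (Fin d) r)
    (O : Set (Fin d → ℝ))
    (hO : O = {x : Fin d → ℝ |
      (∀ i, 0 ≤ x i ∧ x i ≤ 1) ∧ ∀ i j, r i j → x i ≤ x j}) :
    ∀ n : ℕ, 1 ≤ n →
      (Set.ncard {x : Fin d → ℤ | (fun i => (x i : ℝ)) ∈ (n : ℝ) • O} =
        Nat.card {φ : Fin d → Fin (n + 1) // ∀ i j, r i j → φ i ≤ φ j}) ∧
      (Set.ncard {x : Fin d → ℤ | (fun i => (x i : ℝ)) ∈ interior ((n : ℝ) • O)} =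
        Nat.card {φ : Fin d → Fin (n - 1) // ∀ i j, r i j → i ≠ j → φ i < φ j}) := by
  intro n hn
  have hc : (0 : ℝ) < n := by exact_mod_cast hn
  subst hO
  constructor
  · convert ncard_int_cube_eq_card_fin (ι := Fin d) 0 (n + 1)
      (fun x => ∀ i j, r i j → x i ≤ x j) using 2
    · ext x
      simp only [Set.mem_ofPred_eq, mem_smul_orderPolytope r hc]
      norm_cast
      simp only [zero_add, Nat.cast_add, Nat.cast_one, Int.lt_add_one_iff]
    · simp
  · convert ncard_int_cube_eq_card_fin (ι := Fin d) 1 (n - 1)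
      (fun x => ∀ i j, r i j → i ≠ j → x i < x j) using 2
    · ext x
      simp only [Set.mem_ofPred_eq, mem_interior_smul_orderPolytope r hc]
      norm_cast
      simp only [Nat.add_sub_cancel' hn]
      rfl
    · simp
end

section
/- Let d ≥ 1 and let r be a partial order on {1,…,d}. Then there exist polynomials ω, ω° ∈ ℚ[t] such that ω(n) = Ω_r(n) and ω°(n) = Ω°_r(n) for every natural number n, and ω°(t) = (−1)^d · ω(−t). -/
open Finset in
/-- The maps `φ : α → ℕ` with support `S` and values at most `n` such that, on `S`,
`r i j` implies `φ i ≤ φ j` and `s i j` implies `φ i < φ j`. -/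
noncomputable def orderMaps {α : Type*} [Fintype α] [DecidableEq α] (r s : α → α → Prop)
    (S : Finset α) (n : ℕ) : Finset (α → ℕ) :=
  open Classical in
  {φ ∈ Fintype.piFinset fun _ => range (n + 1) | (∀ i, φ i ≠ 0 ↔ i ∈ S) ∧
    (∀ i ∈ S, ∀ j ∈ S, r i j → φ i ≤ φ j) ∧ ∀ i ∈ S, ∀ j ∈ S, s i j → φ i < φ j}

open Finset in
/-- The subsets of `S` which can occur as `{i ∈ S | 1 < φ i}` for `φ` in `orderMaps r s S n`. -/
noncomputable def upperParts {α : Type*} [DecidableEq α] (r s : α → α → Prop)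
    (S : Finset α) : Finset (Finset α) :=
  open Classical in
  {U ∈ S.powerset | (∀ i ∈ U, ∀ j ∈ S, r i j → j ∈ U) ∧ ∀ i ∈ S, ∀ j ∈ S, s i j → j ∈ U}

section

variable {α : Type*} [DecidableEq α] {r s : α → α → Prop} {S U : Finset α}

theorem mem_upperParts : U ∈ upperParts r s S ↔
    U ⊆ S ∧ (∀ i ∈ U, ∀ j ∈ S, r i j → j ∈ U) ∧ ∀ i ∈ S, ∀ j ∈ S, s i j → j ∈ U := by
  simp [upperParts]

theorem self_mem_upperParts : S ∈ upperParts r s S := by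
  simp +contextual [mem_upperParts]

variable [Fintype α]

theorem mem_orderMaps {n : ℕ} {φ : α → ℕ} : φ ∈ orderMaps r s S n ↔
    (∀ i, φ i ≤ n) ∧ (∀ i, φ i ≠ 0 ↔ i ∈ S) ∧
    (∀ i ∈ S, ∀ j ∈ S, r i j → φ i ≤ φ j) ∧ ∀ i ∈ S, ∀ j ∈ S, s i j → φ i < φ j := by
  simp [orderMaps]

theorem card_orderMaps_zero (r s : α → α → Prop) (S : Finset α) :
    (orderMaps r s S 0).card = if S = ∅ then 1 else 0 := by
  split_ifs with h
  · rw [Finset.card_eq_one]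
    refine ⟨0, ?_⟩
    ext φ
    simp only [mem_orderMaps, h, Finset.mem_singleton]
    constructor
    · rintro ⟨h1, -⟩
      ext i
      simpa using h1 i
    · rintro rfl
      simp
  · rw [Finset.card_eq_zero, Finset.eq_empty_iff_forall_notMem]
    intro φ hφ
    obtain ⟨h1, h2, -⟩ := mem_orderMaps.1 hφ
    obtain ⟨i, hi⟩ := Finset.nonempty_iff_ne_empty.2 h
    exact (h2 i).2 hi (Nat.le_zero.1 (h1 i))

theorem card_orderMaps_succ (r s : α → α → Prop) (S : Finset α) (n : ℕ) :
    (orderMaps r s S (n + 1)).card = ∑ U ∈ upperParts r s S, (orderMaps r s U n).card := by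
  rw [← Finset.card_sigma]
  refine Finset.card_bij' (fun φ _ => ⟨({i | 1 < φ i} : Finset α), fun i => φ i - 1⟩)
    (fun x _ i => x.2 i + if i ∈ S then 1 else 0) ?_ ?_ ?_ ?_
  · intro φ hφ
    obtain ⟨h1, h2, h3, h4⟩ := mem_orderMaps.1 hφ
    have hS : ∀ i, 1 < φ i → i ∈ S := fun i hi => (h2 i).1 (by omega)
    simp only [Finset.mem_sigma, mem_upperParts, mem_orderMaps, Finset.mem_filter_univ]
    refine ⟨⟨fun i hi => hS i (by simpa using hi), fun i hi j hj hr => ?_,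
      fun i hi j hj hs => ?_⟩, fun i => ?_, fun i => ?_, fun i hi j hj hr => ?_,
      fun i hi j hj hs => ?_⟩
    · have := h3 i (hS i hi) j hj hr
      omega
    · have := h4 i hi j hj hs
      have := (h2 i).2 hi
      omega
    · have := h1 i
      omega
    · omega
    · have := h3 i (hS i hi) j (hS j hj) hr
      omega
    · have := h4 i (hS i hi) j (hS j hj) hs
      omega
  · rintro ⟨U, ψ⟩ hx
    simp only [Finset.mem_sigma, mem_upperParts, mem_orderMaps] at hx
    obtain ⟨⟨hU, hr, hs⟩, h1, h2, h3, h4⟩ := hx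
    refine mem_orderMaps.2 ⟨fun i => ?_, fun i => ?_, fun i hi j hj hrij => ?_,
      fun i hi j hj hsij => ?_⟩
    · have := h1 i
      dsimp only
      split_ifs <;> omega
    · have := h2 i
      have := @hU i
      by_cases hi : i ∈ S <;> simp_all
    · simp only [hi, hj, if_true, add_le_add_iff_right]
      by_cases hiU : i ∈ U
      · exact h3 i hiU j (hr i hiU j hj hrij) hrij
      · have := (h2 i).not.2 hiU
        omega
    · simp only [hi, hj, if_true, add_lt_add_iff_right]
      have hjU := hs i hi j hj hsij
      by_cases hiU : i ∈ U
      · exact h4 i hiU j hjU hsij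
      · have := (h2 i).not.2 hiU
        have := (h2 j).2 hjU
        omega
  · intro φ hφ
    obtain ⟨-, h2, -⟩ := mem_orderMaps.1 hφ
    ext i
    have := h2 i
    dsimp only
    split_ifs with hi
    · have := this.2 hi
      omega
    · have := this.not.2 hi
      omega
  · rintro ⟨U, ψ⟩ hx
    simp only [Finset.mem_sigma, mem_upperParts, mem_orderMaps] at hx
    obtain ⟨⟨hU, -⟩, -, h2, -⟩ := hx
    have h0 : ∀ i ∉ S, ψ i = 0 := fun i hi => by
      by_contra h
      exact hi (hU ((h2 i).1 h))
    have key : ∀ i, ψ i + (if i ∈ S then 1 else 0) - 1 = ψ i := fun i => by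
      split_ifs with hi
      · omega
      · simp [h0 i hi]
    have hset : ({i | 1 < ψ i + if i ∈ S then 1 else 0} : Finset α) = U := by
      ext i
      rw [Finset.mem_filter_univ, ← h2]
      split_ifs with hi
      · omega
      · simp [h0 i hi]
    simp only [key, hset]

end

theorem Polynomial.exists_eval_eq_sum_range (q : Polynomial ℚ) :
    ∃ p : Polynomial ℚ, ∀ n : ℕ, p.eval (n : ℚ) = ∑ k ∈ Finset.range n, q.eval (k : ℚ) := by
  induction q using Polynomial.induction_on' with
  | add a b ha hb =>
    obtain ⟨p, hp⟩ := ha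
    obtain ⟨p', hp'⟩ := hb
    exact ⟨p + p', fun n => by simp [hp, hp', Finset.sum_add_distrib]⟩
  | monomial m c =>
    refine ⟨∑ i ∈ Finset.range (m + 1),
      Polynomial.C (c * (_root_.bernoulli i * ((m + 1).choose i : ℚ) / ((m : ℚ) + 1))) *
        Polynomial.X ^ (m + 1 - i), fun n => ?_⟩
    simp only [Polynomial.eval_monomial, ← Finset.mul_sum, sum_range_pow,
      Polynomial.eval_finsetSum, Polynomial.eval_mul, Polynomial.eval_C, Polynomial.eval_pow,
      Polynomial.eval_X]
    rw [Finset.mul_sum]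
    exact Finset.sum_congr rfl fun i _ => by ring

theorem exists_polynomial_card_orderMaps {α : Type*} [Fintype α] [DecidableEq α]
    (r s : α → α → Prop) (S : Finset α) :
    ∃ p : Polynomial ℚ, ∀ n : ℕ, p.eval (n : ℚ) = (orderMaps r s S n).card := by
  induction S using Finset.strongInduction with
  | H S ih =>
    choose! p hp using ih
    obtain ⟨q, hq⟩ := Polynomial.exists_eval_eq_sum_range
      (∑ U ∈ (upperParts r s S).erase S, p U)
    refine ⟨q + Polynomial.C ((orderMaps r s S 0).card : ℚ), fun n => ?_⟩
    rw [Polynomial.eval_add, Polynomial.eval_C, hq]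
    induction n with
    | zero => simp
    | succ n ihn =>
      rw [Finset.sum_range_succ, add_right_comm, ihn, card_orderMaps_succ,
        ← Finset.add_sum_erase _ _ self_mem_upperParts, Polynomial.eval_finsetSum]
      push_cast
      congr 1
      refine Finset.sum_congr rfl fun U hU => hp U ?_ n
      obtain ⟨hne, hU⟩ := Finset.mem_erase.1 hU
      exact (mem_upperParts.1 hU).1.ssubset_of_ne hne

/-- Möbius inversion for up-sets: sets containing all non-minimal elements of `S` carry the
nonzero values of the Möbius function. -/
theorem sum_upperParts_neg_one_pow_card {α : Type*} [Fintype α] [DecidableEq α]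
    (r : α → α → Prop) (hr : IsPartialOrder α r) (g : Finset α → ℚ) (S : Finset α) :
    ∑ V ∈ upperParts (fun _ _ => False) (fun i j => r i j ∧ i ≠ j) S,
      (-1 : ℚ) ^ V.card * ∑ U ∈ upperParts r (fun _ _ => False) V, g U =
    (-1) ^ S.card * g S := by
  classical
  have hwf : WellFounded fun i j => r i j ∧ i ≠ j := by
    have : IsTrans α fun i j => r i j ∧ i ≠ j :=
      ⟨fun a b c hab hbc => ⟨hr.trans _ _ _ hab.1 hbc.1, by
        rintro rfl
        exact hab.2 (hr.antisymm _ _ hab.1 hbc.1)⟩⟩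
    have : Std.Irrefl fun i j : α => r i j ∧ i ≠ j := ⟨fun a h => h.2 rfl⟩
    exact Finite.wellFounded_of_trans_of_irrefl _
  simp_rw [Finset.mul_sum]
  rw [Finset.sum_comm' (t' := upperParts r (fun _ _ => False) S)
    (s' := fun U => {V ∈ upperParts (fun _ _ => False) (fun i j => r i j ∧ i ≠ j) S | U ⊆ V})]
  · rw [Finset.sum_eq_single_of_mem S self_mem_upperParts]
    · rw [Finset.sum_eq_single_of_mem S]
      · simp [self_mem_upperParts]
      · intro V hV hne
        obtain ⟨hV, hSV⟩ := Finset.mem_filter.1 hV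
        exact absurd ((mem_upperParts.1 hV).1.antisymm hSV) hne
    · intro U hU hne
      obtain ⟨hUS, hup, -⟩ := mem_upperParts.1 hU
      obtain ⟨a, ha, hmin⟩ := hwf.has_min {i | i ∈ S ∧ i ∉ U} (by
        obtain ⟨i, hi⟩ := Finset.exists_of_ssubset (hUS.ssubset_of_ne hne)
        exact ⟨i, hi⟩)
      have hminS : ∀ i ∈ S, ¬ (r i a ∧ i ≠ a) := fun i hi h =>
        hmin i ⟨hi, fun hiU => ha.2 (hup i hiU a ha.1 h.1)⟩ h
      refine Finset.sum_involution
        (fun V _ => if a ∈ V then V.erase a else insert a V) ?_ ?_ ?_ ?_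
      · intro V _
        split_ifs with h
        · rw [← Finset.card_erase_add_one h]
          ring
        · rw [Finset.card_insert_of_notMem h]
          ring
      · intro V _ _ heq
        split_ifs at heq with h
        · exact Finset.erase_ne_self.2 h heq
        · exact Finset.insert_ne_self.2 h heq
      · intro V hV
        simp only [Finset.mem_filter, mem_upperParts] at hV ⊢
        obtain ⟨⟨hVS, -, hs⟩, hUV⟩ := hV
        split_ifs with h
        · refine ⟨⟨(Finset.erase_subset _ _).trans hVS, by simp, fun i hi j hj hij => ?_⟩,
            Finset.subset_erase.2 ⟨hUV, ha.2⟩⟩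
          refine Finset.mem_erase.2 ⟨?_, hs i hi j hj hij⟩
          rintro rfl
          exact hminS i hi hij
        · exact ⟨⟨Finset.insert_subset ha.1 hVS, by simp, fun i hi j hj hij =>
            Finset.mem_insert_of_mem (hs i hi j hj hij)⟩,
            hUV.trans (Finset.subset_insert _ _)⟩
      · intro V _
        by_cases h : a ∈ V <;> simp [h]
  · intro V U
    simp only [Finset.mem_filter, mem_upperParts]
    constructor
    · rintro ⟨⟨hVS, -, hs⟩, hUV, hup, -⟩
      refine ⟨⟨⟨hVS, by simp, hs⟩, hUV⟩, hUV.trans hVS, fun i hi j hj hij => ?_, by simp⟩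
      by_cases hne : i = j
      · exact hne ▸ hi
      · exact hup i hi j (hs i (hVS (hUV hi)) j hj ⟨hij, hne⟩) hij
    · rintro ⟨⟨⟨hVS, -, hs⟩, hUV⟩, -, hup, -⟩
      exact ⟨⟨hVS, by simp, hs⟩, hUV, fun i hi j hj => hup i hi j (hVS hj), by simp⟩

theorem eval_neg_eq_card_strict_orderMaps {α : Type*} [Fintype α] [DecidableEq α]
    (r : α → α → Prop) (hr : IsPartialOrder α r) (p : Finset α → Polynomial ℚ)
    (hp : ∀ S, ∀ n : ℕ, (p S).eval (n : ℚ) = (orderMaps r (fun _ _ => False) S n).card)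
    (n : ℕ) (S : Finset α) :
    (-1) ^ S.card * (p S).eval (-n : ℚ) =
      (orderMaps (fun _ _ => False) (fun i j => r i j ∧ i ≠ j) S n).card := by
  have hrec : ∀ S, (p S).comp (Polynomial.X + 1) =
      ∑ U ∈ upperParts r (fun _ _ => False) S, p U := fun S => by
    refine Polynomial.eq_of_infinite_eval_eq _ _
      ((Set.infinite_range_of_injective (Nat.cast_injective (R := ℚ))).mono ?_)
    rintro _ ⟨m, rfl⟩
    have := hp S (m + 1)
    rw [card_orderMaps_succ] at this
    simpa [Polynomial.eval_finsetSum, hp] using this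
  induction n generalizing S with
  | zero =>
    have := hp S 0
    rw [card_orderMaps_zero] at this ⊢
    simp only [Nat.cast_zero, neg_zero] at this ⊢
    rw [this]
    split_ifs with h <;> simp [h]
  | succ n ih =>
    rw [card_orderMaps_succ]
    push_cast
    rw [← sum_upperParts_neg_one_pow_card r hr fun S => (p S).eval (-(n + 1) : ℚ)]
    refine Finset.sum_congr rfl fun V _ => ?_
    rw [← ih V, ← Polynomial.eval_finsetSum, ← hrec V]
    simp

theorem card_orderMaps_univ {α : Type*} [Fintype α] [DecidableEq α] (r s : α → α → Prop)
    (n : ℕ) : (orderMaps r s Finset.univ n).card =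
      Nat.card {φ : α → Fin n // (∀ i j, r i j → φ i ≤ φ j) ∧ ∀ i j, s i j → φ i < φ j} := by
  rw [← Nat.card_eq_finsetCard]
  refine Nat.card_congr
    { toFun := fun φ => ⟨fun i => ⟨φ.1 i - 1, ?_⟩, fun i j hij => ?_, fun i j hij => ?_⟩
      invFun := fun ψ => ⟨fun i => ψ.1 i + 1, ?_⟩
      left_inv := fun φ => ?_
      right_inv := fun ψ => ?_ }
  · obtain ⟨h1, h2, -⟩ := mem_orderMaps.1 φ.2
    have := h1 i
    have := (h2 i).2 (Finset.mem_univ i)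
    omega
  · exact Nat.sub_le_sub_right ((mem_orderMaps.1 φ.2).2.2.1 i (by simp) j (by simp) hij) 1
  · obtain ⟨-, h2, -, h4⟩ := mem_orderMaps.1 φ.2
    have := h4 i (by simp) j (by simp) hij
    have := (h2 i).2 (Finset.mem_univ i)
    simp only [Fin.mk_lt_mk]
    omega
  · refine mem_orderMaps.2 ⟨fun i => (ψ.1 i).2, by simp, fun i _ j _ hij => ?_,
      fun i _ j _ hij => ?_⟩
    · exact Nat.succ_le_succ (ψ.2.1 i j hij)
    · exact Nat.succ_lt_succ (ψ.2.2 i j hij)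
  · ext i
    have := ((mem_orderMaps.1 φ.2).2.1 i).2 (Finset.mem_univ i)
    exact Nat.sub_add_cancel (Nat.one_le_iff_ne_zero.2 this)
  · ext i
    simp

/-- **Theorem (Stanley, order polynomial reciprocity).** For a partial order `r` on
`{1,…,d}`, the counting functions `Ω_r` (weak order-preserving maps into `{1,…,n}`) and
`Ω°_r` (strict order-preserving maps into `{1,…,n}`) are polynomials in `n`, related by
`Ω°_r(t) = (-1)^d · Ω_r(-t)`. -/
theorem order_polynomial_reciprocity (d : ℕ) (hd : 1 ≤ d)
    (r : Fin d → Fin d → Prop) (hr : IsPartialOrder (Fin d) r) :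
    ∃ ω ωs : Polynomial ℚ,
      (∀ n : ℕ, ω.eval (n : ℚ) =
        (Nat.card {φ : Fin d → Fin n // ∀ i j, r i j → φ i ≤ φ j} : ℚ)) ∧
      (∀ n : ℕ, ωs.eval (n : ℚ) =
        (Nat.card {φ : Fin d → Fin n // ∀ i j, r i j → i ≠ j → φ i < φ j} : ℚ)) ∧
      ωs = (-1 : Polynomial ℚ) ^ d * ω.comp (-Polynomial.X) := by
  choose p hp using exists_polynomial_card_orderMaps r fun _ _ => False
  refine ⟨p Finset.univ, _, fun n => ?_, fun n => ?_, rfl⟩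
  · rw [hp, card_orderMaps_univ]
    simp
  · have := eval_neg_eq_card_strict_orderMaps r hr p hp n Finset.univ
    rw [card_orderMaps_univ] at this
    simpa using this
end

section
/- Let G be a finite simple graph on the vertex set {1,…,d}. Then for every n ∈ ℕ, the number of proper colorings χ_G(n) equals the sum, over all acyclic orientations ρ of G, of the number of maps φ : {1,…,d} → {1,…,n} such that φ(u) < φ(v) whenever there is a nonempty directed path from u to v in the orientation ρ. -/
open scoped Classical

/-- The orientation of `G` induced by a map `φ` to a linear order: each edge points towards the
endpoint with the larger value. -/
noncomputable def inducedOrientation {V α : Type*} [LT α] (G : SimpleGraph V) (φ : V → α) :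
    V → V → Bool :=
  fun u v => decide (G.Adj u v ∧ φ u < φ v)

@[simp]
theorem inducedOrientation_eq_true_iff {V α : Type*} [LT α] {G : SimpleGraph V} {φ : V → α}
    {u v : V} : inducedOrientation G φ u v = true ↔ G.Adj u v ∧ φ u < φ v := by
  simp [inducedOrientation]

theorem lt_of_transGen {V α : Type*} [Preorder α] {r : V → V → Prop} {φ : V → α}
    (h : ∀ u v, r u v → φ u < φ v) {u v : V} (huv : Relation.TransGen r u v) : φ u < φ v := by
  induction huv with
  | single h' => exact h _ _ h'
  | tail _ h' ih => exact ih.trans (h _ _ h')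

theorem inducedOrientation_eq_not_swap {V α : Type*} [LinearOrder α] {G : SimpleGraph V}
    {φ : V → α} {u v : V} (huv : G.Adj u v) (hne : φ u ≠ φ v) :
    inducedOrientation G φ u v = !inducedOrientation G φ v u := by
  rw [Bool.eq_iff_iff, Bool.not_eq_true', ← Bool.not_eq_true, inducedOrientation_eq_true_iff,
    inducedOrientation_eq_true_iff]
  simp [huv, huv.symm, hne.le_iff_lt]

/-- Given an orientation `o` of `G`, the proper colorings inducing `o` are the maps that increase
strictly along directed paths of `o`. -/
theorem proper_and_inducedOrientation_eq_iff {V α : Type*} [LinearOrder α] {G : SimpleGraph V}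
    {o : V → V → Bool} (hadj : ∀ u v, o u v = true → G.Adj u v)
    (hswap : ∀ u v, G.Adj u v → o u v = !o v u) (φ : V → α) :
    ((∀ u v, G.Adj u v → φ u ≠ φ v) ∧ inducedOrientation G φ = o) ↔
      ∀ u v, Relation.TransGen (fun a b => o a b = true) u v → φ u < φ v := by
  constructor
  · rintro ⟨-, rfl⟩ u v
    exact lt_of_transGen fun a b hab => (inducedOrientation_eq_true_iff.1 hab).2
  · intro h
    have hlt : ∀ u v, o u v = true → φ u < φ v := fun u v huv => h u v (.single huv)
    have hdir : ∀ u v, G.Adj u v → o u v = true ∨ o v u = true := fun u v huv => by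
      have := hswap u v huv
      cases hvu : o v u <;> simp [this, hvu]
    refine ⟨fun u v huv => ?_, ?_⟩
    · exact (hdir u v huv).elim (fun h' => (hlt u v h').ne) fun h' => (hlt v u h').ne'
    · funext u v
      rw [Bool.eq_iff_iff, inducedOrientation_eq_true_iff]
      refine ⟨fun ⟨huv, hφ⟩ => ?_, fun huv => ⟨hadj u v huv, hlt u v huv⟩⟩
      exact (hdir u v huv).resolve_right fun hvu => (hlt v u hvu).asymm hφ

/-- **Proposition (Stanley).** The chromatic polynomial of a finite simple graph `G` on
`{1,…,d}` is the sum, over all acyclic orientations `ρ` of `G`, of the number of maps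
`φ : {1,…,d} → {1,…,n}` with `φ(u) < φ(v)` whenever there is a nonempty directed path
from `u` to `v` in `ρ` (the strict order polynomial of the poset `Π_ρ`). -/
theorem chromatic_as_acyclic_orientations (d : ℕ) (G : SimpleGraph (Fin d)) (n : ℕ) :
    Nat.card {φ : Fin d → Fin n // ∀ u v, G.Adj u v → φ u ≠ φ v} =
      ∑ o ∈ Finset.univ.filter (fun o : Fin d → Fin d → Bool =>
          (∀ u v, o u v = true → G.Adj u v) ∧
          (∀ u v, G.Adj u v → o u v = !o v u) ∧
          (∀ u, ¬ Relation.TransGen (fun a b => o a b = true) u u)),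
        Nat.card {φ : Fin d → Fin n //
          ∀ u v, Relation.TransGen (fun a b => o a b = true) u v → φ u < φ v} := by
  rw [Nat.card_eq_fintype_card, Fintype.card_subtype,
    Finset.card_eq_sum_card_fiberwise (f := inducedOrientation G)]
  · refine Finset.sum_congr rfl fun o ho => ?_
    obtain ⟨hadj, hswap, -⟩ := (Finset.mem_filter.1 ho).2
    rw [Nat.card_eq_fintype_card, Fintype.card_subtype, Finset.filter_filter]
    simp only [proper_and_inducedOrientation_eq_iff hadj hswap]
  · intro φ hφ
    have hproper := (Finset.mem_filter.1 hφ).2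
    refine Finset.mem_filter.2 ⟨Finset.mem_univ _,
      fun u v huv => (inducedOrientation_eq_true_iff.1 huv).1,
      fun u v huv => inducedOrientation_eq_not_swap huv (hproper u v huv), fun u hu => ?_⟩
    exact (lt_of_transGen (fun a b hab => (inducedOrientation_eq_true_iff.1 hab).2) hu).false
end

section
/- Let G be a finite simple graph on d ≥ 1 vertices and let h_G ∈ ℤ[z] be the polynomial with (1−z)^{d+1} · Σ_{n≥0} χ_G(n) z^n = h_G(z) as formal power series over ℤ. Then the coefficient of z^d in h_G equals the number of acyclic orientations of G. -/
theorem sum_powerset_erase_empty_neg_one_pow {V : Type*} [DecidableEq V] {M : Finset V}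
    (hM : M.Nonempty) :
    ∑ S ∈ M.powerset.erase ∅, (-1 : ℤ) ^ (S.card - 1) = 1 := by
  have h := Finset.sum_powerset_neg_one_pow_card_of_nonempty hM
  rw [← Finset.add_sum_erase _ _ (Finset.empty_mem_powerset _)] at h
  have h' : ∑ S ∈ M.powerset.erase ∅, (-1 : ℤ) ^ (S.card - 1) =
      -∑ S ∈ M.powerset.erase ∅, (-1 : ℤ) ^ S.card := by
    rw [← Finset.sum_neg_distrib]
    refine Finset.sum_congr rfl fun S hS => ?_
    have hS : S.Nonempty := Finset.nonempty_iff_ne_empty.2 (Finset.mem_erase.1 hS).1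
    obtain ⟨k, hk⟩ := Nat.exists_eq_succ_of_ne_zero hS.card_pos.ne'
    simp [hk, pow_succ]
  rw [h']
  simp only [Finset.card_empty, pow_zero] at h
  linarith

open scoped Classical in
/-- The maps `V → ℕ` that vanish off `W`, are less than `n` on `W` and strictly decrease along
`r` on `W`. -/
noncomputable def strictMaps {V : Type*} [Fintype V] (r : V → V → Prop) (W : Finset V) (n : ℕ) :
    Finset (V → ℕ) :=
  (Fintype.piFinset fun v => if v ∈ W then Finset.range n else {0}).filter
    fun φ => ∀ u ∈ W, ∀ v ∈ W, r u v → φ v < φ u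

section StrictMaps

variable {V : Type*} [Fintype V] {r : V → V → Prop}

theorem mem_strictMaps {W : Finset V} {n : ℕ} {φ : V → ℕ} :
    φ ∈ strictMaps r W n ↔ (∀ v ∈ W, φ v < n) ∧ (∀ v ∉ W, φ v = 0) ∧
      ∀ u ∈ W, ∀ v ∈ W, r u v → φ v < φ u := by
  classical
  simp only [strictMaps, Finset.mem_filter, Fintype.mem_piFinset, ← and_assoc]
  refine and_congr_left fun _ => ⟨fun h => ⟨fun v hv => ?_, fun v hv => ?_⟩, fun h v => ?_⟩
  · simpa [hv] using h v
  · simpa [hv] using h v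
  · by_cases hv : v ∈ W
    · simpa [hv] using h.1 v hv
    · simpa [hv] using h.2 v hv

theorem strictMaps_empty (n : ℕ) : strictMaps r ∅ n = {0} := by
  ext φ
  simp [mem_strictMaps, funext_iff]

theorem strictMaps_zero {W : Finset V} (hW : W.Nonempty) : strictMaps r W 0 = ∅ := by
  ext φ
  obtain ⟨v, hv⟩ := hW
  simpa [mem_strictMaps] using fun h => absurd hv (h v)

open scoped Classical in
/-- The elements of `W` with no `r`-predecessor in `W`. -/
noncomputable def sourcesIn (r : V → V → Prop) (W : Finset V) : Finset V :=
  W.filter fun v => ∀ u ∈ W, ¬ r u v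

theorem mem_sourcesIn {W : Finset V} {v : V} :
    v ∈ sourcesIn r W ↔ v ∈ W ∧ ∀ u ∈ W, ¬ r u v := by
  simp [sourcesIn]

theorem sourcesIn_subset (W : Finset V) : sourcesIn r W ⊆ W :=
  fun _ hv => (mem_sourcesIn.1 hv).1

theorem sourcesIn_nonempty (hr : WellFounded r) {W : Finset V} (hW : W.Nonempty) :
    (sourcesIn r W).Nonempty := by
  obtain ⟨m, hm, hmin⟩ := hr.has_min (W : Set V) hW
  exact ⟨m, mem_sourcesIn.2 ⟨hm, fun u hu => hmin u hu⟩⟩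

theorem card_strictMaps_succ [DecidableEq V] (W : Finset V) (n : ℕ) :
    (strictMaps r W (n + 1)).card =
      ∑ S ∈ (sourcesIn r W).powerset, (strictMaps r (W \ S) n).card := by
  rw [Finset.card_eq_sum_card_fiberwise (f := fun φ => W.filter (φ · = n))
    (t := (sourcesIn r W).powerset)]
  · refine Finset.sum_congr rfl fun S hS => ?_
    have hSW : S ⊆ W := (Finset.mem_powerset.1 hS).trans (sourcesIn_subset W)
    have hsource : ∀ v ∈ S, ∀ u ∈ W, ¬ r u v := fun v hv =>
      (mem_sourcesIn.1 (Finset.mem_powerset.1 hS hv)).2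
    refine Finset.card_nbij' (fun φ v => if v ∈ S then 0 else φ v)
      (fun φ v => if v ∈ S then n else φ v) ?_ ?_ ?_ ?_
    · intro φ hφ
      simp only [Finset.coe_filter, Set.mem_ofPred_eq, mem_strictMaps, Finset.ext_iff,
        Finset.mem_filter] at hφ
      simp only [Finset.mem_coe, mem_strictMaps, Finset.mem_sdiff]
      grind
    · intro φ hφ
      simp only [Finset.mem_coe, mem_strictMaps, Finset.mem_sdiff] at hφ
      simp only [Finset.coe_filter, Set.mem_ofPred_eq, mem_strictMaps, Finset.ext_iff,
        Finset.mem_filter]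
      grind
    · intro φ hφ
      simp only [Finset.coe_filter, Set.mem_ofPred_eq, Finset.ext_iff, Finset.mem_filter] at hφ
      funext v
      grind
    · intro φ hφ
      simp only [Finset.mem_coe, mem_strictMaps, Finset.mem_sdiff] at hφ
      funext v
      grind
  · intro φ hφ
    simp only [Finset.mem_coe, mem_strictMaps] at hφ
    simp only [Finset.coe_powerset, Set.mem_preimage, Set.mem_powerset_iff, Finset.coe_subset]
    intro v hv
    rw [Finset.mem_filter] at hv
    refine mem_sourcesIn.2 ⟨hv.1, fun u hu huv => ?_⟩
    have := hφ.1 u hu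
    have := hφ.2.2 u hu v hv.1 huv
    omega

/-- The generating function of the numbers of strict maps. -/
noncomputable def strictSeries (r : V → V → Prop) (W : Finset V) : PowerSeries ℤ :=
  PowerSeries.mk fun n => ((strictMaps r W n).card : ℤ)

theorem one_sub_X_mul_strictSeries [DecidableEq V] {W : Finset V} (hW : W.Nonempty) :
    (1 - PowerSeries.X) * strictSeries r W =
      PowerSeries.X * ∑ S ∈ (sourcesIn r W).powerset.erase ∅, strictSeries r (W \ S) := by
  have key : strictSeries r W =
      PowerSeries.X * ∑ S ∈ (sourcesIn r W).powerset, strictSeries r (W \ S) := by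
    ext n
    cases n with
    | zero => simp [strictSeries, strictMaps_zero hW]
    | succ n => simp [strictSeries, PowerSeries.coeff_succ_X_mul, card_strictMaps_succ]
  rw [← Finset.add_sum_erase _ _ (Finset.empty_mem_powerset _), Finset.sdiff_empty] at key
  linear_combination key

theorem exists_numerator_strictSeries (hr : WellFounded r) (W : Finset V) :
    ∃ p : Polynomial ℤ, p.natDegree ≤ W.card ∧ p.coeff W.card = 1 ∧
      (1 - PowerSeries.X) ^ (W.card + 1) * strictSeries r W = (p : PowerSeries ℤ) := by
  classical
  induction W using Finset.strongInduction with
  | H W ih =>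
  rcases W.eq_empty_or_nonempty with rfl | hW
  · refine ⟨1, by simp, by simp, ?_⟩
    simp only [strictSeries, strictMaps_empty]
    simpa [mul_comm, Pi.one_def] using PowerSeries.mk_one_mul_one_sub_eq_one ℤ
  choose! p hdeg hlead hp using ih
  have hsub : ∀ S ∈ (sourcesIn r W).powerset.erase ∅,
      W \ S ⊂ W ∧ 0 < S.card ∧ (W \ S).card + S.card = W.card := by
    intro S hS
    obtain ⟨hne, hS⟩ := Finset.mem_erase.1 hS
    have hSW := (Finset.mem_powerset.1 hS).trans (sourcesIn_subset W)
    have hne := Finset.nonempty_iff_ne_empty.2 hne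
    exact ⟨Finset.sdiff_ssubset hSW hne, hne.card_pos, Finset.card_sdiff_add_card_eq_card hSW⟩
  have hdeg' : ∀ k : ℕ, ((1 - Polynomial.X : Polynomial ℤ) ^ k).natDegree ≤ k := fun k => by
    compute_degree
  have hlead' : ∀ k : ℕ, ((1 - Polynomial.X : Polynomial ℤ) ^ k).coeff k = (-1) ^ k := fun k => by
    have h := Polynomial.coeff_pow_of_natDegree_le (p := (1 - Polynomial.X : Polynomial ℤ)) (n := 1)
      (by compute_degree) (m := k)
    simpa [Polynomial.coeff_one] using h
  have hterm : ∀ S ∈ (sourcesIn r W).powerset.erase ∅,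
      ((1 - Polynomial.X : Polynomial ℤ) ^ (S.card - 1) * p (W \ S)).natDegree ≤ W.card - 1 ∧
      ((1 - Polynomial.X : Polynomial ℤ) ^ (S.card - 1) * p (W \ S)).coeff (W.card - 1) =
        (-1) ^ (S.card - 1) := by
    intro S hS
    obtain ⟨hlt, hpos, hcard⟩ := hsub S hS
    have hWc : W.card - 1 = (S.card - 1) + (W \ S).card := by omega
    rw [hWc]
    refine ⟨Polynomial.natDegree_mul_le_of_le (hdeg' _) (hdeg _ hlt), ?_⟩
    rw [Polynomial.coeff_mul_add_eq_of_natDegree_le (hdeg' _) (hdeg _ hlt), hlead',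
      hlead _ hlt, mul_one]
  have hWcard : W.card = W.card - 1 + 1 := by have := hW.card_pos; omega
  refine ⟨Polynomial.X * ∑ S ∈ (sourcesIn r W).powerset.erase ∅,
    (1 - Polynomial.X) ^ (S.card - 1) * p (W \ S), ?_, ?_, ?_⟩
  · rw [hWcard, add_comm]
    exact Polynomial.natDegree_mul_le_of_le Polynomial.natDegree_X_le
      (Polynomial.natDegree_sum_le_of_forall_le _ _ fun S hS => (hterm S hS).1)
  · rw [hWcard, Polynomial.coeff_X_mul, Polynomial.finsetSum_coeff,
      Finset.sum_congr rfl fun S hS => (hterm S hS).2]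
    exact sum_powerset_erase_empty_neg_one_pow (sourcesIn_nonempty hr hW)
  · rw [pow_succ, mul_assoc, one_sub_X_mul_strictSeries hW, mul_left_comm, Finset.mul_sum,
      Polynomial.coe_mul, Polynomial.coe_X, ← Polynomial.coeToPowerSeries.ringHom_apply, map_sum]
    congr 1
    refine Finset.sum_congr rfl fun S hS => ?_
    obtain ⟨hlt, hpos, hcard⟩ := hsub S hS
    have hWc : W.card = (S.card - 1) + ((W \ S).card + 1) := by omega
    rw [hWc, pow_add, mul_assoc, hp _ hlt]
    simp

theorem coeff_card_one_sub_X_pow_mul_strictSeries (hr : WellFounded r) (W : Finset V) :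
    PowerSeries.coeff W.card ((1 - PowerSeries.X) ^ (W.card + 1) * strictSeries r W) = 1 := by
  obtain ⟨p, -, hlead, hp⟩ := exists_numerator_strictSeries hr W
  rw [hp, Polynomial.coeff_coe, hlead]

end StrictMaps

theorem wellFounded_of_transGen_irrefl {V : Type*} [Finite V] {r : V → V → Prop}
    (h : ∀ u, ¬ Relation.TransGen r u u) : WellFounded r := by
  have : Std.Irrefl (Relation.TransGen r) := ⟨h⟩
  exact Subrelation.wf (Relation.TransGen.single ·)
    (Finite.wellFounded_of_trans_of_irrefl (Relation.TransGen r))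

namespace SimpleGraph

variable {V : Type*} (G : SimpleGraph V)

/-- `o` encodes an acyclic orientation of `G`. -/
def IsAcyclicOrientation (o : V → V → Bool) : Prop :=
  (∀ u v, o u v = true → G.Adj u v) ∧
  (∀ u v, G.Adj u v → o u v = !o v u) ∧
  (∀ u, ¬ Relation.TransGen (fun a b => o a b = true) u u)

open scoped Classical in
/-- The orientation of `G` that directs each edge towards the smaller color. -/
noncomputable def orientationOfColoring {n : ℕ}
    (φ : {φ : V → Fin n // ∀ u v, G.Adj u v → φ u ≠ φ v}) :
    {o : V → V → Bool // G.IsAcyclicOrientation o} :=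
  ⟨fun u v => decide (G.Adj u v ∧ φ.1 v < φ.1 u), by simp_all, by
    intro u v huv
    rcases lt_or_gt_of_ne (φ.2 u v huv) with h | h <;> simp [huv, huv.symm, h, h.le], by
    intro u hu
    have key : ∀ v, Relation.TransGen
        (fun a b => decide (G.Adj a b ∧ φ.1 b < φ.1 a) = true) u v → φ.1 v < φ.1 u := by
      intro v hv
      induction hv with
      | single h => exact (of_decide_eq_true h).2
      | tail _ h ih => exact (of_decide_eq_true h).2.trans ih
    exact lt_irrefl _ (key u hu)⟩

theorem orientationOfColoring_apply {n : ℕ}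
    (φ : {φ : V → Fin n // ∀ u v, G.Adj u v → φ u ≠ φ v}) (u v : V) :
    (G.orientationOfColoring φ).1 u v = true ↔ G.Adj u v ∧ φ.1 v < φ.1 u := by
  simp [orientationOfColoring]

theorem orientationOfColoring_eq_iff {n : ℕ}
    (φ : {φ : V → Fin n // ∀ u v, G.Adj u v → φ u ≠ φ v})
    (o : {o : V → V → Bool // G.IsAcyclicOrientation o}) :
    G.orientationOfColoring φ = o ↔ ∀ u v, o.1 u v = true → φ.1 v < φ.1 u := by
  constructor
  · rintro rfl u v h
    exact ((G.orientationOfColoring_apply φ u v).1 h).2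
  · obtain ⟨o, ho₁, ho₂, -⟩ := o
    intro h
    refine Subtype.ext (funext₂ fun u v => Bool.eq_iff_iff.2 ?_)
    rw [orientationOfColoring_apply]
    refine ⟨fun ⟨huv, hlt⟩ => ?_, fun huv => ⟨ho₁ u v huv, h u v huv⟩⟩
    by_contra hne
    have hvu : o v u = true := by
      have := ho₂ u v huv
      grind
    exact lt_asymm hlt (h v u hvu)

theorem card_orientationOfColoring_fiber [Fintype V] (n : ℕ)
    (o : {o : V → V → Bool // G.IsAcyclicOrientation o}) :
    Nat.card {φ : {φ : V → Fin n // ∀ u v, G.Adj u v → φ u ≠ φ v} //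
      G.orientationOfColoring φ = o} =
      (strictMaps (fun a b => o.1 a b = true) Finset.univ n).card := by
  rw [← Nat.card_eq_finsetCard]
  refine Nat.card_congr
    { toFun := fun φ => ⟨fun v => φ.1.1 v, mem_strictMaps.2 ⟨fun v _ => (φ.1.1 v).2, by simp,
        fun u _ v _ => (G.orientationOfColoring_eq_iff φ.1 o).1 φ.2 u v⟩⟩
      invFun := fun ψ =>
        have hψ := mem_strictMaps.1 ψ.2
        have hlt : ∀ u v, o.1 u v = true → ψ.1 v < ψ.1 u := fun u v =>
          hψ.2.2 u (Finset.mem_univ u) v (Finset.mem_univ v)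
        ⟨⟨fun v => ⟨ψ.1 v, hψ.1 v (Finset.mem_univ v)⟩, fun u v huv heq => by
          have heq : ψ.1 u = ψ.1 v := congrArg Fin.val heq
          have ho := o.2.2.1 u v huv
          cases hvu : o.1 v u with
          | true => exact (hlt v u hvu).ne heq
          | false => exact (hlt u v (by simpa [hvu] using ho)).ne heq.symm⟩,
        (G.orientationOfColoring_eq_iff _ o).2 hlt⟩
      left_inv := fun _ => rfl
      right_inv := fun _ => rfl }

theorem card_colorings_eq_sum [Fintype V] [Fintype {o : V → V → Bool // G.IsAcyclicOrientation o}]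
    (n : ℕ) : Nat.card {φ : V → Fin n // ∀ u v, G.Adj u v → φ u ≠ φ v} =
      ∑ o : {o : V → V → Bool // G.IsAcyclicOrientation o},
        (strictMaps (fun a b => o.1 a b = true) Finset.univ n).card := by
  rw [Nat.card_congr (Equiv.sigmaFiberEquiv (G.orientationOfColoring (n := n))).symm,
    Nat.card_sigma]
  exact Finset.sum_congr rfl fun o _ => G.card_orientationOfColoring_fiber n o

end SimpleGraph

/-- **Observation.** For a finite simple graph `G` on `d ≥ 1` vertices, the leading
coefficient (at `z^d`) of the numerator polynomial `h_G` of the chromatic series equals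
the number of acyclic orientations of `G`. -/
theorem leading_coeff_counts_acyclic_orientations (d : ℕ) (hd : 1 ≤ d)
    (G : SimpleGraph (Fin d)) (h : Polynomial ℤ)
    (hh : (1 - PowerSeries.X) ^ (d + 1) *
        PowerSeries.mk (fun n =>
          (Nat.card {φ : Fin d → Fin n // ∀ u v, G.Adj u v → φ u ≠ φ v} : ℤ)) =
      (h : PowerSeries ℤ)) :
    h.coeff d = (Nat.card {o : Fin d → Fin d → Bool //
      (∀ u v, o u v = true → G.Adj u v) ∧
      (∀ u v, G.Adj u v → o u v = !o v u) ∧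
      (∀ u, ¬ Relation.TransGen (fun a b => o a b = true) u u)} : ℤ) := by
  classical
  change _ = (Nat.card {o : Fin d → Fin d → Bool // G.IsAcyclicOrientation o} : ℤ)
  have hseries : PowerSeries.mk (fun n =>
      (Nat.card {φ : Fin d → Fin n // ∀ u v, G.Adj u v → φ u ≠ φ v} : ℤ)) =
      ∑ o : {o : Fin d → Fin d → Bool // G.IsAcyclicOrientation o},
        strictSeries (fun a b => o.1 a b = true) Finset.univ := by
    ext n
    rw [PowerSeries.coeff_mk, G.card_colorings_eq_sum]
    simp [strictSeries]
  rw [← Polynomial.coeff_coe, ← hh, hseries, Finset.mul_sum, map_sum,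
    Finset.sum_congr rfl fun o _ => show _ = (1 : ℤ) by
      simpa using coeff_card_one_sub_X_pow_mul_strictSeries
        (wellFounded_of_transGen_irrefl o.2.2.2) Finset.univ]
  simp
end

section
/- Let G be a finite simple graph on the vertex set {1,…,d}, d ≥ 1. For each acyclic orientation ρ of G, let Π_ρ be the partial order on {1,…,d} given by the reflexive-transitive closure of the relation o_ρ, and let O_{Π_ρ} ⊆ ℝ^d be its order polytope. Then, as formal power series over ℤ, z · (1−z)^{d+1} · Σ_{n≥0} χ_G(n) z^n = Σ_{ρ acyclic} (1−z)^{d+1} · Σ_{n≥1} L°_{O_{Π_ρ}}(n) z^n; that is, z·h_G(z) is the sum over all acyclic orientations ρ of G of the numerator polynomials of the Ehrhart series of the open order polytopes O°_{Π_ρ}. -/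
open scoped Classical

open scoped Pointwise

/-- A point is interior to the `n`-th dilate of the order polytope of the preorder
generated by an irreflexive relation iff it satisfies all defining inequalities strictly. -/
theorem mem_interior_smul_orderPolytope_iff {d : ℕ} (r : Fin d → Fin d → Prop)
    (hr : ∀ i, ¬ r i i) {n : ℝ} (hn : 0 < n) (x : Fin d → ℝ) :
    x ∈ interior (n • {y : Fin d → ℝ | (∀ i, 0 ≤ y i ∧ y i ≤ 1) ∧
        ∀ i j, Relation.ReflTransGen r i j → y i ≤ y j}) ↔
      (∀ i, 0 < x i ∧ x i < n) ∧ ∀ i j, r i j → x i < x j := by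
  have key : ∀ z : Fin d → ℝ, z ∈ n • {y : Fin d → ℝ | (∀ i, 0 ≤ y i ∧ y i ≤ 1) ∧
        ∀ i j, Relation.ReflTransGen r i j → y i ≤ y j} ↔
      (∀ i, 0 ≤ z i ∧ z i ≤ n) ∧ ∀ i j, r i j → z i ≤ z j := by
    intro z
    rw [Set.mem_smul_set_iff_inv_smul_mem₀ hn.ne']
    simp only [Set.mem_ofPred_eq, Pi.smul_apply, smul_eq_mul]
    have h1 : ∀ i, (0 ≤ n⁻¹ * z i ∧ n⁻¹ * z i ≤ 1) ↔ (0 ≤ z i ∧ z i ≤ n) := by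
      intro i
      rw [mul_nonneg_iff_of_pos_left (inv_pos.2 hn), inv_mul_le_iff₀ hn, mul_one]
    have h2 : ∀ i j, n⁻¹ * z i ≤ n⁻¹ * z j ↔ z i ≤ z j :=
      fun i j => mul_le_mul_iff_right₀ (inv_pos.2 hn)
    simp only [h1, h2]
    refine and_congr_right fun _ =>
      ⟨fun h i j hij => h i j (Relation.ReflTransGen.single hij), fun h i j hij => ?_⟩
    induction hij with
    | refl => exact le_rfl
    | tail _ hbc ih => exact ih.trans (h _ _ hbc)
  constructor
  · intro hx
    have shift : ∀ (v : Fin d → ℝ), ∃ ε > 0, (∀ i, 0 ≤ x i + ε * v i ∧ x i + ε * v i ≤ n) ∧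
        ∀ i j, r i j → x i + ε * v i ≤ x j + ε * v j := by
      intro v
      have hc : Filter.Tendsto (fun ε : ℝ => x + ε • v) (nhdsWithin 0 (Set.Ioi 0)) (nhds x) := by
        have : Continuous (fun ε : ℝ => x + ε • v) := by fun_prop
        simpa using (this.tendsto 0).mono_left nhdsWithin_le_nhds
      obtain ⟨ε, hε, hpos⟩ :=
        ((hc.eventually (mem_interior_iff_mem_nhds.1 hx)).and self_mem_nhdsWithin).exists
      exact ⟨ε, hpos, by simpa using (key _).1 hε⟩
    refine ⟨fun i => ⟨?_, ?_⟩, fun i j hij => ?_⟩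
    · obtain ⟨ε, hε, h, -⟩ := shift (fun _ => -1)
      linarith [(h i).1]
    · obtain ⟨ε, hε, h, -⟩ := shift (fun _ => 1)
      linarith [(h i).2]
    · obtain ⟨ε, hε, -, h⟩ := shift (Pi.single i 1)
      have hne : j ≠ i := fun e => hr i (e ▸ hij)
      have := h i j hij
      simp only [Pi.single_eq_same, Pi.single_eq_of_ne hne] at this
      linarith
  · rintro ⟨h1, h2⟩
    refine mem_interior.2 ⟨{z | (∀ i, 0 < z i ∧ z i < n) ∧ ∀ i j, r i j → z i < z j},
      fun z hz => (key z).2 ⟨fun i => ⟨(hz.1 i).1.le, (hz.1 i).2.le⟩,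
        fun i j hij => (hz.2 i j hij).le⟩, ?_, h1, h2⟩
    simp only [Set.ofPred_and, Set.ofPred_forall]
    refine IsOpen.inter (isOpen_iInter_of_finite fun i => IsOpen.inter ?_ ?_)
      (isOpen_iInter_of_finite fun i => isOpen_iInter_of_finite fun j =>
        isOpen_iInter_of_finite fun _ => ?_)
    · exact isOpen_lt continuous_const (continuous_apply i)
    · exact isOpen_lt (continuous_apply i) continuous_const
    · exact isOpen_lt (continuous_apply i) (continuous_apply j)

/-- The orientation of `G` directing each edge towards its endpoint of larger color. -/
noncomputable def orientationOfColoring {d m : ℕ} (G : SimpleGraph (Fin d)) (φ : Fin d → Fin m) :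
    Fin d → Fin d → Bool :=
  fun u v => decide (G.Adj u v ∧ φ u < φ v)

theorem orientationOfColoring_eq_true {d m : ℕ} {G : SimpleGraph (Fin d)} {φ : Fin d → Fin m}
    {u v : Fin d} : orientationOfColoring G φ u v = true ↔ G.Adj u v ∧ φ u < φ v := by
  simp [orientationOfColoring]

/-- The orientation induced by a proper coloring is `o` iff the coloring increases along `o`. -/
theorem proper_and_orientationOfColoring_eq_iff {d m : ℕ} {G : SimpleGraph (Fin d)}
    {o : Fin d → Fin d → Bool} (h1 : ∀ u v, o u v = true → G.Adj u v)
    (h2 : ∀ u v, G.Adj u v → o u v = !o v u) (φ : Fin d → Fin m) :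
    ((∀ u v, G.Adj u v → φ u ≠ φ v) ∧ orientationOfColoring G φ = o) ↔
      ∀ u v, o u v = true → φ u < φ v := by
  constructor
  · rintro ⟨-, rfl⟩ u v h
    exact (orientationOfColoring_eq_true.1 h).2
  · intro h
    have or_of_adj : ∀ u v, G.Adj u v → o u v = true ∨ o v u = true := by
      intro u v huv
      have := h2 u v huv
      cases hvu : o v u
      · exact Or.inl (by rw [this, hvu, Bool.not_false])
      · exact Or.inr rfl
    refine ⟨fun u v huv => ?_, ?_⟩
    · rcases or_of_adj u v huv with h' | h'
      · exact (h u v h').ne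
      · exact (h v u h').ne'
    · funext u v
      rw [Bool.eq_iff_iff, orientationOfColoring_eq_true]
      refine ⟨fun ⟨huv, hlt⟩ => ?_, fun huv => ⟨h1 u v huv, h u v huv⟩⟩
      exact (or_of_adj u v huv).resolve_right fun h' => lt_asymm hlt (h v u h')

theorem not_transGen_orientationOfColoring {d m : ℕ} (G : SimpleGraph (Fin d))
    (φ : Fin d → Fin m) (u : Fin d) :
    ¬ Relation.TransGen (fun a b => orientationOfColoring G φ a b = true) u u := by
  have mono : ∀ v, Relation.TransGen (fun a b => orientationOfColoring G φ a b = true) u v →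
      φ u < φ v := by
    intro v h
    induction h with
    | single h => exact (orientationOfColoring_eq_true.1 h).2
    | tail _ h ih => exact ih.trans (orientationOfColoring_eq_true.1 h).2
  exact fun h => lt_irrefl _ (mono u h)

/-- Shifting colors by one identifies colorings that increase along `r` with
lattice points in the interior of a dilated order polytope. -/
theorem ncard_interior_smul_orderPolytope {d : ℕ} (m : ℕ) (r : Fin d → Fin d → Prop)
    (hr : ∀ i, ¬ r i i) :
    Set.ncard {x : Fin d → ℤ |
        (fun i => (x i : ℝ)) ∈ interior (((m + 1 : ℕ) : ℝ) •
          {y : Fin d → ℝ | (∀ i, 0 ≤ y i ∧ y i ≤ 1) ∧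
            ∀ i j, Relation.ReflTransGen r i j → y i ≤ y j})} =
      Set.ncard {φ : Fin d → Fin m | ∀ u v, r u v → φ u < φ v} := by
  have hinj : Function.Injective (fun (φ : Fin d → Fin m) i => ((φ i : ℕ) : ℤ) + 1) := by
    intro φ ψ h
    funext i
    have := congrFun h i
    simp only at this
    exact Fin.ext (by omega)
  rw [← Set.ncard_image_of_injective _ hinj]
  congr 1
  ext x
  rw [Set.mem_ofPred_eq, mem_interior_smul_orderPolytope_iff r hr (by positivity)]
  have hcast : ((m + 1 : ℕ) : ℝ) = (((m + 1 : ℕ) : ℤ) : ℝ) := by push_cast; rfl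
  rw [hcast]
  simp only [Int.cast_pos, Int.cast_lt, Set.mem_image, Set.mem_ofPred_eq]
  constructor
  · rintro ⟨hx, hlt⟩
    refine ⟨fun i => ⟨(x i - 1).toNat, ?_⟩, fun u v huv => ?_, funext fun i => ?_⟩
    · have := hx i
      omega
    · have := hx u
      have := hlt u v huv
      rw [Fin.mk_lt_mk]
      omega
    · have := hx i
      simp only
      omega
  · rintro ⟨φ, hφ, rfl⟩
    refine ⟨fun i => ?_, fun i j hij => ?_⟩
    · have := (φ i).isLt
      push_cast
      omega
    · have := Fin.lt_def.1 (hφ i j hij)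
      simp only
      omega

/-- **Identity (5.1).** For a finite simple graph `G` on `{1,…,d}`, `z·h_G(z)` — where
`h_G` is the numerator of the chromatic series — equals the sum over all acyclic
orientations `ρ` of `G` of the numerator polynomials of the Ehrhart series of the open
order polytopes `O°_{Π_ρ}`, where `Π_ρ` is the reflexive-transitive closure of the
orientation relation. -/
theorem chromatic_numerator_as_sum_over_orientations (d : ℕ) (hd : 1 ≤ d)
    (G : SimpleGraph (Fin d)) :
    PowerSeries.X * ((1 - PowerSeries.X) ^ (d + 1) *
        PowerSeries.mk (fun n =>
          (Nat.card {φ : Fin d → Fin n // ∀ u v, G.Adj u v → φ u ≠ φ v} : ℤ))) =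
    ∑ o ∈ Finset.univ.filter (fun o : Fin d → Fin d → Bool =>
        (∀ u v, o u v = true → G.Adj u v) ∧
        (∀ u v, G.Adj u v → o u v = !o v u) ∧
        (∀ u, ¬ Relation.TransGen (fun a b => o a b = true) u u)),
      (1 - PowerSeries.X) ^ (d + 1) *
        PowerSeries.mk (fun n =>
          if n = 0 then 0 else
            (Set.ncard {x : Fin d → ℤ |
              (fun i => (x i : ℝ)) ∈ interior ((n : ℝ) •
                {y : Fin d → ℝ | (∀ i, 0 ≤ y i ∧ y i ≤ 1) ∧
                  ∀ i j, Relation.ReflTransGen (fun a b => o a b = true) i j →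
                    y i ≤ y j})} : ℤ)) := by
  rw [← Finset.mul_sum, mul_left_comm]
  congr 1
  ext n
  rw [map_sum]
  simp only [PowerSeries.coeff_mk]
  rcases n with _ | m
  · simp
  simp only [PowerSeries.coeff_succ_X_mul, PowerSeries.coeff_mk, Nat.succ_ne_zero, if_false]
  rw [← Nat.cast_sum, Nat.cast_inj, Nat.card_eq_fintype_card, Fintype.card_subtype,
    Finset.card_eq_sum_card_fiberwise (f := orientationOfColoring G)]
  · refine Finset.sum_congr rfl fun o ho => ?_
    obtain ⟨-, h1, h2, h3⟩ := Finset.mem_filter.1 ho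
    rw [ncard_interior_smul_orderPolytope m (fun a b => o a b = true)
      fun i hi => h3 i (Relation.TransGen.single hi), ← Set.ncard_coe_finset]
    congr 1
    ext φ
    simpa using proper_and_orientationOfColoring_eq_iff h1 h2 φ
  · intro φ hφ
    have hφ := (Finset.mem_filter.1 hφ).2
    refine Finset.mem_coe.2 (Finset.mem_filter.2 ⟨Finset.mem_univ _,
      fun u v h => (orientationOfColoring_eq_true.1 h).1, fun u v huv => ?_,
      not_transGen_orientationOfColoring G φ⟩)
    have hne := hφ u v huv
    rw [Bool.eq_iff_iff, Bool.not_eq_true', ← Bool.not_eq_true, orientationOfColoring_eq_true,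
      orientationOfColoring_eq_true]
    simp only [huv, huv.symm, true_and, not_lt]
    exact ⟨le_of_lt, fun h => lt_of_le_of_ne h hne⟩
end
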